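/- Classification of contact symmetries: let Q : ℝ⁵ → ℝ be a smooth function of the variables (x, t, u, p, q) such that for every smooth solution u : ℝ² → ℝ of the short pulse equation, the function Q̃(x,t) = Q(x, t, u(x,t), ∂x u(x,t), ∂t u(x,t)) satisfies the linearized symmetry equation ∂x∂t Q̃ = α·Q̃ + β·∂x∂x(u²·Q̃) at every point of ℝ². Then there exist constants C₁, C₂, C₃ ∈ ℝ such that Q(x,t,u,p,q) = C₁·p + C₂·q + C₃·(x·p − t·q − u) for all (x,t,u,p,q). In particular, every contact symmetry of the SPE is a point symmetry, and the Lie algebra of point symmetries is three-dimensional, spanned by the x-translation, the t-translation, and the dilation. -/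

import Mathlib

/-- Partial derivative with respect to the first variable `x`. -/
noncomputable def pdx (u : ℝ → ℝ → ℝ) : ℝ → ℝ → ℝ := fun x t => deriv (fun x' => u x' t) x

/-- Partial derivative with respect to the second variable `t`. -/
noncomputable def pdt (u : ℝ → ℝ → ℝ) : ℝ → ℝ → ℝ := fun x t => deriv (fun t' => u x t') t

/-- Smoothness (C^∞) of a function of two real variables. -/
def Smooth2 (u : ℝ → ℝ → ℝ) : Prop := ContDiff ℝ (⊤ : ℕ∞) (fun p : ℝ × ℝ => u p.1 p.2)

/-- `u` is a smooth solution of the short pulse equation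
`∂x ∂t u = α u + (β/3) ∂x ∂x (u³)`. -/
def IsSPESol (α β : ℝ) (u : ℝ → ℝ → ℝ) : Prop :=
  Smooth2 u ∧ ∀ x t : ℝ,
    pdx (pdt u) x t = α * u x t + β / 3 * pdx (pdx (fun x t => u x t ^ 3)) x t

/-- `Q` satisfies the linearized symmetry equation of the SPE along `u`:
`∂x ∂t Q = α Q + β ∂x ∂x (u² Q)`. -/
def SatisfiesLinearized (α β : ℝ) (u Q : ℝ → ℝ → ℝ) : Prop :=
  ∀ x t : ℝ,
    pdx (pdt Q) x t = α * Q x t + β * pdx (pdx (fun x t => u x t ^ 2 * Q x t)) x t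

/-- Solution of the determining equations of the contact symmetries of the short pulse equation,
in a commutative differential algebra with coordinates `x, t, u, p, q`. -/
theorem determining_equations_solve {R : Type*} [CommRing R] [Algebra ℝ R]
    (d₁ d₂ d₃ d₄ d₅ : Derivation ℝ R R)
    (c₁₂ : ∀ f, d₂ (d₁ f) = d₁ (d₂ f)) (c₁₃ : ∀ f, d₃ (d₁ f) = d₁ (d₃ f))
    (c₁₄ : ∀ f, d₄ (d₁ f) = d₁ (d₄ f)) (c₁₅ : ∀ f, d₅ (d₁ f) = d₁ (d₅ f))
    (c₂₃ : ∀ f, d₃ (d₂ f) = d₂ (d₃ f)) (c₂₄ : ∀ f, d₄ (d₂ f) = d₂ (d₄ f))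
    (c₂₅ : ∀ f, d₅ (d₂ f) = d₂ (d₅ f)) (c₃₄ : ∀ f, d₄ (d₃ f) = d₃ (d₄ f))
    (c₃₅ : ∀ f, d₅ (d₃ f) = d₃ (d₅ f)) (c₄₅ : ∀ f, d₅ (d₄ f) = d₄ (d₅ f))
    (u p q Q a b a' b' : R) (haa : a * a' = 1) (hbb : b * b' = 1)
    (a₁ : d₁ a = 0) (a₂ : d₂ a = 0) (a₃ : d₃ a = 0) (a₄ : d₄ a = 0) (a₅ : d₅ a = 0)
    (b₁ : d₁ b = 0) (b₂ : d₂ b = 0) (b₃ : d₃ b = 0) (b₄ : d₄ b = 0) (b₅ : d₅ b = 0)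
    (u₁ : d₁ u = 0) (u₂ : d₂ u = 0) (u₃ : d₃ u = 1) (u₄ : d₄ u = 0) (u₅ : d₅ u = 0)
    (p₁ : d₁ p = 0) (p₂ : d₂ p = 0) (p₃ : d₃ p = 0) (p₄ : d₄ p = 1) (p₅ : d₅ p = 0)
    (q₁ : d₁ q = 0) (q₂ : d₂ q = 0) (q₃ : d₃ q = 0) (q₄ : d₄ q = 0) (q₅ : d₅ q = 1)
    (hu : ∀ f, u * f = 0 → f = 0) (hu₃ : ∀ f, d₃ (u * u * u * f) = 0 → u * u * u * f = 0)
    (hN : d₄ (d₅ Q) + b * u * u * d₅ (d₅ Q) = 0)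
    (hM : u * (a + 2 * b * p * p) * d₅ (d₅ Q) + d₁ (d₅ Q) + p * d₃ (d₅ Q) = 0)
    (hE1 : d₅ (d₅ Q) = 0 → d₄ (d₅ Q) = 0 → d₃ (d₅ Q) = 0 → d₁ (d₅ Q) = 0 →
      -(b * u * u) * (d₁ (d₄ Q) + p * d₃ (d₄ Q)) + (d₂ (d₄ Q) + q * d₃ (d₄ Q))
        + b * u * u * d₂ (d₅ Q) + u * (a + 2 * b * p * p) * d₄ (d₄ Q) + 2 * b * u * p * d₄ Q
        + 2 * b * u * q * d₅ Q - 2 * b * u * Q = 0)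
    (hE0 : d₅ (d₅ Q) = 0 → d₄ (d₅ Q) = 0 → d₃ (d₅ Q) = 0 → d₁ (d₅ Q) = 0 →
      d₁ (d₂ Q) + q * d₁ (d₃ Q) + u * (a + 2 * b * p * p) * d₁ (d₄ Q)
        + p * (d₂ (d₃ Q) + q * d₃ (d₃ Q) + u * (a + 2 * b * p * p) * d₃ (d₄ Q))
        + u * (a + 2 * b * p * p) * d₂ (d₅ Q) + u * (a + 2 * b * p * p) * d₃ Q
        + (a + 2 * b * p * p) * (p * d₄ Q + q * d₅ Q - Q) - 4 * b * u * p * (d₁ Q + p * d₃ Q)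
        - b * u * u * (d₁ (d₁ Q) + 2 * p * d₁ (d₃ Q) + p * p * d₃ (d₃ Q)) = 0) :
    d₅ (d₅ Q) = 0 ∧ d₄ (d₅ Q) = 0 ∧ d₃ (d₅ Q) = 0 ∧ d₁ (d₅ Q) = 0 ∧
      d₂ (d₅ Q) = -d₁ (d₄ Q) ∧ d₂ (d₄ Q) = 0 ∧ d₃ (d₄ Q) = 0 ∧ d₄ (d₄ Q) = 0 ∧
      d₁ (d₁ (d₄ Q)) = 0 ∧ d₁ (d₂ (d₄ Q)) = 0 ∧ d₁ (d₃ (d₄ Q)) = 0 ∧ d₁ (d₄ (d₄ Q)) = 0 ∧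
      d₁ (d₄ (d₅ Q)) = 0 ∧ Q = p * d₄ Q + q * d₅ Q - u * d₁ (d₄ Q) := by
  have two : ∀ X : R, 2 * X = 0 → X = 0 := fun X h => by
    have : (2 : ℝ) • X = 0 := by rw [ofNat_smul_eq_nsmul, nsmul_eq_mul]; exact_mod_cast h
    simpa using this
  have ca : ∀ X : R, a * X = 0 → X = 0 := fun X h => by linear_combination a' * h - X * haa
  have cb : ∀ X : R, b * X = 0 → X = 0 := fun X h => by linear_combination b' * h - X * hbb
  have two' : ∀ d : Derivation ℝ R R, d 2 = 0 := fun d => by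
    have := d.map_natCast 2
    exact_mod_cast this
  have four' : ∀ d : Derivation ℝ R R, d 4 = 0 := fun d => by
    have := d.map_natCast 4
    exact_mod_cast this
  have n1 := congrArg d₁ hN
  have n3 := congrArg d₃ hN
  have n5 := congrArg d₅ hN
  have m4 := congrArg d₄ hM
  have m5 := congrArg d₅ hM
  simp only [map_add, Derivation.leibniz, smul_eq_mul, map_zero, two', a₄, a₅, b₁, b₃, b₄, b₅, u₁,
    u₃, u₄, u₅, p₄, p₅, c₁₄, c₁₅, c₃₄, c₃₅, c₄₅] at n1 n3 n5 m4 m5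
  have K : d₃ (d₅ Q) + 2 * b * u * p * d₅ (d₅ Q) = 0 := by
    linear_combination m4 + b * u * u * m5 - u * (a + 2 * b * p * p) * n5 - n1 - p * n3
  have L : a * u * d₅ (d₅ Q) + d₁ (d₅ Q) = 0 := by linear_combination hM - p * K
  have l3 := congrArg d₃ L
  have l5 := congrArg d₅ L
  have k1 := congrArg d₁ K
  have k5 := congrArg d₅ K
  simp only [map_add, Derivation.leibniz, smul_eq_mul, map_zero, two', a₃, a₅, b₁, b₅, u₁, u₃, u₅,
    p₁, p₅, c₁₃, c₁₅, c₃₅] at l3 l5 k1 k5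
  have Q55 : d₅ (d₅ Q) = 0 := ca _ (by
    linear_combination l3 - k1 + 2 * b * u * p * l5 - a * u * k5)
  have Q45 : d₄ (d₅ Q) = 0 := by linear_combination hN - b * u * u * Q55
  have Q35 : d₃ (d₅ Q) = 0 := by linear_combination K - 2 * b * u * p * Q55
  have Q15 : d₁ (d₅ Q) = 0 := by linear_combination L - a * u * Q55
  have E1 := hE1 Q55 Q45 Q35 Q15
  have E0 := hE0 Q55 Q45 Q35 Q15
  clear hE1 hE0 n1 n3 n5 m4 m5 l3 l5 k1 k5 K L hN hM
  have e15 := congrArg d₅ E1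
  simp only [map_add, map_sub, map_neg, Derivation.leibniz, smul_eq_mul, map_zero, two', a₅, b₅,
    u₅, p₅, q₅, c₁₅, c₂₅, c₃₅, c₄₅, Q55, Q45] at e15
  have Q34 : d₃ (d₄ Q) = 0 := by linear_combination e15
  have Q344 := congrArg d₄ Q34
  have Q134 := congrArg d₁ Q34
  simp only [map_zero, c₃₄] at Q344 Q134
  have E1a := congrArg d₃ E1
  simp only [map_add, map_sub, map_neg, Derivation.leibniz, smul_eq_mul, map_zero, two', a₃, b₃,
    u₃, p₃, q₃, c₁₃, c₂₃, Q35, Q34, Q344] at E1a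
  have E1b := congrArg d₃ E1a
  simp only [map_add, map_sub, map_neg, Derivation.leibniz, smul_eq_mul, map_zero, two',
    Derivation.map_one_eq_zero, a₃, b₃, u₃, p₃, q₃, c₁₃, c₂₃, Q35, Q34, Q344] at E1b
  have Y' : d₂ (d₅ Q) - d₁ (d₄ Q) - 2 * d₃ Q = u * d₃ (d₃ Q) := by
    have := cb (d₂ (d₅ Q) - d₁ (d₄ Q) - 2 * d₃ Q - u * d₃ (d₃ Q))
      (two _ (by linear_combination E1b))
    linear_combination this
  have J : b * (u * u * u * d₃ (d₃ Q)) = d₂ (d₄ Q) := by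
    linear_combination u * E1a - E1 + (q - b * u * u * p) * Q34 - b * u * u * Y'
  have j3 := congrArg d₃ J
  simp only [Derivation.leibniz, smul_eq_mul, map_zero, b₃, u₃, c₂₃, Q34] at j3
  have Q33 : d₃ (d₃ Q) = 0 := hu _ (hu _ (hu _ (by
    have := hu₃ (d₃ (d₃ Q)) (cb _ (by
      simp only [Derivation.leibniz, smul_eq_mul, u₃]
      linear_combination j3))
    linear_combination this)))
  have Q24 : d₂ (d₄ Q) = 0 := by linear_combination b * u * u * u * Q33 - J
  have Y : d₂ (d₅ Q) - d₁ (d₄ Q) - 2 * d₃ Q = 0 := by linear_combination Y' + u * Q33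
  clear j3 J Y' E1b
  have E : (a + 2 * b * p * p) * d₄ (d₄ Q)
      + 2 * b * (p * d₄ Q + q * d₅ Q - Q + u * d₃ Q) = 0 := by
    linear_combination E1a - 2 * b * u * Y
  have Y₄ := congrArg d₄ Y
  have e05 := congrArg d₅ E0
  have Q124 := congrArg d₁ Q24
  have Q244 := congrArg d₄ Q24
  have Q245 := congrArg d₂ Q45
  have Q125 : d₁ (d₂ (d₅ Q)) = 0 := by rw [← c₁₂, Q15, map_zero]
  simp only [map_add, map_sub, Derivation.leibniz, smul_eq_mul, map_zero, two', four', a₅, b₅, u₅,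
    p₅, q₅, c₁₄, c₁₅, c₂₄, c₂₅, c₃₄, c₃₅, c₄₅, Q55, Q45, Q35, Q15, Q34, Q33]
      at Y₄ e05 Q124 Q244 Q245
  have Q144 : d₁ (d₄ (d₄ Q)) = 0 := by linear_combination -Y₄
  have Q13 : d₁ (d₃ Q) = 0 := by linear_combination e05 - Q125
  have Q123 := congrArg d₂ Q13
  simp only [map_zero, c₁₂] at Q123
  have f1 := congrArg d₁ E
  have y1 := congrArg d₁ Y
  have f2 := congrArg d₂ E
  simp only [map_add, map_sub, Derivation.leibniz, smul_eq_mul, map_zero, two', a₁, a₂, b₁, b₂,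
    u₁, u₂, p₁, p₂, q₁, q₂, Q15, Q24, Q244, Q144, Q13, Q125] at f1 y1 f2
  have Q1 : d₁ Q = p * d₁ (d₄ Q) := by
    have := cb (p * d₁ (d₄ Q) - d₁ Q) (two _ (by linear_combination f1))
    linear_combination -this
  have Q114 : d₁ (d₁ (d₄ Q)) = 0 := by linear_combination -y1
  have Q2 : d₂ Q = q * d₂ (d₅ Q) + u * d₂ (d₃ Q) := by
    have := cb (q * d₂ (d₅ Q) + u * d₂ (d₃ Q) - d₂ Q) (two _ (by linear_combination f2))
    linear_combination -this
  have Q11 := congrArg d₁ Q1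
  have Q12 := congrArg d₁ Q2
  have Q233 := congrArg d₂ Q33
  simp only [map_add, Derivation.leibniz, smul_eq_mul, map_zero, u₁, p₁, q₁, Q123, Q125, Q114]
      at Q11 Q12 Q233
  have E0' : u * (a + 2 * b * p * p) * (d₁ (d₄ Q) + d₂ (d₅ Q) + d₃ Q) + p * d₂ (d₃ Q)
      + (a + 2 * b * p * p) * (p * d₄ Q + q * d₅ Q - Q)
      - 4 * b * u * p * p * (d₁ (d₄ Q) + d₃ Q) = 0 := by
    linear_combination E0 - Q12 - q * Q13 - p * q * Q33 - p * u * (a + 2 * b * p * p) * Q34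
      + 4 * b * u * p * Q1 + b * u * u * (Q11 + 2 * p * Q13 + p * p * Q33)
  have g3 := congrArg d₃ E0'
  simp only [map_add, map_sub, Derivation.leibniz, smul_eq_mul, map_zero, two', four', a₃, b₃, u₃,
    p₃, q₃, c₁₃, c₂₃, Q35, Q34, Q33] at g3
  have Q3 : d₃ Q = -d₁ (d₄ Q) := by
    have := ca (d₁ (d₄ Q) + d₃ Q) (two _ (by
      linear_combination g3 - (a + 2 * b * p * p) * Y))
    linear_combination this
  have Q25 : d₂ (d₅ Q) = -d₁ (d₄ Q) := by linear_combination Y + 2 * Q3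
  have Q23 := congrArg d₂ Q3
  simp only [map_neg, map_zero, c₁₂, Q24] at Q23
  have W0 : (a + 2 * b * p * p) * (p * d₄ Q + q * d₅ Q - Q - u * d₁ (d₄ Q)) = 0 := by
    linear_combination E0' - (u * (a + 2 * b * p * p) - 4 * b * u * p * p) * Q3
      - u * (a + 2 * b * p * p) * Q25 - p * Q23
  have E' : (a + 2 * b * p * p) * d₄ (d₄ Q)
      + 2 * b * (p * d₄ Q + q * d₅ Q - Q - u * d₁ (d₄ Q)) = 0 := by
    linear_combination E - 2 * b * u * Q3
  have w4 := congrArg d₄ W0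
  simp only [map_add, map_sub, Derivation.leibniz, smul_eq_mul, map_zero, two', a₄, b₄, u₄, p₄,
    q₄, c₁₄, Q45, Q144] at w4
  have pW : p * (p * d₄ Q + q * d₅ Q - Q - u * d₁ (d₄ Q)) = 0 :=
    cb _ (two _ (by linear_combination w4 - p * E'))
  have W : p * d₄ Q + q * d₅ Q - Q - u * d₁ (d₄ Q) = 0 :=
    ca _ (by linear_combination W0 - 2 * b * p * pW)
  have Wd := congrArg d₄ W
  simp only [map_add, map_sub, Derivation.leibniz, smul_eq_mul, map_zero, u₄, p₄, q₄, c₁₄, Q45,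
    Q144] at Wd
  have Q44 : d₄ (d₄ Q) = 0 :=
    ca _ (by linear_combination E' - 2 * b * W - 2 * b * p * Wd)
  have Q145 : d₁ (d₄ (d₅ Q)) = 0 := by rw [Q45, map_zero]
  exact ⟨Q55, Q45, Q35, Q15, Q25, Q24, Q34, Q44, Q114, Q124, Q134, Q144, Q145,
    by linear_combination -W⟩

/-- The algebra of smooth real functions on a normed space. -/
def smoothFunctions (E : Type*) [NormedAddCommGroup E] [NormedSpace ℝ E] :
    Subalgebra ℝ (E → ℝ) where
  carrier := {f | ContDiff ℝ (⊤ : ℕ∞) f}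
  mul_mem' {f g} hf hg := by
    simp only [Set.mem_ofPred_eq] at *
    exact hf.mul hg
  add_mem' {f g} hf hg := by
    simp only [Set.mem_ofPred_eq] at *
    exact hf.add hg
  algebraMap_mem' c := (contDiff_const : ContDiff ℝ (⊤ : ℕ∞) fun _ : E => c)

section DirDeriv

variable {E : Type*} [NormedAddCommGroup E] [NormedSpace ℝ E]

theorem smoothFunctions_contDiff (f : smoothFunctions E) :
    ContDiff ℝ (⊤ : ℕ∞) (f : E → ℝ) := f.2

theorem smoothFunctions_differentiable (f : smoothFunctions E) :
    Differentiable ℝ (f : E → ℝ) := (smoothFunctions_contDiff f).differentiable (by simp)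

/-- The derivative of a function in the direction `v`. -/
noncomputable def dirDeriv (v : E) (f : E → ℝ) : E → ℝ := fun z => fderiv ℝ f z v

theorem dirDeriv_contDiff {f : E → ℝ} (hf : ContDiff ℝ (⊤ : ℕ∞) f) (v : E) :
    ContDiff ℝ (⊤ : ℕ∞) (dirDeriv v f) :=
  (hf.fderiv_right (m := (⊤ : ℕ∞)) (by simp)).clm_apply contDiff_const

/-- The directional derivative as a derivation of the algebra of smooth functions. -/
noncomputable def dirDerivation (v : E) :
    Derivation ℝ (smoothFunctions E) (smoothFunctions E) :=
  Derivation.mk'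
    { toFun := fun f => ⟨dirDeriv v f.1, dirDeriv_contDiff f.2 v⟩
      map_add' := fun f g => by
        ext z
        simp [dirDeriv, fderiv_add (smoothFunctions_differentiable f z) (smoothFunctions_differentiable g z)]
      map_smul' := fun c f => by
        ext z
        simp [dirDeriv, fderiv_const_smul (smoothFunctions_differentiable f z) c] }
    (fun f g => by
      ext z
      simp [dirDeriv, fderiv_mul (smoothFunctions_differentiable f z) (smoothFunctions_differentiable g z)])

theorem dirDeriv_dirDeriv {f : E → ℝ} (hf : ContDiff ℝ (⊤ : ℕ∞) f) (v w : E) (z : E) :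
    dirDeriv v (dirDeriv w f) z = fderiv ℝ (fderiv ℝ f) z v w := by
  have h : ContDiff ℝ (⊤ : ℕ∞) (fderiv ℝ f) := hf.fderiv_right (m := (⊤ : ℕ∞)) (by simp)
  have h' := (h.differentiable (by simp) z).hasFDerivAt.clm_apply (hasFDerivAt_const w z)
  unfold dirDeriv
  rw [h'.fderiv]
  simp

theorem dirDeriv_comm {f : E → ℝ} (hf : ContDiff ℝ (⊤ : ℕ∞) f) (v w : E) (z : E) :
    dirDeriv v (dirDeriv w f) z = dirDeriv w (dirDeriv v f) z := by
  rw [dirDeriv_dirDeriv hf, dirDeriv_dirDeriv hf]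
  exact (hf.contDiffAt.isSymmSndFDerivAt (by simp; exact WithTop.coe_le_coe.2 le_top)) v w

theorem dirDerivation_comm (v w : E) (f : smoothFunctions E) :
    dirDerivation v (dirDerivation w f) = dirDerivation w (dirDerivation v f) := by
  ext z
  exact dirDeriv_comm f.2 v w z

end DirDeriv

/-- The first jet space, with coordinates `(x, t, u, u_x, u_t)`. -/
abbrev JetSpace := ℝ × ℝ × ℝ × ℝ × ℝ

namespace JetSpace

/-- The coordinate vector fields of the first jet space. -/
noncomputable abbrev dx : (JetSpace → ℝ) → JetSpace → ℝ := dirDeriv (1, 0, 0, 0, 0)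
/-- A coordinate vector field of the first jet space. -/
noncomputable abbrev dt : (JetSpace → ℝ) → JetSpace → ℝ := dirDeriv (0, 1, 0, 0, 0)
/-- A coordinate vector field of the first jet space. -/
noncomputable abbrev du : (JetSpace → ℝ) → JetSpace → ℝ := dirDeriv (0, 0, 1, 0, 0)
/-- A coordinate vector field of the first jet space. -/
noncomputable abbrev dp : (JetSpace → ℝ) → JetSpace → ℝ := dirDeriv (0, 0, 0, 1, 0)
/-- A coordinate vector field of the first jet space. -/
noncomputable abbrev dq : (JetSpace → ℝ) → JetSpace → ℝ := dirDeriv (0, 0, 0, 0, 1)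

theorem fderiv_eq (f : JetSpace → ℝ) (z : JetSpace) (a b c d e : ℝ) :
    fderiv ℝ f z (a, b, c, d, e) =
      a * dx f z + b * dt f z + c * du f z + d * dp f z + e * dq f z := by
  have : ((a, b, c, d, e) : JetSpace) = a • ((1, 0, 0, 0, 0) : JetSpace)
      + b • ((0, 1, 0, 0, 0) : JetSpace) + c • ((0, 0, 1, 0, 0) : JetSpace)
      + d • ((0, 0, 0, 1, 0) : JetSpace) + e • ((0, 0, 0, 0, 1) : JetSpace) := by
    simp
  rw [this]
  simp only [map_add, map_smul, smul_eq_mul, dirDeriv]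

theorem exists_eq_const {f : JetSpace → ℝ} (hf : ContDiff ℝ (⊤ : ℕ∞) f)
    (h : ∀ z, dx f z = 0 ∧ dt f z = 0 ∧ du f z = 0 ∧ dp f z = 0 ∧ dq f z = 0) :
    ∃ c, ∀ z, f z = c := by
  refine ⟨f 0, fun z => is_const_of_fderiv_eq_zero (𝕜 := ℝ) (hf.differentiable (by simp)) ?_ z 0⟩
  intro z
  refine ContinuousLinearMap.ext fun ⟨a, b, c, d, e⟩ => ?_
  obtain ⟨h1, h2, h3, h4, h5⟩ := h z
  rw [fderiv_eq, h1, h2, h3, h4, h5]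
  simp

end JetSpace

namespace JetSpace

/-- The linearized short pulse equation for the characteristic `Q` at a jet: `(x,t,v,p,q)` is the
first jet of a solution, `r = u_xx`, `τ = u_tt`, `k = u_xxx`; the remaining derivatives
`s = u_xt`, `sx = u_xxt`, `st = u_xtt` are determined by the equation. -/
def LinearizedAt (α β : ℝ) (Q : JetSpace → ℝ) (x t v p q r τ k s sx st : ℝ) : Prop :=
  let z : JetSpace := (x, t, v, p, q)
  dx (dt Q) z + p * du (dt Q) z + r * dp (dt Q) z + s * dq (dt Q) z
    + q * (dx (du Q) z + p * du (du Q) z + r * dp (du Q) z + s * dq (du Q) z) + s * du Q z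
    + s * (dx (dp Q) z + p * du (dp Q) z + r * dp (dp Q) z + s * dq (dp Q) z) + sx * dp Q z
    + τ * (dx (dq Q) z + p * du (dq Q) z + r * dp (dq Q) z + s * dq (dq Q) z) + st * dq Q z
  = α * Q z + β * (v ^ 2 *
      (dx (dx Q) z + p * du (dx Q) z + r * dp (dx Q) z + s * dq (dx Q) z
      + p * (dx (du Q) z + p * du (du Q) z + r * dp (du Q) z + s * dq (du Q) z) + r * du Q z
      + r * (dx (dp Q) z + p * du (dp Q) z + r * dp (dp Q) z + s * dq (dp Q) z) + k * dp Q z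
      + s * (dx (dq Q) z + p * du (dq Q) z + r * dp (dq Q) z + s * dq (dq Q) z) + sx * dq Q z)
    + 4 * v * p * (dx Q z + p * du Q z + r * dp Q z + s * dq Q z)
    + (2 * p ^ 2 + 2 * v * r) * Q z)

/-- For all values of `u_xx` and `u_tt` at the first jet `(x,t,v,p,q)` of a solution, the linearized
short pulse equation holds for the characteristic `Q`. -/
def LinearizedOver (α β : ℝ) (Q : JetSpace → ℝ) (x t v p q : ℝ) : Prop :=
  ∀ r τ : ℝ, ∃ k s sx st : ℝ, LinearizedAt α β Q x t v p q r τ k s sx st ∧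
    s = α * v + β * (2 * v * p ^ 2 + v ^ 2 * r) ∧
    sx = α * p + β * (2 * p ^ 3 + 6 * v * p * r + v ^ 2 * k) ∧
    st = α * q + β * (2 * q * p ^ 2 + 4 * v * p * s + 2 * v * q * r + v ^ 2 * sx)

section Determining

variable {α β : ℝ} {Q : JetSpace → ℝ} {x t v p q : ℝ}

theorem determining_r_tau (H : LinearizedOver α β Q x t v p q) :
    dp (dq Q) (x, t, v, p, q) + β * v * v * dq (dq Q) (x, t, v, p, q) = 0 := by
  obtain ⟨k₁, s₁, sx₁, st₁, h₁, rfl, rfl, rfl⟩ := H 1 1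
  obtain ⟨k₂, s₂, sx₂, st₂, h₂, rfl, rfl, rfl⟩ := H 1 0
  obtain ⟨k₃, s₃, sx₃, st₃, h₃, rfl, rfl, rfl⟩ := H 0 1
  obtain ⟨k₄, s₄, sx₄, st₄, h₄, rfl, rfl, rfl⟩ := H 0 0
  simp only [LinearizedAt] at h₁ h₂ h₃ h₄
  linear_combination h₁ - h₂ - h₃ + h₄

theorem determining_tau (H : LinearizedOver α β Q x t v p q) :
    v * (α + 2 * β * p * p) * dq (dq Q) (x, t, v, p, q) + dx (dq Q) (x, t, v, p, q)
      + p * du (dq Q) (x, t, v, p, q) = 0 := by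
  obtain ⟨k₃, s₃, sx₃, st₃, h₃, rfl, rfl, rfl⟩ := H 0 1
  obtain ⟨k₄, s₄, sx₄, st₄, h₄, rfl, rfl, rfl⟩ := H 0 0
  simp only [LinearizedAt] at h₃ h₄
  linear_combination h₃ - h₄

theorem determining_r (H : LinearizedOver α β Q x t v p q)
    (hQ : ContDiff ℝ (⊤ : ℕ∞) Q) (Q55 : dq (dq Q) (x, t, v, p, q) = 0)
    (Q45 : dp (dq Q) (x, t, v, p, q) = 0) (Q35 : du (dq Q) (x, t, v, p, q) = 0)
    (Q15 : dx (dq Q) (x, t, v, p, q) = 0) :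
    -(β * v * v) * (dx (dp Q) (x, t, v, p, q) + p * du (dp Q) (x, t, v, p, q))
      + (dt (dp Q) (x, t, v, p, q) + q * du (dp Q) (x, t, v, p, q))
      + β * v * v * dt (dq Q) (x, t, v, p, q)
      + v * (α + 2 * β * p * p) * dp (dp Q) (x, t, v, p, q)
      + 2 * β * v * p * dp Q (x, t, v, p, q) + 2 * β * v * q * dq Q (x, t, v, p, q)
      - 2 * β * v * Q (x, t, v, p, q) = 0 := by
  obtain ⟨k₁, s₁, sx₁, st₁, h₁, rfl, rfl, rfl⟩ := H 1 0
  obtain ⟨k₂, s₂, sx₂, st₂, h₂, rfl, rfl, rfl⟩ := H (-1) 0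
  simp only [LinearizedAt, Q55, Q45, Q35, Q15] at h₁ h₂
  simp only [dirDeriv_comm hQ (0, 0, 0, 1, 0) (0, 1, 0, 0, 0),
    dirDeriv_comm hQ (0, 0, 0, 1, 0) (0, 0, 1, 0, 0),
    dirDeriv_comm hQ (0, 0, 0, 1, 0) (1, 0, 0, 0, 0),
    dirDeriv_comm hQ (0, 0, 0, 0, 1) (0, 1, 0, 0, 0),
    dirDeriv_comm hQ (0, 0, 0, 0, 1) (0, 0, 1, 0, 0),
    dirDeriv_comm hQ (0, 0, 0, 0, 1) (1, 0, 0, 0, 0),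
    dirDeriv_comm hQ (0, 0, 0, 0, 1) (0, 0, 0, 1, 0), Q45, Q35, Q15] at h₁ h₂ ⊢
  linear_combination (h₁ - h₂) / 2

theorem determining_one (H : LinearizedOver α β Q x t v p q)
    (hQ : ContDiff ℝ (⊤ : ℕ∞) Q) (Q55 : dq (dq Q) (x, t, v, p, q) = 0)
    (Q45 : dp (dq Q) (x, t, v, p, q) = 0) (Q35 : du (dq Q) (x, t, v, p, q) = 0)
    (Q15 : dx (dq Q) (x, t, v, p, q) = 0) :
    dx (dt Q) (x, t, v, p, q) + q * dx (du Q) (x, t, v, p, q)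
      + v * (α + 2 * β * p * p) * dx (dp Q) (x, t, v, p, q)
      + p * (dt (du Q) (x, t, v, p, q) + q * du (du Q) (x, t, v, p, q)
        + v * (α + 2 * β * p * p) * du (dp Q) (x, t, v, p, q))
      + v * (α + 2 * β * p * p) * dt (dq Q) (x, t, v, p, q)
      + v * (α + 2 * β * p * p) * du Q (x, t, v, p, q)
      + (α + 2 * β * p * p) * (p * dp Q (x, t, v, p, q) + q * dq Q (x, t, v, p, q)
        - Q (x, t, v, p, q))
      - 4 * β * v * p * (dx Q (x, t, v, p, q) + p * du Q (x, t, v, p, q))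
      - β * v * v * (dx (dx Q) (x, t, v, p, q) + 2 * p * dx (du Q) (x, t, v, p, q)
        + p * p * du (du Q) (x, t, v, p, q)) = 0 := by
  obtain ⟨k₁, s₁, sx₁, st₁, h₁, rfl, rfl, rfl⟩ := H 0 0
  simp only [LinearizedAt, Q55, Q45, Q35, Q15] at h₁
  simp only [dirDeriv_comm hQ (0, 0, 0, 1, 0) (0, 1, 0, 0, 0),
    dirDeriv_comm hQ (0, 0, 1, 0, 0) (0, 1, 0, 0, 0),
    dirDeriv_comm hQ (0, 0, 1, 0, 0) (1, 0, 0, 0, 0),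
    dirDeriv_comm hQ (0, 0, 0, 1, 0) (0, 0, 1, 0, 0),
    dirDeriv_comm hQ (0, 0, 0, 1, 0) (1, 0, 0, 0, 0),
    dirDeriv_comm hQ (0, 0, 0, 0, 1) (0, 1, 0, 0, 0),
    dirDeriv_comm hQ (0, 0, 0, 0, 1) (0, 0, 1, 0, 0),
    dirDeriv_comm hQ (0, 0, 0, 0, 1) (1, 0, 0, 0, 0),
    dirDeriv_comm hQ (0, 0, 0, 0, 1) (0, 0, 0, 1, 0), Q45, Q35, Q15] at h₁ ⊢
  linear_combination h₁

end Determining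

theorem classification_of_linearizedAt {α β : ℝ} (hα : α ≠ 0) (hβ : β ≠ 0) {Q : JetSpace → ℝ}
    (hQ : ContDiff ℝ (⊤ : ℕ∞) Q)
    (H : ∀ x t v p q r τ : ℝ, ∃ k s sx st : ℝ, LinearizedAt α β Q x t v p q r τ k s sx st ∧
      s = α * v + β * (2 * v * p ^ 2 + v ^ 2 * r) ∧
      sx = α * p + β * (2 * p ^ 3 + 6 * v * p * r + v ^ 2 * k) ∧
      st = α * q + β * (2 * q * p ^ 2 + 4 * v * p * s + 2 * v * q * r + v ^ 2 * sx)) :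
    ∃ C₁ C₂ C₃ : ℝ, ∀ x t v p q : ℝ,
      Q (x, t, v, p, q) = C₁ * p + C₂ * q + C₃ * (x * p - t * q - v) := by
  let S := smoothFunctions JetSpace
  let X : S := ⟨fun z => z.1, show ContDiff ℝ (⊤ : ℕ∞) fun z : JetSpace => z.1 by fun_prop⟩
  let T : S := ⟨fun z => z.2.1, show ContDiff ℝ (⊤ : ℕ∞) fun z : JetSpace => z.2.1 by fun_prop⟩
  let U : S := ⟨fun z => z.2.2.1, show ContDiff ℝ (⊤ : ℕ∞) fun z : JetSpace => z.2.2.1 by fun_prop⟩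
  let P : S := ⟨fun z => z.2.2.2.1, show ContDiff ℝ (⊤ : ℕ∞) fun z : JetSpace => z.2.2.2.1 by fun_prop⟩
  let R : S := ⟨fun z => z.2.2.2.2, show ContDiff ℝ (⊤ : ℕ∞) fun z : JetSpace => z.2.2.2.2 by fun_prop⟩
  let D : JetSpace → Derivation ℝ S S := dirDerivation
  have coord : ∀ (v z : JetSpace), dirDeriv v (fun z => z.1) z = v.1 ∧
      dirDeriv v (fun z => z.2.1) z = v.2.1 ∧ dirDeriv v (fun z => z.2.2.1) z = v.2.2.1 ∧
      dirDeriv v (fun z => z.2.2.2.1) z = v.2.2.2.1 ∧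
      dirDeriv v (fun z => z.2.2.2.2) z = v.2.2.2.2 := by
    intro v z
    have h1 : HasFDerivAt (fun z : JetSpace => z) (ContinuousLinearMap.id ℝ JetSpace) z :=
      hasFDerivAt_id z
    refine ⟨?_, ?_, ?_, ?_, ?_⟩ <;> unfold dirDeriv
    · rw [h1.fst.fderiv]; rfl
    · rw [h1.snd.fst.fderiv]; rfl
    · rw [h1.snd.snd.fst.fderiv]; rfl
    · rw [h1.snd.snd.snd.fst.fderiv]; rfl
    · rw [h1.snd.snd.snd.snd.fderiv]; rfl
  have coordX : ∀ v, D v X = algebraMap ℝ S v.1 := fun v =>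
    Subtype.ext (funext fun z => (coord v z).1)
  have coordT : ∀ v, D v T = algebraMap ℝ S v.2.1 := fun v =>
    Subtype.ext (funext fun z => (coord v z).2.1)
  have coordU : ∀ v, D v U = algebraMap ℝ S v.2.2.1 := fun v =>
    Subtype.ext (funext fun z => (coord v z).2.2.1)
  have coordP : ∀ v, D v P = algebraMap ℝ S v.2.2.2.1 := fun v =>
    Subtype.ext (funext fun z => (coord v z).2.2.2.1)
  have coordR : ∀ v, D v R = algebraMap ℝ S v.2.2.2.2 := fun v =>
    Subtype.ext (funext fun z => (coord v z).2.2.2.2)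
  have line : ∀ (f : S) (x t p q : ℝ), Continuous fun s : ℝ => (f : JetSpace → ℝ) (x, t, s, p, q) :=
    fun f x t p q => (smoothFunctions_contDiff f).continuous.comp (by fun_prop)
  have hu : ∀ f : S, U * f = 0 → f = 0 := by
    intro f hf
    refine Subtype.ext (funext fun ⟨x, t, s, p, q⟩ => ?_)
    have := Continuous.ext_on (dense_compl_singleton (0 : ℝ)) (line f x t p q)
      (continuous_const (y := (0 : ℝ))) (fun s hs => by
        have h := congrFun (congrArg Subtype.val hf) (x, t, s, p, q)
        exact (mul_eq_zero.1 h).resolve_left hs)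
    exact congrFun this s
  have hu₃ : ∀ f : S, D (0, 0, 1, 0, 0) (U * U * U * f) = 0 → U * U * U * f = 0 := by
    intro f hf
    refine Subtype.ext (funext fun ⟨x, t, s, p, q⟩ => ?_)
    set g : S := U * U * U * f with hg
    have hd : ∀ s, HasDerivAt (fun s => (g : JetSpace → ℝ) (x, t, s, p, q)) 0 s := by
      intro s
      have hl : HasDerivAt (fun s : ℝ => ((x, t, s, p, q) : JetSpace)) (0, 0, 1, 0, 0) s :=
        (hasDerivAt_const s x).prodMk ((hasDerivAt_const s t).prodMk ((hasDerivAt_id s).prodMk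
          ((hasDerivAt_const s p).prodMk (hasDerivAt_const s q))))
      have h := (smoothFunctions_differentiable g (x, t, s, p, q)).hasFDerivAt.comp_hasDerivAt s hl
      have h0 : fderiv ℝ (g : JetSpace → ℝ) (x, t, s, p, q) (0, 0, 1, 0, 0) = 0 :=
        congrFun (congrArg Subtype.val hf) (x, t, s, p, q)
      rwa [h0] at h
    have h1 : (g : JetSpace → ℝ) (x, t, s, p, q) = (g : JetSpace → ℝ) (x, t, 0, p, q) :=
      is_const_of_deriv_eq_zero (f := fun s => (g : JetSpace → ℝ) (x, t, s, p, q))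
        (fun s => (hd s).differentiableAt) (fun s => (hd s).deriv) s 0
    have h2 : (g : JetSpace → ℝ) (x, t, 0, p, q) = 0 := by
      rw [hg]
      change (0 : ℝ) * 0 * 0 * _ = 0
      ring
    exact h1.trans h2
  have J := fun z : JetSpace => H z.1 z.2.1 z.2.2.1 z.2.2.2.1 z.2.2.2.2
  have key := determining_equations_solve (D (1, 0, 0, 0, 0)) (D (0, 1, 0, 0, 0))
    (D (0, 0, 1, 0, 0)) (D (0, 0, 0, 1, 0)) (D (0, 0, 0, 0, 1))
    (dirDerivation_comm _ _) (dirDerivation_comm _ _) (dirDerivation_comm _ _)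
    (dirDerivation_comm _ _) (dirDerivation_comm _ _) (dirDerivation_comm _ _)
    (dirDerivation_comm _ _) (dirDerivation_comm _ _) (dirDerivation_comm _ _)
    (dirDerivation_comm _ _) U P R ⟨Q, hQ⟩ (algebraMap ℝ S α) (algebraMap ℝ S β)
    (algebraMap ℝ S α⁻¹) (algebraMap ℝ S β⁻¹)
    (by rw [← map_mul, mul_inv_cancel₀ hα, map_one]) (by rw [← map_mul, mul_inv_cancel₀ hβ, map_one])
    (Derivation.map_algebraMap _ _) (Derivation.map_algebraMap _ _) (Derivation.map_algebraMap _ _)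
    (Derivation.map_algebraMap _ _) (Derivation.map_algebraMap _ _) (Derivation.map_algebraMap _ _)
    (Derivation.map_algebraMap _ _) (Derivation.map_algebraMap _ _) (Derivation.map_algebraMap _ _)
    (Derivation.map_algebraMap _ _)
    (by simp [coordU]) (by simp [coordU]) (by simp [coordU]) (by simp [coordU]) (by simp [coordU])
    (by simp [coordP]) (by simp [coordP]) (by simp [coordP]) (by simp [coordP]) (by simp [coordP])
    (by simp [coordR]) (by simp [coordR]) (by simp [coordR]) (by simp [coordR]) (by simp [coordR])
    hu hu₃
    (Subtype.ext (funext fun z => determining_r_tau (J z)))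
    (Subtype.ext (funext fun z => determining_tau (J z)))
    (fun Q55 Q45 Q35 Q15 => Subtype.ext (funext fun z => determining_r (J z) hQ
      (congrFun (congrArg Subtype.val Q55) z) (congrFun (congrArg Subtype.val Q45) z)
      (congrFun (congrArg Subtype.val Q35) z) (congrFun (congrArg Subtype.val Q15) z)))
    (fun Q55 Q45 Q35 Q15 => Subtype.ext (funext fun z => determining_one (J z) hQ
      (congrFun (congrArg Subtype.val Q55) z) (congrFun (congrArg Subtype.val Q45) z)
      (congrFun (congrArg Subtype.val Q35) z) (congrFun (congrArg Subtype.val Q15) z)))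
  obtain ⟨Q55, Q45, Q35, Q15, Q25, Q24, Q34, Q44, K1, K2, K3, K4, K5, hQe⟩ := key
  have const : ∀ f : S, D (1, 0, 0, 0, 0) f = 0 → D (0, 1, 0, 0, 0) f = 0 →
      D (0, 0, 1, 0, 0) f = 0 → D (0, 0, 0, 1, 0) f = 0 → D (0, 0, 0, 0, 1) f = 0 →
      ∃ c, f = algebraMap ℝ S c := by
    intro f h₁ h₂ h₃ h₄ h₅
    obtain ⟨c, hc⟩ := exists_eq_const (smoothFunctions_contDiff f) fun z =>
      ⟨congrFun (congrArg Subtype.val h₁) z, congrFun (congrArg Subtype.val h₂) z,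
        congrFun (congrArg Subtype.val h₃) z, congrFun (congrArg Subtype.val h₄) z,
        congrFun (congrArg Subtype.val h₅) z⟩
    exact ⟨c, Subtype.ext (funext hc)⟩
  obtain ⟨k, hk⟩ := const (D (1, 0, 0, 0, 0) (D (0, 0, 0, 1, 0) ⟨Q, hQ⟩)) K1
    ((dirDerivation_comm _ _ _).trans K2) ((dirDerivation_comm _ _ _).trans K3)
    ((dirDerivation_comm _ _ _).trans K4)
    ((dirDerivation_comm _ _ _).trans ((congrArg _ (dirDerivation_comm _ _ _)).trans K5))
  have Q54 : D (0, 0, 0, 0, 1) (D (0, 0, 0, 1, 0) ⟨Q, hQ⟩) = 0 :=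
    (dirDerivation_comm _ _ _).trans Q45
  obtain ⟨C₁, hC₁⟩ := const (D (0, 0, 0, 1, 0) ⟨Q, hQ⟩ - algebraMap ℝ S k * X)
    (by simp [hk, coordX]) (by simp [Q24, coordX]) (by simp [Q34, coordX]) (by simp [Q44, coordX])
    (by simp [Q54, coordX])
  obtain ⟨C₂, hC₂⟩ := const (D (0, 0, 0, 0, 1) ⟨Q, hQ⟩ + algebraMap ℝ S k * T)
    (by simp [Q15, coordT]) (by simp [Q25, hk, coordT]) (by simp [Q35, coordT])
    (by simp [Q45, coordT]) (by simp [Q55, coordT])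
  rw [hk] at hQe
  refine ⟨C₁, C₂, k, fun x t v p q => ?_⟩
  have e := congrFun (congrArg Subtype.val hQe) (x, t, v, p, q)
  have e₁ := congrFun (congrArg Subtype.val hC₁) (x, t, v, p, q)
  have e₂ := congrFun (congrArg Subtype.val hC₂) (x, t, v, p, q)
  change Q (x, t, v, p, q) = p * dp Q (x, t, v, p, q) + q * dq Q (x, t, v, p, q) - v * k at e
  change dp Q (x, t, v, p, q) - k * x = C₁ at e₁
  change dq Q (x, t, v, p, q) + k * t = C₂ at e₂
  linear_combination e + p * e₁ + q * e₂

end JetSpace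

section Smooth2

variable {f g : ℝ → ℝ → ℝ}

theorem Smooth2.hasDerivAt_fst (hf : Smooth2 f) (x t : ℝ) :
    HasDerivAt (fun x' => f x' t) (pdx f x t) x := by
  have h : Differentiable ℝ (fun x' => f x' t) :=
    (hf.comp (contDiff_id.prodMk contDiff_const)).differentiable (by simp)
  exact (h x).hasDerivAt

theorem Smooth2.hasDerivAt_snd (hf : Smooth2 f) (x t : ℝ) :
    HasDerivAt (fun t' => f x t') (pdt f x t) t := by
  have h : Differentiable ℝ (fun t' => f x t') :=
    (hf.comp (contDiff_const.prodMk contDiff_id)).differentiable (by simp)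
  exact (h t).hasDerivAt

theorem Smooth2.pdx_eq (hf : Smooth2 f) (x t : ℝ) :
    pdx f x t = dirDeriv (1, 0) (fun z : ℝ × ℝ => f z.1 z.2) (x, t) := by
  have h := (hf.differentiable (by simp) (x, t)).hasFDerivAt.comp_hasDerivAt x
    ((hasDerivAt_id x).prodMk (hasDerivAt_const x t))
  exact h.deriv

theorem Smooth2.pdt_eq (hf : Smooth2 f) (x t : ℝ) :
    pdt f x t = dirDeriv (0, 1) (fun z : ℝ × ℝ => f z.1 z.2) (x, t) := by
  have h := (hf.differentiable (by simp) (x, t)).hasFDerivAt.comp_hasDerivAt t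
    ((hasDerivAt_const t x).prodMk (hasDerivAt_id t))
  exact h.deriv

theorem Smooth2.pdx (hf : Smooth2 f) : Smooth2 (pdx f) :=
  by
  have e : (fun z : ℝ × ℝ => _root_.pdx f z.1 z.2) = dirDeriv (1, 0) fun z : ℝ × ℝ => f z.1 z.2 :=
    funext fun z => hf.pdx_eq z.1 z.2
  unfold Smooth2
  rw [e]
  exact dirDeriv_contDiff hf (1, 0)

theorem Smooth2.pdt (hf : Smooth2 f) : Smooth2 (pdt f) :=
  by
  have e : (fun z : ℝ × ℝ => _root_.pdt f z.1 z.2) = dirDeriv (0, 1) fun z : ℝ × ℝ => f z.1 z.2 :=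
    funext fun z => hf.pdt_eq z.1 z.2
  unfold Smooth2
  rw [e]
  exact dirDeriv_contDiff hf (0, 1)

theorem Smooth2.pdt_pdx (hf : Smooth2 f) : _root_.pdt (_root_.pdx f) = _root_.pdx (_root_.pdt f) := by
  funext x t
  rw [hf.pdx.pdt_eq, hf.pdt.pdx_eq,
    funext fun z : ℝ × ℝ => hf.pdx_eq z.1 z.2, funext fun z : ℝ × ℝ => hf.pdt_eq z.1 z.2]
  exact dirDeriv_comm hf _ _ _

end Smooth2

theorem IsSPESol.pdx_pdt {α β : ℝ} {u : ℝ → ℝ → ℝ} (hu : IsSPESol α β u) (x t : ℝ) :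
    pdx (pdt u) x t
      = α * u x t + β * (2 * u x t * pdx u x t ^ 2 + u x t ^ 2 * pdx (pdx u) x t) := by
  have h₁ : pdx (fun x t => u x t ^ 3) = fun x t => 3 * u x t ^ 2 * pdx u x t := by
    funext x t
    refine ((hu.1.hasDerivAt_fst x t).pow 3).deriv.trans ?_
    norm_num
  have h₂ : pdx (fun x t => 3 * u x t ^ 2 * pdx u x t) x t
      = 6 * u x t * pdx u x t ^ 2 + 3 * u x t ^ 2 * pdx (pdx u) x t := by
    refine ((((hu.1.hasDerivAt_fst x t).pow 2).const_mul 3).mul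
      (hu.1.pdx.hasDerivAt_fst x t)).deriv.trans ?_
    push_cast
    simp only [Pi.pow_apply]
    ring
  rw [hu.2, h₁, h₂]
  ring

namespace JetSpace

/-- The first jet of a function of two variables. -/
noncomputable abbrev jet (u : ℝ → ℝ → ℝ) (x t : ℝ) : JetSpace := (x, t, u x t, pdx u x t, pdt u x t)

theorem hasDerivAt_jet_fst {F : JetSpace → ℝ} (hF : ContDiff ℝ (⊤ : ℕ∞) F) {u : ℝ → ℝ → ℝ}
    (hu : Smooth2 u) (x t : ℝ) :
    HasDerivAt (fun x' => F (jet u x' t)) (dx F (jet u x t) + pdx u x t * du F (jet u x t)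
      + pdx (pdx u) x t * dp F (jet u x t) + pdx (pdt u) x t * dq F (jet u x t)) x := by
  have h := (hF.differentiable (by simp) (jet u x t)).hasFDerivAt.comp_hasDerivAt x
    ((hasDerivAt_id x).prodMk ((hasDerivAt_const x t).prodMk ((hu.hasDerivAt_fst x t).prodMk
      ((hu.pdx.hasDerivAt_fst x t).prodMk (hu.pdt.hasDerivAt_fst x t)))))
  rw [fderiv_eq] at h
  exact h.congr_deriv (by ring)

theorem hasDerivAt_jet_snd {F : JetSpace → ℝ} (hF : ContDiff ℝ (⊤ : ℕ∞) F) {u : ℝ → ℝ → ℝ}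
    (hu : Smooth2 u) (x t : ℝ) :
    HasDerivAt (fun t' => F (jet u x t')) (dt F (jet u x t) + pdt u x t * du F (jet u x t)
      + pdx (pdt u) x t * dp F (jet u x t) + pdt (pdt u) x t * dq F (jet u x t)) t := by
  have h := (hF.differentiable (by simp) (jet u x t)).hasFDerivAt.comp_hasDerivAt t
    ((hasDerivAt_const t x).prodMk ((hasDerivAt_id t).prodMk ((hu.hasDerivAt_snd x t).prodMk
      ((hu.pdx.hasDerivAt_snd x t).prodMk (hu.pdt.hasDerivAt_snd x t)))))
  rw [fderiv_eq] at h
  exact h.congr_deriv (by rw [hu.pdt_pdx]; ring)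

theorem linearizedAt_of_isSPESol {α β : ℝ} {u : ℝ → ℝ → ℝ} (hu : IsSPESol α β u)
    {Q : JetSpace → ℝ} (hQ : ContDiff ℝ (⊤ : ℕ∞) Q)
    (h : SatisfiesLinearized α β u (fun x t => Q (jet u x t))) (x t : ℝ) :
    ∃ k s sx st : ℝ, LinearizedAt α β Q x t (u x t) (pdx u x t) (pdt u x t) (pdx (pdx u) x t)
        (pdt (pdt u) x t) k s sx st ∧
      s = α * u x t + β * (2 * u x t * pdx u x t ^ 2 + u x t ^ 2 * pdx (pdx u) x t) ∧
      sx = α * pdx u x t + β * (2 * pdx u x t ^ 3 + 6 * u x t * pdx u x t * pdx (pdx u) x t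
        + u x t ^ 2 * k) ∧
      st = α * pdt u x t + β * (2 * pdt u x t * pdx u x t ^ 2 + 4 * u x t * pdx u x t * s
        + 2 * u x t * pdt u x t * pdx (pdx u) x t + u x t ^ 2 * sx) := by
  have hs := hu.1
  have hspe := hu.pdx_pdt
  refine ⟨pdx (pdx (pdx u)) x t, pdx (pdt u) x t, pdx (pdx (pdt u)) x t, pdx (pdt (pdt u)) x t,
    ?_, hspe x t, ?_, ?_⟩
  · have e := h x t
    have ht : pdt (fun x t => Q (jet u x t)) = fun x t => dt Q (jet u x t)
        + pdt u x t * du Q (jet u x t) + pdx (pdt u) x t * dp Q (jet u x t)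
        + pdt (pdt u) x t * dq Q (jet u x t) :=
      funext₂ fun x t => (hasDerivAt_jet_snd hQ hs x t).deriv
    have hxt := ((((hasDerivAt_jet_fst (dirDeriv_contDiff hQ (0, 1, 0, 0, 0)) hs x t).add
      ((hs.pdt.hasDerivAt_fst x t).mul
        (hasDerivAt_jet_fst (dirDeriv_contDiff hQ (0, 0, 1, 0, 0)) hs x t))).add
      ((hs.pdt.pdx.hasDerivAt_fst x t).mul
        (hasDerivAt_jet_fst (dirDeriv_contDiff hQ (0, 0, 0, 1, 0)) hs x t))).add
      ((hs.pdt.pdt.hasDerivAt_fst x t).mul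
        (hasDerivAt_jet_fst (dirDeriv_contDiff hQ (0, 0, 0, 0, 1)) hs x t))).deriv
    have hx : pdx (fun x t => u x t ^ 2 * Q (jet u x t)) = fun x t =>
        2 * u x t * pdx u x t * Q (jet u x t) + u x t ^ 2 * (dx Q (jet u x t)
        + pdx u x t * du Q (jet u x t) + pdx (pdx u) x t * dp Q (jet u x t)
        + pdx (pdt u) x t * dq Q (jet u x t)) := by
      funext x t
      refine (((hs.hasDerivAt_fst x t).pow 2).mul (hasDerivAt_jet_fst hQ hs x t)).deriv.trans ?_
      simp
    have hxx := (((((hs.hasDerivAt_fst x t).const_mul 2).mul (hs.pdx.hasDerivAt_fst x t)).mul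
      (hasDerivAt_jet_fst hQ hs x t)).add (((hs.hasDerivAt_fst x t).pow 2).mul
      ((((hasDerivAt_jet_fst (dirDeriv_contDiff hQ (1, 0, 0, 0, 0)) hs x t).add
      ((hs.pdx.hasDerivAt_fst x t).mul
        (hasDerivAt_jet_fst (dirDeriv_contDiff hQ (0, 0, 1, 0, 0)) hs x t))).add
      ((hs.pdx.pdx.hasDerivAt_fst x t).mul
        (hasDerivAt_jet_fst (dirDeriv_contDiff hQ (0, 0, 0, 1, 0)) hs x t))).add
      ((hs.pdt.pdx.hasDerivAt_fst x t).mul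
        (hasDerivAt_jet_fst (dirDeriv_contDiff hQ (0, 0, 0, 0, 1)) hs x t))))).deriv
    rw [ht, hx] at e
    replace e := hxt.symm.trans (e.trans (congrArg (fun y => α * Q (jet u x t) + β * y) hxx))
    simp only [Pi.pow_apply, Pi.mul_apply, Pi.add_apply, Nat.add_one_sub_one, Nat.cast_ofNat,
      pow_one] at e
    simp only [LinearizedAt]
    linear_combination e
  · have h₁ : HasDerivAt (fun x' => pdx (pdt u) x' t) _ x :=
      (((hs.hasDerivAt_fst x t).const_mul α).add (((((hs.hasDerivAt_fst x t).const_mul 2).mul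
      ((hs.pdx.hasDerivAt_fst x t).pow 2)).add (((hs.hasDerivAt_fst x t).pow 2).mul
      (hs.pdx.pdx.hasDerivAt_fst x t))).const_mul β)).congr_of_eventuallyEq
      (.of_forall fun x' => hspe x' t)
    refine h₁.deriv.trans ?_
    simp only [Pi.pow_apply, Nat.add_one_sub_one, Nat.cast_ofNat, pow_one]
    ring
  · have h₁ : HasDerivAt (fun t' => pdx (pdt u) x t') _ t :=
      (((hs.hasDerivAt_snd x t).const_mul α).add (((((hs.hasDerivAt_snd x t).const_mul 2).mul
      ((hs.pdx.hasDerivAt_snd x t).pow 2)).add (((hs.hasDerivAt_snd x t).pow 2).mul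
      (hs.pdx.pdx.hasDerivAt_snd x t))).const_mul β)).congr_of_eventuallyEq
      (.of_forall fun t' => hspe x t')
    rw [← hs.pdt.pdt_pdx]
    refine h₁.deriv.trans ?_
    rw [hs.pdx.pdt_pdx, hs.pdt_pdx]
    simp only [Pi.pow_apply, Nat.add_one_sub_one, Nat.cast_ofNat, pow_one]
    ring

end JetSpace

/-- If the second-order jets `(x, t, u, u_x, u_t, u_xx, u_tt)` of solutions fill the jet space, then
every contact symmetry is a combination of the translations and the dilation. -/
theorem contact_symmetry_of_jets {α β : ℝ} (hα : α ≠ 0) (hβ : β ≠ 0)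
    (hjet : ∀ x t v p q r τ : ℝ, ∃ u, IsSPESol α β u ∧ u x t = v ∧ pdx u x t = p ∧ pdt u x t = q ∧
      pdx (pdx u) x t = r ∧ pdt (pdt u) x t = τ)
    {Q : JetSpace → ℝ} (hQ : ContDiff ℝ (⊤ : ℕ∞) Q)
    (hsym : ∀ u : ℝ → ℝ → ℝ, IsSPESol α β u →
      SatisfiesLinearized α β u fun x t => Q (x, t, u x t, pdx u x t, pdt u x t)) :
    ∃ C₁ C₂ C₃ : ℝ, ∀ x t v p q : ℝ,
      Q (x, t, v, p, q) = C₁ * p + C₂ * q + C₃ * (x * p - t * q - v) := by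
  refine JetSpace.classification_of_linearizedAt hα hβ hQ fun x t v p q r τ => ?_
  obtain ⟨u, hu, rfl, rfl, rfl, rfl, rfl⟩ := hjet x t v p q r τ
  exact JetSpace.linearizedAt_of_isSPESol hu hQ (hsym u hu) x t

section ParametricIntegral

open MeasureTheory Filter Topology

theorem hasDerivAt_integral_of_continuous {f f' : ℝ → ℝ → ℝ}
    (hf : Continuous fun z : ℝ × ℝ => f z.1 z.2) (hf' : Continuous fun z : ℝ × ℝ => f' z.1 z.2)
    (h : ∀ x s, HasDerivAt (fun x => f x s) (f' x s) x) (a b x₀ : ℝ) :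
    HasDerivAt (fun x => ∫ s in a..b, f x s) (∫ s in a..b, f' x₀ s) x₀ := by
  obtain ⟨M, hM⟩ := ((isCompact_closedBall x₀ 1).prod (isCompact_uIcc (a := a) (b := b)))
    |>.exists_bound_of_continuousOn hf'.continuousOn
  have hc : ∀ x, Continuous (f x) := fun x => hf.comp (by fun_prop : Continuous fun s => (x, s))
  have hc' : ∀ x, Continuous (f' x) := fun x => hf'.comp (by fun_prop : Continuous fun s => (x, s))
  refine (intervalIntegral.hasDerivAt_integral_of_dominated_loc_of_deriv_le (bound := fun _ => M)
    (Metric.closedBall_mem_nhds x₀ one_pos) (.of_forall fun x => (hc x).aestronglyMeasurable)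
    ((hc x₀).intervalIntegrable a b) (hc' x₀).aestronglyMeasurable
    (.of_forall fun s hs x hx => hM (x, s) ⟨hx, Set.uIoc_subset_uIcc hs⟩)
    intervalIntegrable_const (.of_forall fun s _ x _ => h x s)).2

theorem continuous_integral_of_continuous {X : Type*} [TopologicalSpace X] {f : X → ℝ → ℝ}
    (hf : Continuous fun z : X × ℝ => f z.1 z.2) {a b : X → ℝ} (ha : Continuous a)
    (hb : Continuous b) : Continuous fun x => ∫ s in a x..b x, f x s := by
  have h : ∀ x, ∫ s in a x..b x, f x s = (∫ s in 0..b x, f x s) - ∫ s in 0..a x, f x s := by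
    intro x
    have hc : Continuous (f x) := hf.comp (by fun_prop : Continuous fun s => (x, s))
    exact (intervalIntegral.integral_interval_sub_left (hc.intervalIntegrable _ _)
      (hc.intervalIntegrable _ _)).symm
  simp only [h]
  exact (intervalIntegral.continuous_parametric_intervalIntegral_of_continuous hf hb).sub
    (intervalIntegral.continuous_parametric_intervalIntegral_of_continuous hf ha)

/-- A function whose partial derivatives are `C^n` is `C^(n+1)`. -/
theorem contDiff_succ_of_partials {n : ℕ} {f f₁ f₂ : ℝ → ℝ → ℝ}
    (h₁ : ∀ x t, HasDerivAt (fun x => f x t) (f₁ x t) x)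
    (h₂ : ∀ x t, HasDerivAt (fun t => f x t) (f₂ x t) t)
    (c₁ : ContDiff ℝ n fun z : ℝ × ℝ => f₁ z.1 z.2)
    (c₂ : ContDiff ℝ n fun z : ℝ × ℝ => f₂ z.1 z.2) :
    ContDiff ℝ (n + 1 : ℕ) fun z : ℝ × ℝ => f z.1 z.2 := by
  have L : ContDiff ℝ n fun z : ℝ × ℝ =>
      (ContinuousLinearMap.toSpanSingleton ℝ (f₁ z.1 z.2)).coprod
        (ContinuousLinearMap.toSpanSingleton ℝ (f₂ z.1 z.2)) := by
    have e : ∀ z : ℝ × ℝ, (ContinuousLinearMap.toSpanSingleton ℝ (f₁ z.1 z.2)).coprod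
        (ContinuousLinearMap.toSpanSingleton ℝ (f₂ z.1 z.2))
        = f₁ z.1 z.2 • ContinuousLinearMap.fst ℝ ℝ ℝ + f₂ z.1 z.2 • ContinuousLinearMap.snd ℝ ℝ ℝ := by
      intro z
      ext <;> simp
    simp only [e]
    exact (c₁.smul contDiff_const).add (c₂.smul contDiff_const)
  push_cast
  refine contDiff_succ_iff_hasFDerivAt.2 ⟨_, L, fun z => ?_⟩
  have hS : ∀ g : ℝ → ℝ → ℝ, Continuous (fun z : ℝ × ℝ => g z.1 z.2) →
      Continuous fun z : ℝ × ℝ => ContinuousLinearMap.toSpanSingleton ℝ (g z.1 z.2) := by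
    intro g hg
    have : ∀ z : ℝ × ℝ, ContinuousLinearMap.toSpanSingleton ℝ (g z.1 z.2)
        = g z.1 z.2 • ContinuousLinearMap.id ℝ ℝ := fun z => by ext; simp
    simp only [this]
    exact hg.smul continuous_const
  exact (hasStrictFDerivAt_uncurry_coprod (f := f)
    (f₁ := fun x t => ContinuousLinearMap.toSpanSingleton ℝ (f₁ x t))
    (f₂ := fun x t => ContinuousLinearMap.toSpanSingleton ℝ (f₂ x t))
    (.of_forall fun v => (h₁ v.1 v.2).hasFDerivAt) (.of_forall fun v => (h₂ v.1 v.2).hasFDerivAt)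
    (hS f₁ c₁.continuous).continuousAt (hS f₂ c₂.continuous).continuousAt).hasFDerivAt

theorem hasDerivAt_fst_of_contDiff {n : ℕ} {f : ℝ → ℝ → ℝ}
    (hf : ContDiff ℝ (n + 1 : ℕ) fun z : ℝ × ℝ => f z.1 z.2) :
    ∃ f₁ : ℝ → ℝ → ℝ, ContDiff ℝ n (fun z : ℝ × ℝ => f₁ z.1 z.2) ∧
      ∀ x t, HasDerivAt (fun x => f x t) (f₁ x t) x := by
  refine ⟨fun x t => fderiv ℝ (fun z : ℝ × ℝ => f z.1 z.2) (x, t) (1, 0),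
    (hf.fderiv_right (m := n) (by push_cast; exact le_rfl)).clm_apply contDiff_const, fun x t => ?_⟩
  exact (hf.differentiable (by simp) (x, t)).hasFDerivAt.comp_hasDerivAt x
    ((hasDerivAt_id x).prodMk (hasDerivAt_const x t))

theorem contDiff_integral {n : ℕ} {f : ℝ → ℝ → ℝ}
    (hf : ContDiff ℝ n fun z : ℝ × ℝ => f z.1 z.2) :
    ContDiff ℝ n fun z : ℝ × ℝ => ∫ s in 0..z.2, f z.1 s := by
  induction n generalizing f with
  | zero =>
    simp only [Nat.cast_zero, contDiff_zero] at hf ⊢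
    exact continuous_integral_of_continuous (f := fun (z : ℝ × ℝ) s => f z.1 s)
      (Continuous.comp (g := fun z : ℝ × ℝ => f z.1 z.2) hf
        (by fun_prop : Continuous fun z : (ℝ × ℝ) × ℝ => (z.1.1, z.2)))
      continuous_const continuous_snd
  | succ n ih =>
    obtain ⟨f₁, c₁, h₁⟩ := hasDerivAt_fst_of_contDiff hf
    refine contDiff_succ_of_partials (f := fun x t => ∫ s in 0..t, f x s)
      (f₁ := fun x t => ∫ s in 0..t, f₁ x s) (f₂ := f)
      (fun x t => hasDerivAt_integral_of_continuous hf.continuous c₁.continuous h₁ 0 t x)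
      (fun x t => ?_) (ih c₁) (hf.of_le (by exact_mod_cast n.le_succ))
    have hc : Continuous (f x) := hf.continuous.comp (by fun_prop : Continuous fun s => (x, s))
    exact (hc.integral_hasStrictDerivAt 0 t).hasDerivAt

theorem contDiff_integral_fst {n : ℕ} {f : ℝ → ℝ → ℝ}
    (hf : ContDiff ℝ n fun z : ℝ × ℝ => f z.1 z.2) :
    ContDiff ℝ n fun z : ℝ × ℝ => ∫ s in 0..z.1, f s z.2 :=
  (contDiff_integral (f := fun t x => f x t) (hf.comp (contDiff_snd.prodMk contDiff_fst))).comp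
    (contDiff_snd.prodMk contDiff_fst)

end ParametricIntegral

/-- The function implicitly defined as the unique solution `S(x,t)` of `Θ(S,t) = g(x)` is smooth. -/
theorem smooth2_of_unique_level {Θ S : ℝ → ℝ → ℝ} {g : ℝ → ℝ} (hΘ : Smooth2 Θ)
    (hg : ContDiff ℝ (⊤ : ℕ∞) g) (hS : ∀ x t, Θ (S x t) t = g x)
    (huniq : ∀ σ x t, Θ σ t = g x → σ = S x t) (hpos : ∀ x t, pdx Θ (S x t) t ≠ 0) :
    Smooth2 S := by
  refine contDiff_iff_contDiffAt.2 fun ⟨x₀, t₀⟩ => ?_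
  set Φ : ℝ × ℝ → ℝ × ℝ := fun z => (Θ z.1 z.2, z.2) with hΦ
  have hΦc : ContDiff ℝ (⊤ : ℕ∞) Φ := ContDiff.prodMk hΘ contDiff_snd
  set z₀ : ℝ × ℝ := (S x₀ t₀, t₀)
  set c := pdx Θ (S x₀ t₀) t₀ with hc
  set d := pdt Θ (S x₀ t₀) t₀ with hd
  have hc0 : c ≠ 0 := hpos x₀ t₀
  let e : (ℝ × ℝ) ≃L[ℝ] ℝ × ℝ := ContinuousLinearEquiv.equivOfInverse
    ((c • ContinuousLinearMap.fst ℝ ℝ ℝ + d • ContinuousLinearMap.snd ℝ ℝ ℝ).prod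
      (ContinuousLinearMap.snd ℝ ℝ ℝ))
    ((c⁻¹ • ContinuousLinearMap.fst ℝ ℝ ℝ - (c⁻¹ * d) • ContinuousLinearMap.snd ℝ ℝ ℝ).prod
      (ContinuousLinearMap.snd ℝ ℝ ℝ))
    (fun z => by ext <;> simp; field_simp; ring) (fun z => by ext <;> simp; field_simp; ring)
  have hfd : HasFDerivAt Φ (e : ℝ × ℝ →L[ℝ] ℝ × ℝ) z₀ := by
    have h1 := ((ContDiff.differentiable hΘ (by simp) z₀).hasFDerivAt).prodMk
      (hasFDerivAt_snd (𝕜 := ℝ) (p := z₀))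
    refine h1.congr_fderiv ?_
    have h2 : fderiv ℝ (fun z : ℝ × ℝ => Θ z.1 z.2) z₀ (1, 0) = c := (hΘ.pdx_eq _ _).symm
    have h3 : fderiv ℝ (fun z : ℝ × ℝ => Θ z.1 z.2) z₀ (0, 1) = d := (hΘ.pdt_eq _ _).symm
    ext <;> simp [e, h2, h3]
  have hat : ContDiffAt ℝ (⊤ : ℕ∞) Φ z₀ := hΦc.contDiffAt
  have hinv := hat.to_localInverse hfd (by simp)
  have hstrict := hat.hasStrictFDerivAt' hfd (by simp)
  have hz : Φ z₀ = (g x₀, t₀) := Prod.ext (hS x₀ t₀) rfl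
  have hG : ContDiff ℝ (⊤ : ℕ∞) fun z : ℝ × ℝ => (g z.1, z.2) :=
    ContDiff.prodMk (hg.comp contDiff_fst) contDiff_snd
  have hright := hstrict.eventually_right_inverse
  rw [hz] at hright
  rw [hz] at hinv
  have hcomp : ContDiffAt ℝ (⊤ : ℕ∞)
      (fun z : ℝ × ℝ => (hat.localInverse hfd (by simp) (g z.1, z.2)).1) (x₀, t₀) :=
    contDiff_fst.contDiffAt.comp (x₀, t₀)
      (ContDiffAt.comp (x₀, t₀) (f := fun z : ℝ × ℝ => (g z.1, z.2)) hinv hG.contDiffAt)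
  refine hcomp.congr_of_eventuallyEq ?_
  have hev := (hG.continuous.continuousAt (x := (x₀, t₀))).eventually hright
  filter_upwards [hev] with z hz'
  have h1 := congrArg Prod.fst hz'
  have h2 := congrArg Prod.snd hz'
  simp only [hΦ] at h1 h2
  rw [h2] at h1
  exact (huniq _ _ _ h1).symm

section WeightedFixedPoint

variable {Z V : Type*} [TopologicalSpace Z] [NormedAddCommGroup V]

/-- Uniqueness for fixed points of a map that halves a weighted sup norm. -/
theorem weighted_fixedPoint_unique {W : Z → ℝ} {Φ : (Z → V) → Z → V}
    (hlip : ∀ w w', Continuous w → Continuous w' → ∀ c, 0 ≤ c →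
      (∀ z, ‖w z - w' z‖ ≤ c * W z) → ∀ z, ‖Φ w z - Φ w' z‖ ≤ c / 2 * W z)
    {w w' : Z → V} (hw : Continuous w) (hw' : Continuous w') (h : Φ w = w) (h' : Φ w' = w')
    {C : ℝ} (hC : 0 ≤ C) (hb : ∀ z, ‖w z - w' z‖ ≤ C * W z) : w = w' := by
  have key : ∀ n : ℕ, ∀ z, ‖w z - w' z‖ ≤ C * (1 / 2) ^ n * W z := by
    intro n
    induction n with
    | zero => simpa using hb
    | succ n ih =>
      intro z
      have := hlip w w' hw hw' _ (by positivity) ih z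
      rw [h, h'] at this
      refine this.trans_eq ?_
      ring
  funext z
  have ht : Filter.Tendsto (fun n : ℕ => C * (1 / 2 : ℝ) ^ n * W z) Filter.atTop (nhds 0) := by
    have := ((tendsto_pow_atTop_nhds_zero_of_lt_one (r := (1 / 2 : ℝ)) (by norm_num)
      (by norm_num)).const_mul C).mul_const (W z)
    simpa using this
  have : ‖w z - w' z‖ ≤ 0 := ge_of_tendsto' ht fun n => key n z
  exact sub_eq_zero.1 (norm_le_zero_iff.1 this)

/-- Existence of a fixed point of a map that halves a weighted sup norm. -/
theorem exists_weighted_fixedPoint [NormedSpace ℝ V] [CompleteSpace V] {W : Z → ℝ}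
    (hW : Continuous W) (hW0 : ∀ z, 0 < W z) {Φ : (Z → V) → Z → V}
    (hcont : ∀ w, Continuous w → Continuous (Φ w))
    (hlip : ∀ w w', Continuous w → Continuous w' → ∀ c, 0 ≤ c →
      (∀ z, ‖w z - w' z‖ ≤ c * W z) → ∀ z, ‖Φ w z - Φ w' z‖ ≤ c / 2 * W z)
    {C : ℝ} (hC : ∀ z, ‖Φ 0 z‖ ≤ C * W z) :
    ∃ w, Continuous w ∧ Φ w = w ∧ ∃ C, 0 ≤ C ∧ ∀ z, ‖w z‖ ≤ C * W z := by
  have hbd : ∀ f : BoundedContinuousFunction Z V, ∀ z,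
      ‖Φ (fun z => W z • f z) z‖ ≤ (‖f‖ / 2 + C) * W z := by
    intro f z
    have h1 := hlip (fun z => W z • f z) 0 (hW.smul f.continuous) continuous_const ‖f‖
      (norm_nonneg _) (fun z => by
        simp only [Pi.zero_apply, sub_zero, norm_smul, Real.norm_eq_abs, abs_of_pos (hW0 z)]
        rw [mul_comm]
        exact mul_le_mul_of_nonneg_right (f.norm_coe_le_norm z) (hW0 z).le) z
    calc ‖Φ (fun z => W z • f z) z‖ = ‖Φ (fun z => W z • f z) z - Φ 0 z + Φ 0 z‖ := by simp
      _ ≤ _ := (norm_add_le _ _).trans (by linarith [hC z])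
  let Ψ : BoundedContinuousFunction Z V → BoundedContinuousFunction Z V := fun f =>
    BoundedContinuousFunction.ofNormedAddCommGroup (fun z => (W z)⁻¹ • Φ (fun z => W z • f z) z)
      ((hW.inv₀ fun z => (hW0 z).ne').smul (hcont _ (hW.smul f.continuous))) (‖f‖ / 2 + C)
      (fun z => by
        rw [norm_smul, norm_inv, Real.norm_eq_abs, abs_of_pos (hW0 z), inv_mul_le_iff₀ (hW0 z)]
        linarith [hbd f z])
  have hΨ : ContractingWith (1 / 2) Ψ := by
    refine ⟨by rw [← NNReal.coe_lt_coe]; norm_num, LipschitzWith.of_dist_le_mul fun f g => ?_⟩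
    refine (BoundedContinuousFunction.dist_le (by positivity)).2 fun z => ?_
    have h1 := hlip (fun z => W z • f z) (fun z => W z • g z) (hW.smul f.continuous)
      (hW.smul g.continuous) (dist f g) dist_nonneg (fun z => by
        rw [← smul_sub, norm_smul, Real.norm_eq_abs, abs_of_pos (hW0 z), mul_comm, ← dist_eq_norm]
        exact mul_le_mul_of_nonneg_right (BoundedContinuousFunction.dist_coe_le_dist z)
          (hW0 z).le) z
    change dist ((W z)⁻¹ • Φ (fun z => W z • f z) z) ((W z)⁻¹ • Φ (fun z => W z • g z) z) ≤ _
    rw [dist_eq_norm, ← smul_sub, norm_smul, norm_inv, Real.norm_eq_abs, abs_of_pos (hW0 z),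
      inv_mul_le_iff₀ (hW0 z)]
    refine h1.trans_eq ?_
    push_cast
    ring
  set f := ContractingWith.fixedPoint Ψ hΨ
  have hf : Ψ f = f := hΨ.fixedPoint_isFixedPt
  refine ⟨fun z => W z • f z, hW.smul f.continuous, funext fun z => ?_, ‖f‖, norm_nonneg _,
    fun z => ?_⟩
  · have : (W z)⁻¹ • Φ (fun z => W z • f z) z = f z := congrArg (fun g => g z) hf
    change _ = W z • f z
    rw [← this, smul_inv_smul₀ (hW0 z).ne']
  · rw [norm_smul, Real.norm_eq_abs, abs_of_pos (hW0 z), mul_comm]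
    exact mul_le_mul_of_nonneg_right (f.norm_coe_le_norm z) (hW0 z).le

end WeightedFixedPoint

theorem abs_integral_le_exp {f : ℝ → ℝ} {c K a b : ℝ} (hK : 0 < K) (hc : 0 ≤ c)
    (hf : ∀ s ∈ Set.uIcc a b, |f s| ≤ c * Real.exp (K * |s - a|)) :
    |∫ s in a..b, f s| ≤ c / K * Real.exp (K * |b - a|) := by
  have main : ∀ {f : ℝ → ℝ} {r : ℝ}, 0 ≤ r → (∀ s ∈ Set.Icc 0 r, |f s| ≤ c * Real.exp (K * s)) →
      |∫ s in (0 : ℝ)..r, f s| ≤ c / K * Real.exp (K * r) := by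
    intro f r hr h
    have hint : ∫ s in (0 : ℝ)..r, c * Real.exp (K * s) = c / K * (Real.exp (K * r) - 1) := by
      rw [intervalIntegral.integral_const_mul, intervalIntegral.integral_comp_mul_left _ hK.ne',
        integral_exp]
      simp
      ring
    have := intervalIntegral.norm_integral_le_of_norm_le hr (f := f) (μ := MeasureTheory.volume)
      (g := fun s => c * Real.exp (K * s)) (.of_forall fun s hs => h s ⟨hs.1.le, hs.2⟩)
      (Continuous.intervalIntegrable (by fun_prop) _ _)
    rw [hint] at this
    refine this.trans ?_
    have : 0 ≤ c / K := by positivity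
    nlinarith
  rcases le_total a b with hab | hab
  · have h := main (f := fun s => f (s + a)) (sub_nonneg.2 hab) (fun s hs => by
      have := hf (s + a) (Set.uIcc_of_le hab ▸ ⟨by linarith [hs.1], by linarith [hs.2]⟩)
      rwa [add_sub_cancel_right, abs_of_nonneg hs.1] at this)
    rwa [intervalIntegral.integral_comp_add_right, zero_add, sub_add_cancel,
      ← abs_of_nonneg (sub_nonneg.2 hab)] at h
  · have h := main (f := fun s => f (a - s)) (sub_nonneg.2 hab) (fun s hs => by
      have := hf (a - s) (Set.uIcc_of_ge hab ▸ ⟨by linarith [hs.2], by linarith [hs.1]⟩)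
      rwa [sub_sub_cancel_left, abs_neg, abs_of_nonneg hs.1] at this)
    rw [intervalIntegral.integral_comp_sub_left, sub_sub_cancel, sub_zero,
      intervalIntegral.integral_symm, abs_neg] at h
    rwa [abs_of_nonpos (sub_nonpos.2 hab), neg_sub]

section SineGordon

open Real

theorem continuous_uncurry_comp {X : Type*} [TopologicalSpace X] {f : ℝ → ℝ → ℝ} {a b : X → ℝ}
    (hf : Continuous fun z : ℝ × ℝ => f z.1 z.2) (ha : Continuous a) (hb : Continuous b) :
    Continuous fun x => f (a x) (b x) :=
  hf.comp (ha.prodMk hb)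

set_option maxHeartbeats 400000 in
/-- Cauchy problem on the diagonal for the sine-Gordon equation `w_yt = sin w`. -/
theorem exists_sineGordon (w₀ : ℝ) {P R : ℝ → ℝ} (hP : ContDiff ℝ (⊤ : ℕ∞) P)
    (hR : ContDiff ℝ (⊤ : ℕ∞) R) :
    ∃ w : ℝ → ℝ → ℝ, Smooth2 w ∧ w 0 0 = w₀ ∧
      (∀ y t, HasDerivAt (fun y => w y t) (P y + ∫ τ in y..t, sin (w y τ)) y) ∧
      (∀ y t, HasDerivAt (fun t => w y t) (R t + ∫ η in t..y, sin (w η t)) t) ∧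
      ∀ a, (∀ y, P (y + a) = P y) → (∀ t, R (t + a) = R t) →
        (∫ s in 0..a, P s) + (∫ s in 0..a, R s) = 0 → ∀ y t, w (y + a) (t + a) = w y t := by
  set l : ℝ × ℝ → ℝ := fun z => w₀ + (∫ s in 0..z.1, P s) + ∫ s in 0..z.2, R s with hl
  have hlc : Continuous l :=
    (continuous_const.add (continuous_integral_of_continuous (f := fun _ s => P s)
      (hP.continuous.comp continuous_snd) continuous_const continuous_fst)).add
      (continuous_integral_of_continuous (f := fun _ s => R s)
      (hR.continuous.comp continuous_snd) continuous_const continuous_snd)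
  set Φ : (ℝ × ℝ → ℝ) → ℝ × ℝ → ℝ := fun v z =>
    ∫ η in z.2..z.1, ∫ τ in η..z.2, sin (l (η, τ) + v (η, τ)) with hΦ
  set W : ℝ × ℝ → ℝ := fun z => exp (2 * |z.1 - z.2|) with hW
  have hlip : ∀ w w' : ℝ × ℝ → ℝ, Continuous w → Continuous w' → ∀ c, 0 ≤ c →
      (∀ z, ‖w z - w' z‖ ≤ c * W z) → ∀ z, ‖Φ w z - Φ w' z‖ ≤ c / 2 * W z := by
    intro w w' hw hw' c hc h z
    have hin : ∀ w : ℝ × ℝ → ℝ, Continuous w → ∀ η t, IntervalIntegrable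
        (fun τ => sin (l (η, τ) + w (η, τ))) MeasureTheory.volume η t := fun w hw η t =>
      Continuous.intervalIntegrable (by fun_prop) _ _
    have hout : ∀ w : ℝ × ℝ → ℝ, Continuous w → ∀ y t, IntervalIntegrable
        (fun η => ∫ τ in η..t, sin (l (η, τ) + w (η, τ))) MeasureTheory.volume t y :=
      fun w hw y t => Continuous.intervalIntegrable (continuous_integral_of_continuous
        (f := fun η τ => sin (l (η, τ) + w (η, τ))) (by fun_prop) continuous_id continuous_const) _ _
    simp only [hΦ, Real.norm_eq_abs]
    rw [← intervalIntegral.integral_sub (hout w hw _ _) (hout w' hw' _ _)]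
    have h1 : ∀ η ∈ Set.uIcc z.2 z.1, |(∫ τ in η..z.2, sin (l (η, τ) + w (η, τ)))
        - ∫ τ in η..z.2, sin (l (η, τ) + w' (η, τ))| ≤ c / 2 * exp (2 * |η - z.2|) := by
      intro η _
      rw [← intervalIntegral.integral_sub (hin w hw _ _) (hin w' hw' _ _), abs_sub_comm η]
      refine abs_integral_le_exp two_pos hc fun τ _ => ?_
      refine (abs_sin_sub_sin_le _ _).trans ?_
      rw [add_sub_add_left_eq_sub, abs_sub_comm τ]
      exact h (η, τ)
    refine (abs_integral_le_exp two_pos (by positivity) h1).trans ?_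
    simp only [hW]
    exact mul_le_mul_of_nonneg_right (by linarith) (exp_pos _).le
  have hcont : ∀ v, Continuous v → Continuous (Φ v) := by
    intro v hv
    refine continuous_integral_of_continuous
      (f := fun (z : ℝ × ℝ) η => ∫ τ in η..z.2, sin (l (η, τ) + v (η, τ))) ?_
      continuous_snd continuous_fst
    exact continuous_integral_of_continuous
      (f := fun (z : (ℝ × ℝ) × ℝ) τ => sin (l (z.2, τ) + v (z.2, τ))) (by fun_prop)
      continuous_snd (continuous_snd.comp continuous_fst)
  have h0 : ∀ z, ‖Φ 0 z‖ ≤ 1 * W z := by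
    intro z
    have h1 : ∀ η ∈ Set.uIcc z.2 z.1, |∫ τ in η..z.2, sin (l (η, τ) + 0)|
        ≤ 1 / 2 * exp (2 * |η - z.2|) := by
      intro η _
      rw [abs_sub_comm η]
      refine abs_integral_le_exp two_pos zero_le_one fun τ _ => ?_
      rw [one_mul]
      exact (abs_sin_le_one _).trans (one_le_exp (by positivity))
    refine (abs_integral_le_exp two_pos (by positivity) h1).trans ?_
    simp only [hW]
    exact mul_le_mul_of_nonneg_right (by norm_num) (exp_pos _).le
  obtain ⟨v, hv, hfix, C, hC, hb⟩ := exists_weighted_fixedPoint (W := W) (by fun_prop)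
    (fun z => exp_pos _) hcont hlip h0
  obtain ⟨w, hw⟩ : ∃ w : ℝ → ℝ → ℝ, ∀ y t, w y t = l (y, t) + v (y, t) := ⟨_, fun _ _ => rfl⟩
  have hwc : Continuous fun z : ℝ × ℝ => w z.1 z.2 := by
    simp only [hw]
    exact hlc.add hv
  have hsc : Continuous fun z : ℝ × ℝ => sin (w z.1 z.2) := continuous_sin.comp hwc
  obtain ⟨g, hg⟩ : ∃ g : ℝ → ℝ → ℝ, ∀ t η, g t η = ∫ τ in η..t, sin (w η τ) := ⟨_, fun _ _ => rfl⟩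
  have hgc : Continuous fun z : ℝ × ℝ => g z.1 z.2 := by
    simp only [hg]
    exact continuous_integral_of_continuous (f := fun (z : ℝ × ℝ) τ => sin (w z.2 τ))
      (continuous_uncurry_comp (f := fun y t => sin (w y t)) hsc (by fun_prop) (by fun_prop)) continuous_snd continuous_fst
  have hveq : ∀ y t, v (y, t) = ∫ η in t..y, g t η := fun y t => by
    simp only [hg, hw]
    exact (congrFun hfix (y, t)).symm
  have hwy : ∀ y t, HasDerivAt (fun y => w y t) (P y + ∫ τ in y..t, sin (w y τ)) y := by
    intro y t
    have h1 : HasDerivAt (fun y => l (y, t)) (P y) y :=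
      (((hP.continuous.integral_hasStrictDerivAt 0 y).hasDerivAt).const_add w₀).add_const
        (∫ s in 0..t, R s)
    have h2 : HasDerivAt (fun y => v (y, t)) (g t y) y := by
      simp only [hveq]
      exact ((continuous_uncurry_comp hgc continuous_const continuous_id).integral_hasStrictDerivAt
        t y).hasDerivAt
    simp only [hw] at h1 h2 ⊢
    simp only [hg, hw] at h2
    exact h1.add h2
  have hwt : ∀ y t, HasDerivAt (fun t => w y t) (R t + ∫ η in t..y, sin (w η t)) t := by
    intro y t
    have h1 : HasDerivAt (fun t => l (y, t)) (R t) t :=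
      ((hR.continuous.integral_hasStrictDerivAt 0 t).hasDerivAt).const_add (w₀ + ∫ s in 0..y, P s)
    have hgt : ∀ t η, HasDerivAt (fun t => g t η) (sin (w η t)) t := fun t η => by
      simp only [hg]
      exact ((continuous_uncurry_comp (f := fun y t => sin (w y t)) hsc continuous_const
        continuous_id).integral_hasStrictDerivAt η t).hasDerivAt
    have hsc' : Continuous fun z : ℝ × ℝ => sin (w z.2 z.1) :=
      continuous_uncurry_comp (f := fun y t => sin (w y t)) hsc 
        continuous_snd continuous_fst
    have hH₁ : ∀ z y, HasDerivAt (fun z => ∫ η in 0..y, g z η) (∫ η in 0..y, sin (w η z)) z :=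
      fun z y => hasDerivAt_integral_of_continuous (f := g) (f' := fun z η => sin (w η z))
        hgc hsc' hgt 0 y z
    have hH₂ : ∀ z y, HasDerivAt (fun y => ∫ η in 0..y, g z η) (g z y) y := fun z y =>
      ((continuous_uncurry_comp hgc continuous_const continuous_id).integral_hasStrictDerivAt
        0 y).hasDerivAt
    have hH := contDiff_succ_of_partials (n := 0) hH₁ hH₂
      (contDiff_zero.2 (continuous_integral_of_continuous
        (f := fun (z : ℝ × ℝ) η => sin (w η z.1)) (continuous_uncurry_comp (f := fun y t => sin (w y t)) hsc (by fun_prop) (by fun_prop))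
        continuous_const continuous_snd)) (contDiff_zero.2 hgc)
    have hHd := (hH.differentiable (by simp) (t, t)).hasFDerivAt
    have e₁ := (hHd.comp_hasDerivAt_of_eq t ((hasDerivAt_id t).prodMk (hasDerivAt_const t t)) rfl).unique
      (hH₁ t t)
    have e₂ := (hHd.comp_hasDerivAt_of_eq t ((hasDerivAt_const t t).prodMk (hasDerivAt_id t)) rfl).unique
      (hH₂ t t)
    have hdiag := hHd.comp_hasDerivAt_of_eq t ((hasDerivAt_id t).prodMk (hasDerivAt_id t)) rfl
    rw [show ((1 : ℝ), (1 : ℝ)) = (1, 0) + (0, 1) by simp, map_add, e₁, e₂] at hdiag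
    have hgtt : g t t = 0 := (hg t t).trans intervalIntegral.integral_same
    rw [hgtt, add_zero] at hdiag
    have h2 : HasDerivAt (fun t => v (y, t)) (∫ η in t..y, sin (w η t)) t := by
      have hci : ∀ a b, IntervalIntegrable (fun η => sin (w η t)) MeasureTheory.volume a b :=
        fun a b => (continuous_uncurry_comp (f := fun y t => sin (w y t)) hsc 
          continuous_id continuous_const).intervalIntegrable a b
      rw [← intervalIntegral.integral_interval_sub_left (hci 0 y) (hci 0 t)]
      refine ((hH₁ t y).sub hdiag).congr_of_eventuallyEq (.of_forall fun z => ?_)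
      have hcg : ∀ a b, IntervalIntegrable (g z) MeasureTheory.volume a b :=
        fun a b => (continuous_uncurry_comp hgc continuous_const continuous_id).intervalIntegrable a b
      change v (y, z) = _
      rw [hveq, ← intervalIntegral.integral_interval_sub_left (hcg 0 y) (hcg 0 z)]
      rfl
    exact (h1.add h2).congr_of_eventuallyEq (.of_forall fun z => hw y z)
  refine ⟨w, ?_, ?_, hwy, hwt, ?_⟩
  · refine contDiff_infty.2 fun n => ?_
    induction n with
    | zero => exact contDiff_zero.2 hwc
    | succ n ih =>
      have hs : ContDiff ℝ n fun z : ℝ × ℝ => sin (w z.1 z.2) := contDiff_sin.comp ih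
      have i₁ := contDiff_integral (f := fun y τ => sin (w y τ)) hs
      have i₂ := contDiff_integral_fst (f := fun η t => sin (w η t)) hs
      refine contDiff_succ_of_partials hwy hwt ?_ ?_
      · have hP' : ContDiff ℝ n P := hP.of_le (by exact_mod_cast le_top)
        refine (hP'.comp contDiff_fst).add ?_
        have e : (fun z : ℝ × ℝ => ∫ τ in z.1..z.2, sin (w z.1 τ)) = fun z : ℝ × ℝ =>
            (∫ τ in 0..z.2, sin (w z.1 τ)) - ∫ τ in 0..z.1, sin (w z.1 τ) := funext fun z =>
          (intervalIntegral.integral_interval_sub_left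
            ((continuous_uncurry_comp (f := fun y t => sin (w y t)) hsc continuous_const continuous_id).intervalIntegrable _ _)
            ((continuous_uncurry_comp (f := fun y t => sin (w y t)) hsc continuous_const continuous_id).intervalIntegrable _ _)).symm
        rw [e]
        exact i₁.sub (i₁.comp (contDiff_fst.prodMk contDiff_fst))
      · have hR' : ContDiff ℝ n R := hR.of_le (by exact_mod_cast le_top)
        refine (hR'.comp contDiff_snd).add ?_
        have e : (fun z : ℝ × ℝ => ∫ η in z.2..z.1, sin (w η z.2)) = fun z : ℝ × ℝ =>
            (∫ η in 0..z.1, sin (w η z.2)) - ∫ η in 0..z.2, sin (w η z.2) := funext fun z =>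
          (intervalIntegral.integral_interval_sub_left
            ((continuous_uncurry_comp (f := fun y t => sin (w y t)) hsc continuous_id continuous_const).intervalIntegrable _ _)
            ((continuous_uncurry_comp (f := fun y t => sin (w y t)) hsc continuous_id continuous_const).intervalIntegrable _ _)).symm
        rw [e]
        exact i₂.sub (i₂.comp (contDiff_snd.prodMk contDiff_snd))
  · simp [hw, hl, hveq]
  · intro a hPa hRa hint y t
    have hint' : ∀ {f : ℝ → ℝ}, Continuous f → (∀ y, f (y + a) = f y) → ∀ y,
        ∫ s in 0..y + a, f s = (∫ s in 0..y, f s) + ∫ s in 0..a, f s := by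
      intro f hf hfa y
      rw [← intervalIntegral.integral_add_adjacent_intervals (hf.intervalIntegrable 0 a)
        (hf.intervalIntegrable a (y + a)), add_comm]
      congr 1
      have := intervalIntegral.integral_comp_add_right (a := 0) (b := y) f a
      simp only [hfa, zero_add] at this
      exact this.symm
    have hla : ∀ y t, l (y + a, t + a) = l (y, t) := by
      intro y t
      simp only [hl]
      rw [hint' hP.continuous hPa, hint' hR.continuous hRa]
      linear_combination hint
    set v' : ℝ × ℝ → ℝ := fun z => v (z.1 + a, z.2 + a) with hv'
    have hfix' : Φ v' = v' := by
      funext z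
      simp only [hv']
      rw [← hfix]
      simp only [hΦ]
      rw [← intervalIntegral.integral_comp_add_right]
      refine intervalIntegral.integral_congr fun η _ => ?_
      rw [← intervalIntegral.integral_comp_add_right]
      refine intervalIntegral.integral_congr fun τ _ => ?_
      rw [hla, ← congrFun hfix]
    have hvv : v' = v := by
      refine weighted_fixedPoint_unique hlip (hv.comp (by fun_prop)) hv hfix' hfix
        (add_nonneg hC hC) fun z => ?_
      refine (norm_sub_le _ _).trans ?_
      have := hb (z.1 + a, z.2 + a)
      simp only [hW, add_sub_add_right_eq_sub] at this hb ⊢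
      linarith [hb z]
    have := congrFun hvv (y, t)
    simp only [hw, hla]
    rw [← this]

end SineGordon

section Lagrangian

theorem Smooth2.comp {f a b : ℝ → ℝ → ℝ} (hf : Smooth2 f) (ha : Smooth2 a) (hb : Smooth2 b) :
    Smooth2 fun x t => f (a x t) (b x t) :=
  ContDiff.comp (g := fun z : ℝ × ℝ => f z.1 z.2) hf (ContDiff.prodMk ha hb)

theorem Smooth2.hasDerivAt_comp {f : ℝ → ℝ → ℝ} (hf : Smooth2 f) {a b : ℝ → ℝ} {a' b' x : ℝ}
    (ha : HasDerivAt a a' x) (hb : HasDerivAt b b' x) :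
    HasDerivAt (fun x => f (a x) (b x))
      (_root_.pdx f (a x) (b x) * a' + _root_.pdt f (a x) (b x) * b') x := by
  have h := (ContDiff.differentiable hf (by simp) (a x, b x)).hasFDerivAt.comp_hasDerivAt x
    (ha.prodMk hb)
  refine h.congr_deriv ?_
  rw [hf.pdx_eq, hf.pdt_eq, dirDeriv, dirDeriv,
    show (a', b') = a' • ((1 : ℝ), (0 : ℝ)) + b' • ((0 : ℝ), (1 : ℝ)) by simp, map_add, map_smul,
    map_smul, smul_eq_mul, smul_eq_mul]
  ring

/-- If `u_t = ½ u² u_x + Z` and `Z_x = ε u`, then `u` solves the short pulse equation. -/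
theorem isSPESol_of_transport {ε : ℝ} {u Z : ℝ → ℝ → ℝ} (hu : Smooth2 u) (hZ : Smooth2 Z)
    (hut : ∀ x t, pdt u x t = 1 / 2 * u x t ^ 2 * pdx u x t + Z x t)
    (hZx : ∀ x t, pdx Z x t = ε * u x t) :
    IsSPESol ε (1 / 2) u ∧ ∀ x t, pdt (pdt u) x t = u x t * pdt u x t * pdx u x t
        + 1 / 2 * u x t ^ 2 * (ε * u x t + u x t * pdx u x t ^ 2
          + 1 / 2 * u x t ^ 2 * pdx (pdx u) x t) + pdt Z x t := by
  have hut' : pdt u = fun x t => 1 / 2 * u x t ^ 2 * pdx u x t + Z x t :=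
    funext fun x => funext fun t => hut x t
  have huxt : ∀ x t, pdx (pdt u) x t
      = ε * u x t + u x t * pdx u x t ^ 2 + 1 / 2 * u x t ^ 2 * pdx (pdx u) x t := by
    intro x t
    rw [hut']
    refine (((((hu.hasDerivAt_fst x t).pow 2).const_mul (1 / 2)).mul
      (hu.pdx.hasDerivAt_fst x t)).add (hZ.hasDerivAt_fst x t)).deriv.trans ?_
    rw [hZx]
    simp only [Pi.pow_apply]
    ring
  refine ⟨⟨hu, fun x t => ?_⟩, fun x t => ?_⟩
  · rw [huxt]
    have h₁ : pdx (fun x t => u x t ^ 3) = fun x t => 3 * u x t ^ 2 * pdx u x t := by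
      funext x t
      refine ((hu.hasDerivAt_fst x t).pow 3).deriv.trans ?_
      norm_num
    have h₂ : pdx (fun x t => 3 * u x t ^ 2 * pdx u x t) x t
        = 6 * u x t * pdx u x t ^ 2 + 3 * u x t ^ 2 * pdx (pdx u) x t := by
      refine ((((hu.hasDerivAt_fst x t).pow 2).const_mul 3).mul
        (hu.pdx.hasDerivAt_fst x t)).deriv.trans ?_
      simp only [Pi.pow_apply]
      ring
    rw [h₁, h₂]
    ring
  · have h : pdt (pdt u) x t = deriv (fun t => 1 / 2 * u x t ^ 2 * pdx u x t + Z x t) t := by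
      rw [hut']; rfl
    rw [h]
    refine (((((hu.hasDerivAt_snd x t).pow 2).const_mul (1 / 2)).mul
      (hu.pdx.hasDerivAt_snd x t)).add (hZ.hasDerivAt_snd x t)).deriv.trans ?_
    rw [hu.pdt_pdx, huxt]
    simp only [Pi.pow_apply]
    ring

/-- A solution in Lagrangian form: `S` is a label function transported with speed `-½ u²`, and
`u = U (S, t)`. -/
theorem isSPESol_lagrangian {ε : ℝ} {S U : ℝ → ℝ → ℝ} (hS : Smooth2 S) (hU : Smooth2 U)
    (hSt : ∀ x t, pdt S x t = 1 / 2 * U (S x t) t ^ 2 * pdx S x t)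
    (hZ : ∀ x t, pdx (pdt U) (S x t) t * pdx S x t = ε * U (S x t) t) :
    IsSPESol ε (1 / 2) (fun x t => U (S x t) t) ∧
      (∀ x t, pdx (fun x t => U (S x t) t) x t = pdx U (S x t) t * pdx S x t) ∧
      (∀ x t, pdt (fun x t => U (S x t) t) x t =
        1 / 2 * U (S x t) t ^ 2 * pdx (fun x t => U (S x t) t) x t + pdt U (S x t) t) ∧
      ∀ x t, pdt (pdt (fun x t => U (S x t) t)) x t =
        U (S x t) t * pdt (fun x t => U (S x t) t) x t * pdx (fun x t => U (S x t) t) x t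
        + 1 / 2 * U (S x t) t ^ 2 * (ε * U (S x t) t
          + U (S x t) t * pdx (fun x t => U (S x t) t) x t ^ 2
          + 1 / 2 * U (S x t) t ^ 2 * pdx (pdx (fun x t => U (S x t) t)) x t)
        + pdt (pdt U) (S x t) t + 1 / 2 * ε * U (S x t) t ^ 3 := by
  have hux : ∀ x t, pdx (fun x t => U (S x t) t) x t = pdx U (S x t) t * pdx S x t := fun x t =>
    (hU.hasDerivAt_comp (hS.hasDerivAt_fst x t) (hasDerivAt_const x t)).deriv.trans (by ring)
  have hut : ∀ x t, pdt (fun x t => U (S x t) t) x t =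
      1 / 2 * U (S x t) t ^ 2 * pdx (fun x t => U (S x t) t) x t + pdt U (S x t) t := fun x t =>
    (hU.hasDerivAt_comp (hS.hasDerivAt_snd x t) (hasDerivAt_id t)).deriv.trans (by
      rw [hux, id, hSt]; ring)
  have hZx : ∀ x t, pdx (fun x t => pdt U (S x t) t) x t = ε * U (S x t) t := fun x t =>
    (hU.pdt.hasDerivAt_comp (hS.hasDerivAt_fst x t) (hasDerivAt_const x t)).deriv.trans (by
      rw [hZ]; ring)
  have hZt : ∀ x t, pdt (fun x t => pdt U (S x t) t) x t
      = pdt (pdt U) (S x t) t + 1 / 2 * ε * U (S x t) t ^ 3 := fun x t =>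
    (hU.pdt.hasDerivAt_comp (hS.hasDerivAt_snd x t) (hasDerivAt_id t)).deriv.trans (by
      rw [id, hSt]
      linear_combination 1 / 2 * U (S x t) t ^ 2 * hZ x t)
  have hsnd : Smooth2 fun _ t => t := contDiff_snd
  obtain ⟨hsol, htt⟩ := isSPESol_of_transport (hU.comp hS hsnd) (hU.pdt.comp hS hsnd) hut hZx
  refine ⟨hsol, hux, hut, fun x t => ?_⟩
  rw [htt, hZt]
  ring

end Lagrangian

section SineGordonToSPE

open Real

theorem strictMono_surjective_of_le_deriv {f f' : ℝ → ℝ} {c : ℝ} (hc : 0 < c)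
    (hf : ∀ x, HasDerivAt f (f' x) x) (hf' : ∀ x, c ≤ f' x) :
    StrictMono f ∧ Function.Surjective f := by
  have hd : Differentiable ℝ f := fun x => (hf x).differentiableAt
  have hderiv : ∀ x, deriv f x = f' x := fun x => (hf x).deriv
  have hle : ∀ x y, x ≤ y → c * (y - x) ≤ f y - f x := fun x y hxy =>
    mul_sub_le_image_sub_of_le_deriv hd (fun x => (hderiv x).symm ▸ hf' x) hxy
  refine ⟨strictMono_of_deriv_pos fun x => ?_, ?_⟩
  · rw [hderiv]
    exact hc.trans_le (hf' x)
  · refine hd.continuous.surjective ?_ ?_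
    · refine Filter.tendsto_atTop_mono' _ (f₁ := fun x => c * x + f 0) ?_
        (Filter.tendsto_atTop_add_const_right _ _ (Filter.tendsto_id.const_mul_atTop hc))
      filter_upwards [Filter.eventually_ge_atTop 0] with x hx
      linarith [hle 0 x hx]
    · refine Filter.tendsto_atBot_mono' (f₂ := f) (f₁ := fun x => c * x + f 0) _ ?_
        (Filter.tendsto_atBot_add_const_right _ _ (Filter.tendsto_id.const_mul_atBot hc))
      filter_upwards [Filter.eventually_le_atBot 0] with x hx
      linarith [hle x 0 hx]

/-- The hodograph transformation from the sine-Gordon equation to the short pulse equation. -/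
theorem exists_isSPESol_of_sineGordon {w : ℝ → ℝ → ℝ} (hw : Smooth2 w)
    (hsg : ∀ y t, pdx (pdt w) y t = sin (w y t)) {c : ℝ} (hc : 0 < c)
    (hcos : ∀ y t, c ≤ cos (w y t)) :
    ∃ u, IsSPESol 1 (1 / 2) u ∧ u 0 0 = pdt w 0 0 ∧ pdx u 0 0 = tan (w 0 0) ∧
      pdx (pdx u) 0 0 = pdx w 0 0 / cos (w 0 0) ^ 3 ∧
      pdt u 0 0 = 1 / 2 * u 0 0 ^ 2 * pdx u 0 0 + pdt (pdt w) 0 0 ∧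
      pdt (pdt u) 0 0 = u 0 0 * pdt u 0 0 * pdx u 0 0
        + 1 / 2 * u 0 0 ^ 2 * (1 * u 0 0 + u 0 0 * pdx u 0 0 ^ 2
          + 1 / 2 * u 0 0 ^ 2 * pdx (pdx u) 0 0)
        + pdt (pdt (pdt w)) 0 0 + 1 / 2 * 1 * u 0 0 ^ 3 := by
  have hcw : Smooth2 fun y t => cos (w y t) := contDiff_cos.comp hw
  have hw0 : ContDiff ℝ (⊤ : ℕ∞) fun t => pdt w 0 t ^ 2 :=
    (ContDiff.comp (g := fun z : ℝ × ℝ => pdt w z.1 z.2) hw.pdt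
      (contDiff_const.prodMk contDiff_id)).pow 2
  obtain ⟨X, hX⟩ : ∃ X : ℝ → ℝ → ℝ, ∀ y t,
    X y t = (∫ s in 0..y, cos (w s t)) - 1 / 2 * ∫ τ in 0..t, pdt w 0 τ ^ 2 := ⟨_, fun _ _ => rfl⟩
  have hXs : Smooth2 X := by
    refine contDiff_infty.2 fun n => ?_
    have h₁ := contDiff_integral_fst (f := fun s t => cos (w s t)) (contDiff_infty.1 hcw n)
    have h₂ := contDiff_integral (f := fun _ τ => pdt w 0 τ ^ 2)
      ((contDiff_infty.1 hw0 n).comp contDiff_snd)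
    simp only [hX]
    exact h₁.sub (contDiff_const.mul h₂)
  have hXy : ∀ y t, HasDerivAt (fun y => X y t) (cos (w y t)) y := by
    intro y t
    simp only [hX]
    exact ((continuous_uncurry_comp (f := fun y t => cos (w y t)) hcw.continuous continuous_id
      continuous_const).integral_hasStrictDerivAt 0 y).hasDerivAt.sub_const _
  have hXt : ∀ y t, HasDerivAt (fun t => X y t) (-(1 / 2) * pdt w y t ^ 2) t := by
    intro y t
    have h₁ := hasDerivAt_integral_of_continuous (f := fun t s => cos (w s t))
      (f' := fun t s => -sin (w s t) * pdt w s t)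
      (continuous_uncurry_comp (f := fun y t => cos (w y t)) hcw.continuous continuous_snd continuous_fst)
      (((continuous_sin.comp (continuous_uncurry_comp hw.continuous continuous_snd
        continuous_fst)).neg.mul
        (continuous_uncurry_comp hw.pdt.continuous continuous_snd continuous_fst)))
      (fun t s => (hw.hasDerivAt_snd s t).cos) 0 y t
    have h₂ := (hw0.continuous.integral_hasStrictDerivAt 0 t).hasDerivAt.const_mul (1 / 2)
    have h₃ : ∫ s in 0..y, -sin (w s t) * pdt w s t
        = -(1 / 2) * pdt w y t ^ 2 - -(1 / 2) * pdt w 0 t ^ 2 := by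
      refine intervalIntegral.integral_eq_sub_of_hasDerivAt
        (f := fun s => -(1 / 2) * pdt w s t ^ 2) (fun s _ => ?_)
        (((continuous_sin.comp (continuous_uncurry_comp hw.continuous continuous_id
          continuous_const)).neg.mul
        (continuous_uncurry_comp hw.pdt.continuous continuous_id
          continuous_const)).intervalIntegrable _ _)
      refine (((hw.pdt.hasDerivAt_fst s t).pow 2).const_mul (-(1 / 2))).congr_deriv ?_
      rw [hsg]
      ring
    refine HasDerivAt.congr_deriv (f' := _ - _) (by simp only [hX]; exact h₁.sub h₂) ?_
    rw [h₃]
    ring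
  have hbij := fun t => strictMono_surjective_of_le_deriv hc (fun y => hXy y t) fun y => hcos y t
  choose S' hS' using fun t => (hbij t).2
  obtain ⟨S, hS⟩ : ∃ S : ℝ → ℝ → ℝ, ∀ x t, X (S x t) t = x := ⟨fun x t => S' t x, fun x t => hS' t x⟩
  have hpos : ∀ y t, 0 < cos (w y t) := fun y t => hc.trans_le (hcos y t)
  have hSs : Smooth2 S := smooth2_of_unique_level hXs contDiff_id hS
    (fun σ x t h => (hbij t).1.injective (h.trans (hS x t).symm))
    fun x t => by rw [pdx, (hXy _ _).deriv]; exact (hpos _ _).ne'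
  have hpX : ∀ y t, pdx X y t = cos (w y t) := fun y t => (hXy y t).deriv
  have hpT : ∀ y t, pdt X y t = -(1 / 2) * pdt w y t ^ 2 := fun y t => (hXt y t).deriv
  have hSx : ∀ x t, pdx S x t = 1 / cos (w (S x t) t) := by
    intro x t
    have h := hXs.hasDerivAt_comp (hSs.hasDerivAt_fst x t) (hasDerivAt_const x t)
    simp only [hS] at h
    have := h.unique (hasDerivAt_id x)
    rw [hpX] at this
    rw [eq_div_iff (hpos _ _).ne']
    linarith
  have hSt : ∀ x t, pdt S x t = 1 / 2 * pdt w (S x t) t ^ 2 * pdx S x t := by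
    intro x t
    have h := hXs.hasDerivAt_comp (hSs.hasDerivAt_snd x t) (hasDerivAt_id t)
    simp only [id, hS] at h
    have := h.unique (hasDerivAt_const t x)
    rw [hpX, hpT] at this
    rw [hSx]
    have := hpos (S x t) t
    field_simp
    linarith
  have hS0 : S 0 0 = 0 := (hbij 0).1.injective ((hS 0 0).trans (by simp [hX]))
  have hcdx : ∀ x t, HasDerivAt (fun x => tan (w (S x t) t))
      (1 / cos (w (S x t) t) ^ 2 * (pdx w (S x t) t * pdx S x t)) x := by
    intro x t
    have h₁ : HasDerivAt (fun x => w (S x t) t) (pdx w (S x t) t * pdx S x t) x :=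
      (hw.hasDerivAt_comp (hSs.hasDerivAt_fst x t) (hasDerivAt_const x t)).congr_deriv (by ring)
    have h₂ : HasDerivAt tan (1 / cos (w (S x t) t) ^ 2) (w (S x t) t) :=
      hasDerivAt_tan (hpos _ _).ne'
    exact h₂.comp x h₁
  obtain ⟨hsol, hx, ht, htt⟩ := isSPESol_lagrangian (ε := 1) hSs hw.pdt hSt (fun x t => by
    rw [← hw.pdt.pdt_pdx, hSx, funext fun y => funext fun t => hsg y t, pdt,
      ((hw.hasDerivAt_snd (S x t) t).sin).deriv]
    have := hpos (S x t) t
    field_simp)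
  have hx' : ∀ x t, pdx (fun x t => pdt w (S x t) t) x t = tan (w (S x t) t) := by
    intro x t
    rw [hx, hsg, hSx, tan_eq_sin_div_cos]
    ring
  refine ⟨_, hsol, ?_, ?_, ?_, ?_, ?_⟩
  · rw [hS0]
  · rw [hx', hS0]
  · have := (hcdx 0 0).deriv
    rw [hSx, hS0] at this
    rw [funext fun x => funext fun t => hx' x t]
    refine this.trans ?_
    have := hpos 0 0
    field_simp
  · rw [ht, hS0]
  · rw [htt, hS0]

end SineGordonToSPE

section SineGordonEnergy

open Real

/-- Energy density of the sine-Gordon equation `w_yt = sin w`. -/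
noncomputable def sineGordonEnergy (w : ℝ → ℝ → ℝ) (y t : ℝ) : ℝ :=
  1 / 2 * pdx w y t ^ 2 + 1 / 2 * pdt w y t ^ 2 + 2 * (1 - cos (w y t))

variable {w : ℝ → ℝ → ℝ} {a : ℝ}

theorem Smooth2.sineGordonEnergy (hw : Smooth2 w) : Smooth2 (sineGordonEnergy w) :=
  ((contDiff_const.mul (ContDiff.pow hw.pdx 2)).add (contDiff_const.mul (ContDiff.pow hw.pdt 2))).add
    (contDiff_const.mul (contDiff_const.sub (contDiff_cos.comp hw)))

theorem sineGordonEnergy_pdt (hw : Smooth2 w) (hsg : ∀ y t, pdx (pdt w) y t = sin (w y t))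
    (y t : ℝ) : pdt (sineGordonEnergy w) y t =
      pdx (fun y t => 1 / 2 * pdt w y t ^ 2 + (1 - cos (w y t))) y t +
      pdt (fun y t => 1 / 2 * pdt w y t ^ 2 + (1 - cos (w y t))) y t := by
  have h₁ := (((hw.pdx.hasDerivAt_snd y t).pow 2).const_mul (1 / 2)).add
    (((hw.pdt.hasDerivAt_snd y t).pow 2).const_mul (1 / 2)) |>.add
    (((hw.hasDerivAt_snd y t).cos.const_sub 1).const_mul 2)
  have h₂ := (((hw.pdt.hasDerivAt_fst y t).pow 2).const_mul (1 / 2)).add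
    ((hw.hasDerivAt_fst y t).cos.const_sub 1)
  have h₃ := (((hw.pdt.hasDerivAt_snd y t).pow 2).const_mul (1 / 2)).add
    ((hw.hasDerivAt_snd y t).cos.const_sub 1)
  refine h₁.deriv.trans ((congrArg₂ (· + ·) h₂.deriv h₃.deriv).trans ?_).symm
  rw [hw.pdt_pdx, hsg]
  simp only [Nat.cast_ofNat]
  ring

theorem sineGordonEnergy_integral_eq (hw : Smooth2 w)
    (hsg : ∀ y t, pdx (pdt w) y t = sin (w y t)) (hper : ∀ y t, w (y + a) (t + a) = w y t) (T : ℝ) :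
    ∫ s in 0..a, sineGordonEnergy w s (s - T) = ∫ s in 0..a, sineGordonEnergy w s s := by
  have he := hw.sineGordonEnergy
  obtain ⟨h, hh⟩ : ∃ h : ℝ → ℝ → ℝ, h = fun y t => 1 / 2 * pdt w y t ^ 2 + (1 - cos (w y t)) :=
    ⟨_, rfl⟩
  have hhs : Smooth2 h := by
    rw [hh]
    exact (contDiff_const.mul (ContDiff.pow hw.pdt 2)).add
      (contDiff_const.sub (contDiff_cos.comp hw))
  have hpt : ∀ T, pdt w a (a - T) = pdt w 0 (0 - T) := by
    intro T
    have h₁ : HasDerivAt (fun t => w a (t + a)) (pdt w a (0 - T + a)) (0 - T) :=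
      (hw.hasDerivAt_snd a (0 - T + a)).comp_add_const (0 - T) a
    have h₂ : (fun t => w a (t + a)) = fun t => w 0 t := by
      funext t
      rw [← hper 0 t, zero_add]
    rw [h₂] at h₁
    rw [show a - T = 0 - T + a by ring]
    exact h₁.unique (hw.hasDerivAt_snd 0 (0 - T))
  have key : ∀ T, HasDerivAt (fun T => ∫ s in 0..a, sineGordonEnergy w s (s - T)) 0 T := by
    intro T
    have hc₁ : Continuous fun z : ℝ × ℝ => sineGordonEnergy w z.2 (z.2 - z.1) :=
      continuous_uncurry_comp he.continuous continuous_snd (continuous_snd.sub continuous_fst)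
    have hc₂ : Continuous fun z : ℝ × ℝ => -(pdx h z.2 (z.2 - z.1) + pdt h z.2 (z.2 - z.1)) :=
      ((continuous_uncurry_comp hhs.pdx.continuous continuous_snd
        (continuous_snd.sub continuous_fst)).add (continuous_uncurry_comp hhs.pdt.continuous
        continuous_snd (continuous_snd.sub continuous_fst))).neg
    have h₁ := hasDerivAt_integral_of_continuous
      (f := fun T s => sineGordonEnergy w s (s - T))
      (f' := fun T s => -(pdx h s (s - T) + pdt h s (s - T))) hc₁ hc₂ (fun T s => by
        refine (he.hasDerivAt_comp (hasDerivAt_const T s)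
          ((hasDerivAt_id T).const_sub s)).congr_deriv ?_
        rw [id, sineGordonEnergy_pdt hw hsg, hh]
        ring) 0 a T
    have h₂ : ∫ s in 0..a, -(pdx h s (s - T) + pdt h s (s - T)) = -h a (a - T) - -h 0 (0 - T) := by
      refine intervalIntegral.integral_eq_sub_of_hasDerivAt
        (f := fun s => -h s (s - T)) (fun s _ => ?_)
        ((hc₂.comp (continuous_const.prodMk continuous_id)).intervalIntegrable _ _)
      refine (hhs.hasDerivAt_comp (hasDerivAt_id s)
        ((hasDerivAt_id s).sub_const T)).neg.congr_deriv ?_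
      simp only [id]
      ring
    refine h₁.congr_deriv (h₂.trans ?_)
    have hwa : w a (a - T) = w 0 (0 - T) := by
      rw [← hper 0 (0 - T)]
      congr 1 <;> ring
    simp only [hh, hpt, hwa]
    ring
  have := is_const_of_deriv_eq_zero (fun T => (key T).differentiableAt) (fun T => (key T).deriv) T 0
  simpa using this

theorem cos_ge_of_sineGordonEnergy (ha : 0 < a) (hw : Smooth2 w)
    (hsg : ∀ y t, pdx (pdt w) y t = sin (w y t)) (hper : ∀ y t, w (y + a) (t + a) = w y t) (y t : ℝ) :
    1 - (∫ s in 0..a, sineGordonEnergy w s s) / (2 * a) - a - (∫ s in 0..a, sineGordonEnergy w s s)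
      ≤ cos (w y t) := by
  rw [← sineGordonEnergy_integral_eq hw hsg hper (y - t)]
  set T := y - t with hT
  obtain ⟨e, he⟩ : ∃ e : ℝ → ℝ, ∀ s, e s = sineGordonEnergy w s (s - T) := ⟨_, fun _ => rfl⟩
  obtain ⟨φ, hφ⟩ : ∃ φ : ℝ → ℝ, ∀ s, φ s = w s (s - T) := ⟨_, fun _ => rfl⟩
  simp only [← he]
  have hec : Continuous e := by
    simp only [funext he]
    exact continuous_uncurry_comp hw.sineGordonEnergy.continuous continuous_id
      (continuous_id.sub continuous_const)
  have hφper : Function.Periodic φ a := fun s => by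
    rw [hφ, hφ, ← hper s (s - T)]
    congr 1
    ring
  have hφy : φ y = w y t := by rw [hφ, hT]; congr 1; ring
  have hec_nonneg : ∀ s, 0 ≤ e s := fun s => by
    rw [he, sineGordonEnergy]
    nlinarith [cos_le_one (w s (s - T)), sq_nonneg (pdx w s (s - T)), sq_nonneg (pdt w s (s - T))]
  have hcos : ∀ s, 1 - cos (φ s) ≤ e s / 2 := fun s => by
    rw [he, hφ, sineGordonEnergy]
    nlinarith [sq_nonneg (pdx w s (s - T)), sq_nonneg (pdt w s (s - T))]
  have hφd : ∀ s, HasDerivAt φ (pdx w s (s - T) + pdt w s (s - T)) s := fun s => by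
    simp only [funext hφ]
    refine (hw.hasDerivAt_comp (hasDerivAt_id s) ((hasDerivAt_id s).sub_const T)).congr_deriv ?_
    simp only [id]
    ring
  have hφc : Continuous fun s => pdx w s (s - T) + pdt w s (s - T) :=
    (continuous_uncurry_comp hw.pdx.continuous continuous_id
      (continuous_id.sub continuous_const)).add (continuous_uncurry_comp hw.pdt.continuous
      continuous_id (continuous_id.sub continuous_const))
  have hφb : ∀ s, |pdx w s (s - T) + pdt w s (s - T)| ≤ 1 + e s := fun s => by
    rw [he, sineGordonEnergy, abs_le]
    constructor <;>
    nlinarith [cos_le_one (w s (s - T)), sq_nonneg (pdx w s (s - T) - 1),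
      sq_nonneg (pdt w s (s - T) - 1), sq_nonneg (pdx w s (s - T) + 1),
      sq_nonneg (pdt w s (s - T) + 1)]
  -- a point of the period where the potential does not exceed its mean
  obtain ⟨s₀, hs₀, hmin⟩ : ∃ s₀ ∈ Set.Icc 0 a, e s₀ * a ≤ ∫ s in 0..a, e s := by
    obtain ⟨s₀, hs₀, h⟩ := isCompact_Icc.exists_isMinOn (Set.nonempty_Icc.2 ha.le)
      (hec.continuousOn (s := Set.Icc 0 a))
    refine ⟨s₀, hs₀, ?_⟩
    have := intervalIntegral.integral_mono_on (μ := MeasureTheory.volume) ha.le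
      ((continuous_const (y := e s₀)).intervalIntegrable 0 a) (hec.intervalIntegrable 0 a)
      fun s hs => h hs
    rwa [intervalIntegral.integral_const, smul_eq_mul, sub_zero, mul_comm] at this
  obtain ⟨s, hs, hsy⟩ := hφper.exists_mem_Ico₀ ha y
  have hosc : |φ s - φ s₀| ≤ a + ∫ s in 0..a, e s := by
    have hmono : ∀ x ∈ Set.Icc 0 a, ∀ y ∈ Set.Icc 0 a, x ≤ y →
        |φ y - φ x| ≤ a + ∫ s in 0..a, e s := by
      intro x hx y hy hxy
      have hec1 : Continuous fun s => 1 + e s := continuous_const.add hec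
      rw [← intervalIntegral.integral_eq_sub_of_hasDerivAt (fun s _ => hφd s)
        (hφc.intervalIntegrable _ _), ← Real.norm_eq_abs]
      refine (intervalIntegral.norm_integral_le_of_norm_le hxy
        (.of_forall fun s _ => hφb s) (hec1.intervalIntegrable _ _)).trans ?_
      refine (intervalIntegral.integral_mono_interval hx.1 hxy hy.2
        (.of_forall fun s => add_nonneg zero_le_one (hec_nonneg s))
        (hec1.intervalIntegrable 0 a)).trans_eq ?_
      rw [intervalIntegral.integral_add (continuous_const.intervalIntegrable _ _)
        (hec.intervalIntegrable _ _)]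
      simp
    rcases le_total s s₀ with h | h
    · rw [abs_sub_comm]
      exact hmono s ⟨hs.1, hs.2.le⟩ s₀ hs₀ h
    · exact hmono s₀ hs₀ s ⟨hs.1, hs.2.le⟩ h
  have hlip : |cos (φ s) - cos (φ s₀)| ≤ |φ s - φ s₀| := abs_cos_sub_cos_le _ _
  rw [← hφy, hsy]
  have h₁ := hcos s₀
  have h₂ : e s₀ / 2 ≤ (∫ s in 0..a, e s) / (2 * a) := by
    rw [div_le_div_iff₀ two_pos (by positivity)]
    linarith
  linarith [(abs_le.1 (hlip.trans hosc)).1]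

end SineGordonEnergy

section PeriodicData

open Real Filter Topology

theorem exists_thin_periodic_cutoff {a η : ℝ} (ha : 0 < a) (hη : 0 < η) :
    ∃ G : ℝ → ℝ, ContDiff ℝ (⊤ : ℕ∞) G ∧ (∀ y, G (y + a) = G y) ∧ (∀ y, 0 ≤ G y) ∧
      (∀ y, G y ≤ 1) ∧ G =ᶠ[𝓝 0] 1 ∧ ∫ s in 0..a, G s ≤ η := by
  set G : ℕ → ℝ → ℝ := fun k y => smoothTransition (2 - k * sin (π * y / a) ^ 2) with hG
  have hGs : ∀ k, ContDiff ℝ (⊤ : ℕ∞) (G k) := fun k =>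
    smoothTransition.contDiff.comp (by fun_prop)
  have hlim : Tendsto (fun k => ∫ s in 0..a, G k s) atTop (𝓝 (∫ _ in 0..a, (0 : ℝ))) := by
    refine intervalIntegral.tendsto_integral_filter_of_dominated_convergence (fun _ => 1)
      (.of_forall fun k => (hGs k).continuous.aestronglyMeasurable)
      (.of_forall fun k => .of_forall fun s _ => ?_) (by simp) ?_
    · rw [Real.norm_eq_abs, abs_of_nonneg (smoothTransition.nonneg _)]
      exact smoothTransition.le_one _
    · have hae : ∀ᵐ s : ℝ, s ≠ a := MeasureTheory.Measure.ae_ne MeasureTheory.volume a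
      filter_upwards [hae] with s hsa hs
      rw [Set.uIoc_of_le ha.le] at hs
      have hlt : s < a := lt_of_le_of_ne hs.2 hsa
      have hsin : 0 < sin (π * s / a) := sin_pos_of_pos_of_lt_pi
        (div_pos (mul_pos pi_pos hs.1) ha) (by rw [div_lt_iff₀ ha]; nlinarith [pi_pos])
      refine tendsto_const_nhds.congr' ?_
      filter_upwards [(tendsto_natCast_atTop_atTop (R := ℝ)).eventually_ge_atTop
        (2 / sin (π * s / a) ^ 2)] with k hk
      rw [div_le_iff₀ (by positivity)] at hk
      exact (smoothTransition.zero_of_nonpos (by linarith)).symm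
  rw [intervalIntegral.integral_zero] at hlim
  obtain ⟨k, hk⟩ := (hlim.eventually_le_const hη).exists
  refine ⟨G k, hGs k, fun y => ?_, fun y => smoothTransition.nonneg _,
    fun y => smoothTransition.le_one _, ?_, hk⟩
  · simp only [hG]
    rw [show π * (y + a) / a = π * y / a + π by field_simp, sin_add_pi, neg_sq]
  · have hc : ContinuousAt (fun y : ℝ => 2 - k * sin (π * y / a) ^ 2) 0 := by fun_prop
    have h := hc.tendsto.eventually_const_le (u := 1) (by norm_num)
    filter_upwards [h] with y hy
    exact smoothTransition.one_of_one_le hy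

theorem exists_thin_periodic_data {a η : ℝ} (ha : 0 < a) (ha1 : a ≤ 1) (hη : 0 < η)
    (p v r₁ r₂ : ℝ) :
    ∃ P R : ℝ → ℝ, ContDiff ℝ (⊤ : ℕ∞) P ∧ ContDiff ℝ (⊤ : ℕ∞) R ∧ (∀ y, P (y + a) = P y) ∧
      (∀ y, R (y + a) = R y) ∧ P 0 = p ∧ R 0 = v ∧ deriv R 0 = r₁ ∧ deriv (deriv R) 0 = r₂ ∧
      (∫ s in 0..a, P s) + (∫ s in 0..a, R s) = 0 ∧
      ∫ s in 0..a, (|P s| + |R s| + P s ^ 2 + R s ^ 2) ≤ η := by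
  set K := |v| + |r₁| + |r₂| with hK
  set L := |p| + K with hL
  have hK0 : 0 ≤ K := by positivity
  have hL0 : 0 ≤ L := by positivity
  obtain ⟨G, hGs, hGper, hG0, hG1, hGev, hGint⟩ := exists_thin_periodic_cutoff ha
    (show 0 < min a (η / ((1 + 3 * L) * (4 * L) + 1)) by positivity)
  set I := ∫ s in 0..a, G s with hI
  obtain ⟨ψ, hψ⟩ : ∃ ψ : ℝ → ℝ, ∀ y, ψ y = sin (2 * π * y / a) * (a / (2 * π)) := ⟨_, fun _ => rfl⟩
  have hψs : ContDiff ℝ (⊤ : ℕ∞) ψ := by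
    rw [funext hψ]
    fun_prop
  have hψd : ∀ y, HasDerivAt ψ (cos (2 * π * y / a)) y := by
    intro y
    rw [funext hψ]
    have h : HasDerivAt (fun y => 2 * π * y / a) (2 * π / a) y := by
      simpa using ((hasDerivAt_id y).const_mul (2 * π)).div_const a
    refine (h.sin.mul_const (a / (2 * π))).congr_deriv ?_
    field_simp
  have hψ1 : ∀ y, |ψ y| ≤ 1 := by
    intro y
    rw [hψ, abs_mul, abs_of_pos (show 0 < a / (2 * π) by positivity)]
    refine mul_le_one₀ (abs_sin_le_one _) (by positivity) ?_
    rw [div_le_one (by positivity)]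
    linarith [pi_gt_three]
  obtain ⟨A, hA⟩ : ∃ A : ℝ → ℝ, ∀ y, A y = v + r₁ * ψ y + r₂ / 2 * ψ y ^ 2 := ⟨_, fun _ => rfl⟩
  have hAs : ContDiff ℝ (⊤ : ℕ∞) A := by
    rw [funext hA]
    fun_prop
  have hAb : ∀ y, |A y| ≤ K := by
    intro y
    rw [hA]
    refine (abs_add_three _ _ _).trans ?_
    rw [abs_mul, abs_mul, abs_pow, abs_div, abs_two, hK]
    have h := hψ1 y
    have h2 : |ψ y| ^ 2 ≤ 1 := pow_le_one₀ (abs_nonneg _) h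
    nlinarith [abs_nonneg r₁, abs_nonneg r₂, abs_nonneg v, sq_nonneg (|ψ y|)]
  obtain ⟨R, hR⟩ : ∃ R : ℝ → ℝ, ∀ y, R y = A y * G y := ⟨_, fun _ => rfl⟩
  have hRs : ContDiff ℝ (⊤ : ℕ∞) R := by
    rw [funext hR]
    exact hAs.mul hGs
  set m := (p * I + ∫ s in 0..a, R s) / a with hm
  obtain ⟨P, hP⟩ : ∃ P : ℝ → ℝ, ∀ y, P y = p * G y - m * (1 - cos (2 * π * y / a)) :=
    ⟨_, fun _ => rfl⟩
  have hPs : ContDiff ℝ (⊤ : ℕ∞) P := by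
    rw [funext hP]
    exact (contDiff_const.mul hGs).sub (by fun_prop)
  have hper : ∀ y, 2 * π * (y + a) / a = 2 * π * y / a + 2 * π := fun y => by field_simp
  have hG00 : G 0 = 1 := hGev.eq_of_nhds
  have hψ0 : ψ 0 = 0 := by simp [hψ]
  have hRb : ∀ y, |R y| ≤ K * G y := fun y => by
    rw [hR, abs_mul, abs_of_nonneg (hG0 y)]
    exact mul_le_mul_of_nonneg_right (hAb y) (hG0 y)
  have hGi : ∀ x y, IntervalIntegrable G MeasureTheory.volume x y := fun x y =>
    hGs.continuous.intervalIntegrable x y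
  have hIa : I ≤ a := hGint.trans (min_le_left _ _)
  have hI0 : 0 ≤ I := intervalIntegral.integral_nonneg ha.le fun s _ => hG0 s
  have hRI : |∫ s in 0..a, R s| ≤ K * I := by
    rw [hI, ← intervalIntegral.integral_const_mul, ← Real.norm_eq_abs]
    exact intervalIntegral.norm_integral_le_of_norm_le ha.le (.of_forall fun s _ => hRb s)
      ((hGi _ _).const_mul K)
  have hma : |m| * a ≤ L * I := by
    rw [hm, abs_div, abs_of_pos ha, div_mul_cancel₀ _ ha.ne']
    refine (abs_add_le _ _).trans ?_
    rw [abs_mul, abs_of_nonneg hI0, hL]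
    linarith
  have hmL : |m| ≤ L := by
    by_contra! h
    nlinarith
  have hPb : ∀ y, |P y| ≤ |p| * G y + 2 * |m| := by
    intro y
    rw [hP]
    refine (abs_sub _ _).trans ?_
    rw [abs_mul, abs_mul, abs_of_nonneg (hG0 y),
      abs_of_nonneg (show 0 ≤ 1 - cos (2 * π * y / a) by linarith [cos_le_one (2 * π * y / a)])]
    nlinarith [neg_one_le_cos (2 * π * y / a), abs_nonneg m]
  have hRA : R =ᶠ[𝓝 0] A := by
    filter_upwards [hGev] with y hy
    rw [hR, hy, Pi.one_apply, mul_one]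
  have hAd : ∀ y, deriv A y = (r₁ + r₂ * ψ y) * cos (2 * π * y / a) := by
    intro y
    rw [funext hA]
    refine ((((hψd y).const_mul r₁).const_add v).add
      (((hψd y).pow 2).const_mul (r₂ / 2))).deriv.trans ?_
    ring
  refine ⟨P, R, hPs, hRs, fun y => ?_, fun y => ?_, ?_, ?_, ?_, ?_, ?_, ?_⟩
  · rw [hP, hP, hGper, hper, cos_add_two_pi]
  · rw [hR, hR, hA, hA, hψ, hψ, hGper, hper, sin_add_two_pi]
  · simp [hP, hG00]
  · simp [hR, hA, hψ0, hG00]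
  · rw [hRA.deriv_eq, hAd]
    simp [hψ0]
  · rw [hRA.deriv.deriv_eq, funext hAd]
    have h : HasDerivAt (fun y => 2 * π * y / a) (2 * π / a) 0 := by
      simpa using ((hasDerivAt_id (0 : ℝ)).const_mul (2 * π)).div_const a
    refine (((hψd 0).const_mul r₂).const_add r₁ |>.mul h.cos).deriv.trans ?_
    simp
  · have h : ∫ s in 0..a, (1 - cos (2 * π * s / a)) = (a - ψ a) - (0 - ψ 0) :=
      intervalIntegral.integral_eq_sub_of_hasDerivAt (f := fun s => s - ψ s)
        (fun s _ => (hasDerivAt_id s).sub (hψd s)) (Continuous.intervalIntegrable (by fun_prop) _ _)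
    have hψa : ψ a = 0 := by
      rw [hψ, mul_div_assoc, div_self ha.ne', mul_one, sin_two_pi, zero_mul]
    rw [hψ0, hψa] at h
    simp only [hP]
    rw [intervalIntegral.integral_sub ((hGi _ _).const_mul _)
      (Continuous.intervalIntegrable (by fun_prop) _ _), intervalIntegral.integral_const_mul,
      intervalIntegral.integral_const_mul, h, hm]
    field_simp
    ring
  · have hpt : ∀ s, |P s| + |R s| + P s ^ 2 + R s ^ 2 ≤ (1 + 3 * L) * (2 * L * G s + 2 * |m|) := by
      intro s
      have h1 := hPb s
      have h2 := hRb s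
      have h3 : |P s| ≤ 3 * L := by nlinarith [hG1 s, hG0 s, abs_nonneg p]
      have h4 : |R s| ≤ 3 * L := by nlinarith [hG1 s, hG0 s, abs_nonneg p]
      have h5 : |P s| + |R s| ≤ 2 * L * G s + 2 * |m| := by
        nlinarith [mul_nonneg hL0 (hG0 s)]
      rw [← sq_abs (P s), ← sq_abs (R s)]
      nlinarith [abs_nonneg (P s), abs_nonneg (R s)]
    have hc1 : Continuous fun s => |P s| + |R s| + P s ^ 2 + R s ^ 2 :=
      ((hPs.continuous.abs.add hRs.continuous.abs).add (hPs.continuous.pow 2)).add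
        (hRs.continuous.pow 2)
    have hc2 : Continuous fun s => (1 + 3 * L) * (2 * L * G s + 2 * |m|) :=
      continuous_const.mul ((continuous_const.mul hGs.continuous).add continuous_const)
    refine (intervalIntegral.integral_mono_on ha.le (hc1.intervalIntegrable 0 a)
      (hc2.intervalIntegrable 0 a) fun s _ => hpt s).trans ?_
    rw [intervalIntegral.integral_const_mul, intervalIntegral.integral_add
      ((hGi _ _).const_mul _) (continuous_const.intervalIntegrable _ _),
      intervalIntegral.integral_const_mul, intervalIntegral.integral_const, smul_eq_mul, sub_zero]
    have h := hGint.trans (min_le_right _ _)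
    rw [le_div_iff₀ (by positivity)] at h
    nlinarith

end PeriodicData

section PositiveCase

open Real

theorem exists_isSPESol_one (v p q r τ : ℝ) :
    ∃ u, IsSPESol 1 (1 / 2) u ∧ u 0 0 = v ∧ pdx u 0 0 = p ∧ pdt u 0 0 = q ∧
      pdx (pdx u) 0 0 = r ∧ pdt (pdt u) 0 0 = τ := by
  set w₀ := arctan p with hw₀
  have hc0 : 0 < cos w₀ := cos_arctan_pos p
  have hc1 : cos w₀ ≤ 1 := cos_le_one _
  set a := cos w₀ / 16 with ha'
  have ha : 0 < a := by positivity
  set P₀ := r * cos w₀ ^ 3 with hP₀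
  set W₂ := q - 1 / 2 * v ^ 2 * p with hW₂
  set W₃ := τ - (v * q * p + 1 / 2 * v ^ 2 * (1 * v + v * p ^ 2 + 1 / 2 * v ^ 2 * r)
    + 1 / 2 * 1 * v ^ 3) with hW₃
  obtain ⟨P, R, hPs, hRs, hPper, hRper, hP0, hR0, hR1, hR2, hPR, hint⟩ :=
    exists_thin_periodic_data ha (by linarith) (show 0 < a ^ 2 by positivity) P₀ v
      (W₂ + sin w₀) (W₃ + cos w₀ * (P₀ + 2 * v))
  obtain ⟨w, hw, hw0, hwy, hwt, hper⟩ := exists_sineGordon w₀ hPs hRs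
  have hpx : ∀ y t, pdx w y t = P y + ∫ τ in y..t, sin (w y τ) := fun y t => (hwy y t).deriv
  have hpt : ∀ y t, pdt w y t = R t + ∫ η in t..y, sin (w η t) := fun y t => (hwt y t).deriv
  have hsc : Continuous fun z : ℝ × ℝ => sin (w z.1 z.2) := continuous_sin.comp hw.continuous
  have hsg : ∀ y t, pdx (pdt w) y t = sin (w y t) := by
    intro y t
    have h : HasDerivAt (fun y => ∫ η in t..y, sin (w η t)) (sin (w y t)) y :=
      ((continuous_uncurry_comp (f := fun y t => sin (w y t)) hsc continuous_id
        continuous_const).integral_hasStrictDerivAt t y).hasDerivAt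
    rw [pdx]
    simp only [hpt]
    exact (h.const_add (R t)).deriv
  have hxd : ∀ s, pdx w s s = P s := fun s => by rw [hpx, intervalIntegral.integral_same, add_zero]
  have htd : ∀ s, pdt w s s = R s := fun s => by rw [hpt, intervalIntegral.integral_same, add_zero]
  have hdiag : ∀ s, HasDerivAt (fun s => w s s) (P s + R s) s := fun s => by
    refine (hw.hasDerivAt_comp (hasDerivAt_id s) (hasDerivAt_id s)).congr_deriv ?_
    simp only [id, hxd, htd, mul_one]
  have htt : ∀ s, pdt (pdt w) s s = deriv R s - sin (w s s) := by
    intro s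
    have h := hw.pdt.hasDerivAt_comp (hasDerivAt_id s) (hasDerivAt_id s)
    simp only [id, htd, hsg] at h
    linarith [h.deriv]
  have httt : pdt (pdt (pdt w)) 0 0 = deriv (deriv R) 0 - cos w₀ * (P₀ + 2 * v) := by
    have h := hw.pdt.pdt.hasDerivAt_comp (hasDerivAt_id (0 : ℝ)) (hasDerivAt_id (0 : ℝ))
    have h₁ : pdx (pdt (pdt w)) 0 0 = cos (w 0 0) * pdt w 0 0 := by
      rw [← hw.pdt.pdt_pdx, funext fun y => funext fun t => hsg y t]
      exact (hw.hasDerivAt_snd 0 0).sin.deriv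
    simp only [id, htt, h₁, htd, hw0, hR0] at h
    have hR' : DifferentiableAt ℝ (deriv R) 0 :=
      ((contDiff_infty_iff_deriv.1 hRs).2.differentiable (by simp)) 0
    have h₂ := hR'.hasDerivAt.sub (hdiag 0).sin
    have := h.unique h₂
    rw [hw0, hP0, hR0] at this
    linarith
  have hcP : Continuous P := hPs.continuous
  have hcR : Continuous R := hRs.continuous
  have hdat : Continuous fun s => |P s| + |R s| + P s ^ 2 + R s ^ 2 := by fun_prop
  have hosc : ∀ s ∈ Set.Icc 0 a, |w s s - w₀| ≤ a ^ 2 := by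
    intro s hs
    rw [← hw0, ← intervalIntegral.integral_eq_sub_of_hasDerivAt (fun s _ => hdiag s)
      ((hcP.add hcR).intervalIntegrable _ _), ← Real.norm_eq_abs]
    refine (intervalIntegral.norm_integral_le_of_norm_le hs.1
      (g := fun s => |P s| + |R s| + P s ^ 2 + R s ^ 2) (.of_forall fun s _ => ?_)
      (hdat.intervalIntegrable _ _)).trans
      ((intervalIntegral.integral_mono_interval le_rfl hs.1 hs.2 (.of_forall fun s => ?_)
        (hdat.intervalIntegrable _ _)).trans hint)
    · rw [Real.norm_eq_abs]
      linarith [abs_add_le (P s) (R s), sq_nonneg (P s), sq_nonneg (R s)]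
    · simp only [Pi.zero_apply]
      positivity
  have hE : ∫ s in 0..a, sineGordonEnergy w s s ≤ a ^ 2 + 2 * (1 - cos w₀ + a ^ 2) * a := by
    have hb : ∀ s ∈ Set.Icc 0 a, sineGordonEnergy w s s
        ≤ (|P s| + |R s| + P s ^ 2 + R s ^ 2) + 2 * (1 - cos w₀ + a ^ 2) := by
      intro s hs
      rw [sineGordonEnergy, hxd, htd]
      have h := (abs_le.1 ((abs_cos_sub_cos_le (w s s) w₀).trans (hosc s hs))).1
      nlinarith [abs_nonneg (P s), abs_nonneg (R s), sq_nonneg (P s), sq_nonneg (R s)]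
    refine (intervalIntegral.integral_mono_on ha.le
      ((continuous_uncurry_comp hw.sineGordonEnergy.continuous continuous_id
        continuous_id).intervalIntegrable 0 a)
      ((hdat.add continuous_const).intervalIntegrable 0 a) hb).trans ?_
    refine (intervalIntegral.integral_add (hdat.intervalIntegrable _ _)
      (continuous_const.intervalIntegrable _ _)).trans_le ?_
    rw [intervalIntegral.integral_const, smul_eq_mul]
    linarith
  have hcos : ∀ y t, cos w₀ / 2 ≤ cos (w y t) := by
    intro y t
    refine le_trans ?_ (cos_ge_of_sineGordonEnergy ha hw hsg
      (hper a hPper hRper hPR) y t)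
    have h : (∫ s in 0..a, sineGordonEnergy w s s) / (2 * a) ≤ a / 2 + (1 - cos w₀ + a ^ 2) := by
      rw [div_le_iff₀ (by positivity)]
      linarith
    nlinarith
  obtain ⟨u, hu, hu0, hux, huxx, hut, hutt⟩ :=
    exists_isSPESol_of_sineGordon hw hsg (half_pos hc0) hcos
  rw [htd, hR0] at hu0
  rw [hw0, hw₀, tan_arctan] at hux
  rw [hw0, hxd, hP0, hP₀, mul_div_cancel_right₀ _ (by positivity)] at huxx
  rw [hu0, hux, htt, hR1, hw0] at hut
  have hq : pdt u 0 0 = q := by rw [hut, hW₂]; ring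
  refine ⟨u, hu, hu0, hux, hq, huxx, ?_⟩
  rw [hutt, httt, hR2, hq, hux, huxx, hu0, hW₃]
  ring

end PositiveCase

section LabelSystem

open Real

theorem abs_integral_mul_le {κ g : ℝ → ℝ} (hκ : Continuous κ) {m a b : ℝ}
    (hg : ∀ s, |g s| ≤ m) : |∫ s in a..b, κ s * g s| ≤ m * |∫ s in a..b, (|κ s|)| := by
  have hm : 0 ≤ m := (abs_nonneg _).trans (hg 0)
  have h := intervalIntegral.norm_integral_le_abs_of_norm_le (μ := MeasureTheory.volume)
    (f := fun s => κ s * g s) (g := fun s => m * |κ s|) (a := a) (b := b)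
    (.of_forall fun s => by
      rw [Real.norm_eq_abs, abs_mul, mul_comm]
      exact mul_le_mul_of_nonneg_right (hg s) (abs_nonneg _))
    ((by fun_prop : Continuous fun s => m * |κ s|).intervalIntegrable _ _)
  rwa [intervalIntegral.integral_const_mul, abs_mul, abs_of_nonneg hm, Real.norm_eq_abs] at h

theorem abs_sin_add_mul_cos_le (x F : ℝ) : |sin x + F * cos x| ≤ 1 + |F| := by
  refine (abs_add_le _ _).trans (add_le_add (abs_sin_le_one _) ?_)
  rw [abs_mul]
  exact mul_le_of_le_one_right (abs_nonneg _) (abs_cos_le_one _)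

theorem abs_cos_sub_mul_sin_le (x F : ℝ) : |cos x - F * sin x| ≤ 1 + |F| := by
  refine (abs_sub _ _).trans (add_le_add (abs_cos_le_one _) ?_)
  rw [abs_mul]
  exact mul_le_of_le_one_right (abs_nonneg _) (abs_sin_le_one _)

theorem abs_mul_sub_mul_le {a a' b b' m d : ℝ} (ha : |a| ≤ m) (hb' : |b'| ≤ m) (h : |a - a'| ≤ d)
    (h' : |b - b'| ≤ d) : |a * b - a' * b'| ≤ 2 * m * d := by
  have hm : 0 ≤ m := (abs_nonneg _).trans ha
  have hd : 0 ≤ d := (abs_nonneg _).trans h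
  rw [show a * b - a' * b' = a * (b - b') + (a - a') * b' by ring]
  refine (abs_add_le _ _).trans ?_
  rw [abs_mul, abs_mul]
  have h₁ := mul_le_mul ha h' (abs_nonneg _) hm
  have h₂ := mul_le_mul h hb' (abs_nonneg _) hd
  linarith

theorem abs_sin_add_mul_cos_sub_le {x x' F F' b d e : ℝ} (hF' : |F'| ≤ b) (h : |x - x'| ≤ d)
    (hF : |F - F'| ≤ e) : |(sin x + F * cos x) - (sin x' + F' * cos x')| ≤ (1 + b) * d + e := by
  have h₁ := (abs_sin_sub_sin_le x x').trans h
  have h₂ := (abs_cos_sub_cos_le x x').trans h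
  have hb : 0 ≤ b := (abs_nonneg _).trans hF'
  have h₃ : |(F - F') * cos x| ≤ e := by
    rw [abs_mul]
    exact (mul_le_of_le_one_right (abs_nonneg _) (abs_cos_le_one _)).trans hF
  have h₄ : |F' * (cos x - cos x')| ≤ b * d := by
    rw [abs_mul]
    exact mul_le_mul hF' h₂ (abs_nonneg _) hb
  rw [show (sin x + F * cos x) - (sin x' + F' * cos x')
    = (sin x - sin x') + (F - F') * cos x + F' * (cos x - cos x') by ring]
  refine (abs_add_three _ _ _).trans ?_
  linarith

theorem abs_cos_sub_mul_sin_sub_le {x x' F F' b d e : ℝ} (hF' : |F'| ≤ b) (h : |x - x'| ≤ d)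
    (hF : |F - F'| ≤ e) : |(cos x - F * sin x) - (cos x' - F' * sin x')| ≤ (1 + b) * d + e := by
  have := abs_sin_add_mul_cos_sub_le (x := x + π / 2) (x' := x' + π / 2) (d := d) hF'
    (by rwa [add_sub_add_right_eq_sub]) hF
  simp only [sin_add_pi_div_two, cos_add_pi_div_two, mul_neg] at this
  exact this

theorem exists_label_system_continuous {κ f l₀ E : ℝ → ℝ} (hκ : Continuous κ) (hf : Continuous f)
    (hl₀ : Continuous l₀) (hE : Continuous E) {B k M L : ℝ} (hB : ∀ t, |f t| ≤ B)
    (hk : ∀ σ, |∫ s in 0..σ, (|κ s|)| ≤ k) (hM : ∀ x, |E x| ≤ M)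
    (hL : ∀ x y, |E x - E y| ≤ L * |x - y|) :
    ∃ Θ l F : ℝ → ℝ → ℝ, (Continuous fun z : ℝ × ℝ => Θ z.1 z.2) ∧
      (Continuous fun z : ℝ × ℝ => l z.1 z.2) ∧ (Continuous fun z : ℝ × ℝ => F z.1 z.2) ∧
      (∀ σ t, F σ t = f t + ∫ s in 0..σ, κ s * (E (l s t) * cos (Θ s t) ^ 2)) ∧
      (∀ σ t, Θ σ t = σ + ∫ τ in 0..t, -(1 / 2) * (sin (Θ σ τ) + F σ τ * cos (Θ σ τ)) ^ 2) ∧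
      (∀ σ t, l σ t = l₀ σ + ∫ τ in 0..t, 1 / 2 * ((sin (Θ σ τ) + F σ τ * cos (Θ σ τ)) *
        (cos (Θ σ τ) - F σ τ * sin (Θ σ τ)))) ∧
      ∀ σ t, |F σ t - f t| ≤ k * M := by
  obtain ⟨Fw, hFw⟩ : ∃ Fw : (ℝ × ℝ → ℝ × ℝ) → ℝ → ℝ → ℝ, ∀ w σ t, Fw w σ t = f t + ∫ s in 0..σ,
      κ s * (E (l₀ s + (w (s, t)).2) * cos (s + (w (s, t)).1) ^ 2) := ⟨_, fun _ _ _ => rfl⟩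
  obtain ⟨Sw, hSw⟩ : ∃ Sw : (ℝ × ℝ → ℝ × ℝ) → ℝ → ℝ → ℝ, ∀ w σ t, Sw w σ t =
      sin (σ + (w (σ, t)).1) + Fw w σ t * cos (σ + (w (σ, t)).1) := ⟨_, fun _ _ _ => rfl⟩
  obtain ⟨Cw, hCw⟩ : ∃ Cw : (ℝ × ℝ → ℝ × ℝ) → ℝ → ℝ → ℝ, ∀ w σ t, Cw w σ t =
      cos (σ + (w (σ, t)).1) - Fw w σ t * sin (σ + (w (σ, t)).1) := ⟨_, fun _ _ _ => rfl⟩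
  obtain ⟨Φ, hΦ⟩ : ∃ Φ : (ℝ × ℝ → ℝ × ℝ) → ℝ × ℝ → ℝ × ℝ, ∀ w z, Φ w z =
      (∫ τ in 0..z.2, -(1 / 2) * Sw w z.1 τ ^ 2, ∫ τ in 0..z.2, 1 / 2 * (Sw w z.1 τ * Cw w z.1 τ)) :=
    ⟨_, fun _ _ => rfl⟩
  have hM0 : 0 ≤ M := (abs_nonneg _).trans (hM 0)
  have hB0 : 0 ≤ B := (abs_nonneg _).trans (hB 0)
  have hk0 : 0 ≤ k := (abs_nonneg _).trans (hk 0)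
  have hL0 : 0 ≤ L := by simpa using (abs_nonneg _).trans (hL 1 0)
  set b := B + k * M with hb
  have hb0 : 0 ≤ b := by positivity
  have hcos2 : ∀ x, |cos x ^ 2| ≤ 1 := fun x => by
    rw [abs_of_nonneg (sq_nonneg _)]; exact cos_sq_le_one x
  have hgM : ∀ x y, |E x * cos y ^ 2| ≤ M := fun x y => by
    rw [abs_mul]
    exact (mul_le_of_le_one_right (abs_nonneg _) (hcos2 y)).trans (hM x)
  have hFf : ∀ w σ t, |Fw w σ t - f t| ≤ k * M := by
    intro w σ t
    rw [hFw, add_sub_cancel_left, mul_comm]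
    exact (abs_integral_mul_le hκ fun s => hgM _ _).trans (mul_le_mul_of_nonneg_left (hk σ) hM0)
  have hFb : ∀ w σ t, |Fw w σ t| ≤ b := by
    intro w σ t
    have := abs_add_le (f t) (Fw w σ t - f t)
    rw [add_sub_cancel] at this
    linarith [hB t, hFf w σ t]
  have hSb : ∀ w σ t, |Sw w σ t| ≤ 1 + b := fun w σ t => by
    rw [hSw]; exact (abs_sin_add_mul_cos_le _ _).trans (by linarith [hFb w σ t])
  have hCb : ∀ w σ t, |Cw w σ t| ≤ 1 + b := fun w σ t => by
    rw [hCw]; exact (abs_cos_sub_mul_sin_le _ _).trans (by linarith [hFb w σ t])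
  have hFc : ∀ w, Continuous w → Continuous fun z : ℝ × ℝ => Fw w z.1 z.2 := by
    intro w hw
    simp only [hFw]
    exact (hf.comp continuous_snd).add (continuous_integral_of_continuous
      (f := fun (z : ℝ × ℝ) s => κ s * (E (l₀ s + (w (s, z.2)).2) * cos (s + (w (s, z.2)).1) ^ 2))
      (by fun_prop) continuous_const continuous_fst)
  have hSc : ∀ w, Continuous w → Continuous fun z : ℝ × ℝ => Sw w z.1 z.2 := by
    intro w hw
    have := hFc w hw
    simp only [hSw]
    fun_prop
  have hCc : ∀ w, Continuous w → Continuous fun z : ℝ × ℝ => Cw w z.1 z.2 := by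
    intro w hw
    have := hFc w hw
    simp only [hCw]
    fun_prop
  have hh₁ : ∀ w, Continuous w → Continuous fun z : ℝ × ℝ => -(1 / 2) * Sw w z.1 z.2 ^ 2 :=
    fun w hw => continuous_const.mul ((hSc w hw).pow 2)
  have hh₂ : ∀ w, Continuous w → Continuous fun z : ℝ × ℝ => 1 / 2 * (Sw w z.1 z.2 * Cw w z.1 z.2) :=
    fun w hw => continuous_const.mul ((hSc w hw).mul (hCc w hw))
  set D := 1 + b + k * (L + 2 * M) with hD
  have hD0 : 1 ≤ D := by have : 0 ≤ k * (L + 2 * M) := by positivity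
                         linarith
  set K := 2 * ((1 + b) * D) with hK
  have hK0 : 0 < K := by positivity
  set W : ℝ × ℝ → ℝ := fun z => exp (K * |z.2 - 0|) with hW
  have hlip : ∀ w w' : ℝ × ℝ → ℝ × ℝ, Continuous w → Continuous w' → ∀ c, 0 ≤ c →
      (∀ z, ‖w z - w' z‖ ≤ c * W z) → ∀ z, ‖Φ w z - Φ w' z‖ ≤ c / 2 * W z := by
    intro w w' hw hw' c hc h z
    have h1 : ∀ σ t, |(σ + (w (σ, t)).1) - (σ + (w' (σ, t)).1)| ≤ c * W (σ, t) := fun σ t => by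
      rw [add_sub_add_left_eq_sub]; exact (norm_fst_le (w (σ, t) - w' (σ, t))).trans (h (σ, t))
    have h2 : ∀ σ t, |(l₀ σ + (w (σ, t)).2) - (l₀ σ + (w' (σ, t)).2)| ≤ c * W (σ, t) := fun σ t => by
      rw [add_sub_add_left_eq_sub]; exact (norm_snd_le (w (σ, t) - w' (σ, t))).trans (h (σ, t))
    have hWt : ∀ σ σ' t, W (σ, t) = W (σ', t) := fun _ _ _ => rfl
    have h3 : ∀ σ t, |Fw w σ t - Fw w' σ t| ≤ k * (L + 2 * M) * (c * W (σ, t)) := by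
      intro σ t
      rw [hFw, hFw, add_sub_add_left_eq_sub, ← intervalIntegral.integral_sub
        (Continuous.intervalIntegrable (by fun_prop) _ _)
        (Continuous.intervalIntegrable (by fun_prop) _ _)]
      simp only [← mul_sub]
      have hWp : 0 ≤ c * W (σ, t) := mul_nonneg hc (exp_pos _).le
      have hm : 0 ≤ (L + 2 * M) * (c * W (σ, t)) := by positivity
      refine (abs_integral_mul_le hκ (m := (L + 2 * M) * (c * W (σ, t))) fun s => ?_).trans
        ((mul_le_mul_of_nonneg_left (hk σ) hm).trans_eq (by ring))
      have e1 := h1 s t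
      have e2 := h2 s t
      rw [hWt s σ t] at e1 e2
      set x := s + (w (s, t)).1
      set x' := s + (w' (s, t)).1
      set y := l₀ s + (w (s, t)).2
      set y' := l₀ s + (w' (s, t)).2
      rw [show E y * cos x ^ 2 - E y' * cos x' ^ 2
        = (E y - E y') * cos x ^ 2 + E y' * (cos x * cos x - cos x' * cos x') by ring]
      refine (abs_add_le _ _).trans ?_
      rw [abs_mul, abs_mul]
      have e3 := abs_mul_sub_mul_le (abs_cos_le_one x) (abs_cos_le_one x')
        ((abs_cos_sub_cos_le x x').trans e1) ((abs_cos_sub_cos_le x x').trans e1)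
      have e4 := mul_le_mul (hM y') e3 (abs_nonneg _) hM0
      have e5 := (mul_le_of_le_one_right (abs_nonneg _) (hcos2 x)).trans
        ((hL y y').trans (mul_le_mul_of_nonneg_left e2 hL0))
      linarith
    have h4 : ∀ σ t, |Sw w σ t - Sw w' σ t| ≤ D * (c * W (σ, t)) := fun σ t => by
      rw [hSw, hSw]
      exact (abs_sin_add_mul_cos_sub_le (hFb w' σ t) (h1 σ t) (h3 σ t)).trans_eq (by ring)
    have h5 : ∀ σ t, |Cw w σ t - Cw w' σ t| ≤ D * (c * W (σ, t)) := fun σ t => by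
      rw [hCw, hCw]
      exact (abs_cos_sub_mul_sin_sub_le (hFb w' σ t) (h1 σ t) (h3 σ t)).trans_eq (by ring)
    have hint : ∀ {g g' : ℝ → ℝ → ℝ}, (Continuous fun z : ℝ × ℝ => g z.1 z.2) →
        (Continuous fun z : ℝ × ℝ => g' z.1 z.2) →
        (∀ σ t, |g σ t - g' σ t| ≤ (1 + b) * D * c * W (σ, t)) →
        |(∫ τ in 0..z.2, g z.1 τ) - ∫ τ in 0..z.2, g' z.1 τ| ≤ c / 2 * W z := by
      intro g g' hg hg' hgg
      have e₁ : Continuous (g z.1) := continuous_uncurry_comp hg continuous_const continuous_id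
      have e₂ : Continuous (g' z.1) := continuous_uncurry_comp hg' continuous_const continuous_id
      rw [← intervalIntegral.integral_sub (e₁.intervalIntegrable _ _) (e₂.intervalIntegrable _ _)]
      refine (abs_integral_le_exp hK0 (c := (1 + b) * D * c) (by positivity)
        fun τ _ => hgg z.1 τ).trans_eq ?_
      simp only [hW, hK]
      field_simp
    rw [hΦ, hΦ, Prod.norm_def]
    refine max_le (hint (g := fun σ t => -(1 / 2) * Sw w σ t ^ 2)
      (g' := fun σ t => -(1 / 2) * Sw w' σ t ^ 2) (hh₁ w hw) (hh₁ w' hw') fun σ t => ?_)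
      (hint (g := fun σ t => 1 / 2 * (Sw w σ t * Cw w σ t))
      (g' := fun σ t => 1 / 2 * (Sw w' σ t * Cw w' σ t)) (hh₂ w hw) (hh₂ w' hw') fun σ t => ?_)
    · have e := abs_mul_sub_mul_le (hSb w σ t) (hSb w' σ t) (h4 σ t) (h4 σ t)
      rw [← mul_sub, abs_mul, pow_two, pow_two, show |(-(1 / 2) : ℝ)| = 1 / 2 by norm_num]
      linarith
    · have e := abs_mul_sub_mul_le (hSb w σ t) (hCb w' σ t) (h4 σ t) (h5 σ t)
      rw [← mul_sub, abs_mul, show |(1 / 2 : ℝ)| = 1 / 2 by norm_num]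
      linarith
  have hcont : ∀ w, Continuous w → Continuous (Φ w) := by
    intro w hw
    have i₁ := continuous_integral_of_continuous
      (f := fun (z : ℝ × ℝ) τ => -(1 / 2) * Sw w z.1 τ ^ 2) (a := fun _ => 0)
      (continuous_uncurry_comp (f := fun σ t => -(1 / 2) * Sw w σ t ^ 2) (hh₁ w hw)
        (by fun_prop : Continuous fun z : (ℝ × ℝ) × ℝ => z.1.1) continuous_snd)
      continuous_const continuous_snd
    have i₂ := continuous_integral_of_continuous
      (f := fun (z : ℝ × ℝ) τ => 1 / 2 * (Sw w z.1 τ * Cw w z.1 τ)) (a := fun _ => 0)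
      (continuous_uncurry_comp (f := fun σ t => 1 / 2 * (Sw w σ t * Cw w σ t)) (hh₂ w hw)
        (by fun_prop : Continuous fun z : (ℝ × ℝ) × ℝ => z.1.1) continuous_snd)
      continuous_const continuous_snd
    exact (i₁.prodMk i₂).congr fun z => (hΦ w z).symm
  have h0 : ∀ z, ‖Φ 0 z‖ ≤ (1 + b) ^ 2 * W z := by
    intro z
    have hS2 : ∀ {x y : ℝ}, |x| ≤ 1 + b → |y| ≤ 1 + b → |x * y| ≤ (1 + b) ^ 2 := fun hx hy => by
      rw [abs_mul, pow_two]; exact mul_le_mul hx hy (abs_nonneg _) (by positivity)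
    have hint : ∀ {g : ℝ → ℝ}, (∀ τ, |g τ| ≤ (1 + b) ^ 2) →
        |∫ τ in 0..z.2, g τ| ≤ (1 + b) ^ 2 * W z := by
      intro g hg
      refine (abs_integral_le_exp hK0 (c := (1 + b) ^ 2) (by positivity) fun τ _ =>
        (hg τ).trans (le_mul_of_one_le_right (by positivity) (one_le_exp (by positivity)))).trans ?_
      refine mul_le_mul_of_nonneg_right (div_le_self (by positivity) ?_) (exp_pos _).le
      nlinarith [mul_le_mul (by linarith : 1 ≤ 1 + b) hD0 zero_le_one (by positivity)]
    rw [hΦ, Prod.norm_def]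
    refine max_le (hint fun τ => ?_) (hint fun τ => ?_)
    · have e := hS2 (hSb 0 z.1 τ) (hSb 0 z.1 τ)
      rw [abs_mul, pow_two, show |(-(1 / 2) : ℝ)| = 1 / 2 by norm_num]
      linarith [abs_nonneg (Sw 0 z.1 τ * Sw 0 z.1 τ)]
    · have e := hS2 (hSb 0 z.1 τ) (hCb 0 z.1 τ)
      rw [abs_mul, show |(1 / 2 : ℝ)| = 1 / 2 by norm_num]
      linarith [abs_nonneg (Sw 0 z.1 τ * Cw 0 z.1 τ)]
  obtain ⟨w, hw, hfix, -⟩ := exists_weighted_fixedPoint (W := W) (by fun_prop)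
    (fun z => exp_pos _) hcont hlip h0
  refine ⟨fun σ t => σ + (w (σ, t)).1, fun σ t => l₀ σ + (w (σ, t)).2, Fw w, by fun_prop,
    by fun_prop, hFc w hw, hFw w, fun σ t => ?_, fun σ t => ?_, hFf w⟩
  · have := congrArg Prod.fst (congrFun hfix (σ, t))
    rw [hΦ] at this
    simp only [hSw] at this
    exact congrArg _ this.symm
  · have := congrArg Prod.snd (congrFun hfix (σ, t))
    rw [hΦ] at this
    simp only [hSw, hCw] at this
    exact congrArg _ this.symm

end LabelSystem

section LabelDerivative

open Real

theorem eq_zero_of_abs_deriv_le {δ h : ℝ → ℝ → ℝ} (hδ : Continuous fun z : ℝ × ℝ => δ z.1 z.2)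
    (hh : Continuous fun z : ℝ × ℝ => h z.1 z.2) (h0 : ∀ σ, δ σ 0 = 0)
    (hd : ∀ σ t, HasDerivAt (fun t => δ σ t) (h σ t) t)
    (hK : ∀ R, 0 ≤ R → ∃ K, 0 < K ∧ ∀ σ t, |σ| ≤ R → |t| ≤ R → ∀ c, 0 ≤ c →
      (∀ s, |s| ≤ R → |δ s t| ≤ c) → |h σ t| ≤ K * c) (σ t : ℝ) : δ σ t = 0 := by
  obtain ⟨R, hσ, ht⟩ : ∃ R, |σ| ≤ R ∧ |t| ≤ R := ⟨max |σ| |t|, le_max_left _ _, le_max_right _ _⟩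
  have hR : 0 ≤ R := (abs_nonneg _).trans hσ
  obtain ⟨K, hK0, hK⟩ := hK R hR
  have hbox : ∀ x : ℝ, |x| ≤ R ↔ x ∈ Set.Icc (-R) R := fun x => abs_le
  obtain ⟨z, hz, hmax⟩ := (isCompact_Icc (a := -R) (b := R)).prod (isCompact_Icc (a := -R) (b := R))
    |>.exists_isMaxOn ⟨(σ, t), (hbox σ).1 hσ, (hbox t).1 ht⟩
    (f := fun z : ℝ × ℝ => |δ z.1 z.2| * exp (-(2 * K * |z.2 - 0|))) (by fun_prop)
  obtain ⟨σ₁, t₁⟩ := z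
  obtain ⟨hσ₁, ht₁⟩ := hz
  simp only at hσ₁ ht₁
  set M := |δ σ₁ t₁| * exp (-(2 * K * |t₁ - 0|)) with hM
  have hM0 : 0 ≤ M := by positivity
  have hle : ∀ s τ, |s| ≤ R → |τ| ≤ R → |δ s τ| ≤ M * exp (2 * K * |τ - 0|) := by
    intro s τ hs hτ
    have : |δ s τ| * exp (-(2 * K * |τ - 0|)) ≤ M :=
      isMaxOn_iff.1 hmax (s, τ) ⟨(hbox s).1 hs, (hbox τ).1 hτ⟩
    rwa [exp_neg, ← div_eq_mul_inv, div_le_iff₀ (exp_pos _)] at this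
  have hc : Continuous (h σ₁) := continuous_uncurry_comp hh continuous_const continuous_id
  have hint : δ σ₁ t₁ = ∫ τ in 0..t₁, h σ₁ τ := by
    rw [intervalIntegral.integral_eq_sub_of_hasDerivAt (fun τ _ => hd σ₁ τ)
      (hc.intervalIntegrable _ _), h0, sub_zero]
  have hb : |∫ τ in 0..t₁, h σ₁ τ| ≤ K * M / (2 * K) * exp (2 * K * |t₁ - 0|) := by
    refine abs_integral_le_exp (by positivity) (by positivity) fun τ hτ => ?_
    have hτR : |τ| ≤ R := by
      rw [hbox]
      exact (Set.uIcc_subset_Icc ⟨by linarith, hR⟩ ht₁) hτ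
    rw [mul_assoc]
    exact hK σ₁ τ ((hbox _).2 hσ₁) hτR _ (by positivity) fun s hs => hle s τ hs hτR
  rw [← hint] at hb
  have hMM : M ≤ M / 2 := by
    have := mul_le_mul_of_nonneg_right hb (exp_pos (-(2 * K * |t₁ - 0|))).le
    rw [mul_assoc (K * M / (2 * K)), ← exp_add, add_neg_cancel, exp_zero, mul_one, ← hM] at this
    refine this.trans_eq ?_
    field_simp
  have := hle σ t hσ ht
  rw [show M = 0 by linarith, zero_mul] at this
  exact abs_eq_zero.1 (le_antisymm this (abs_nonneg _))

theorem hasDerivAt_label {κ f l₀ E : ℝ → ℝ} (hκ : Continuous κ) 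
    (hl₀ : Continuous l₀) (hE : Continuous E) {Θ l F S C : ℝ → ℝ → ℝ}
    (hΘc : Continuous fun z : ℝ × ℝ => Θ z.1 z.2) (hlc : Continuous fun z : ℝ × ℝ => l z.1 z.2)
    (hFc : Continuous fun z : ℝ × ℝ => F z.1 z.2)
    (hS : ∀ σ t, S σ t = sin (Θ σ t) + F σ t * cos (Θ σ t))
    (hC : ∀ σ t, C σ t = cos (Θ σ t) - F σ t * sin (Θ σ t))
    (hF : ∀ σ t, F σ t = f t + ∫ s in 0..σ, κ s * (E (l s t) * cos (Θ s t) ^ 2))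
    (hΘ : ∀ σ t, Θ σ t = σ + ∫ τ in 0..t, -(1 / 2) * S σ τ ^ 2)
    (hl : ∀ σ t, l σ t = l₀ σ + ∫ τ in 0..t, 1 / 2 * (S σ τ * C σ τ)) (σ t : ℝ) :
    HasDerivAt (fun σ => Θ σ t) (exp (-(2 * l σ t)) * (exp (2 * l₀ σ) -
      ∫ τ in 0..t, exp (2 * l σ τ) * (S σ τ * (κ σ * E (l σ τ) * cos (Θ σ τ) ^ 3)))) σ := by
  obtain ⟨Ω, hΩ⟩ : ∃ Ω : ℝ → ℝ → ℝ, ∀ σ t, Ω σ t = exp (-(2 * l σ t)) * (exp (2 * l₀ σ) -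
      ∫ τ in 0..t, exp (2 * l σ τ) * (S σ τ * (κ σ * E (l σ τ) * cos (Θ σ τ) ^ 3))) :=
    ⟨_, fun _ _ => rfl⟩
  rw [← hΩ]
  have hSc : Continuous fun z : ℝ × ℝ => S z.1 z.2 := by simp only [hS]; fun_prop
  have hCc : Continuous fun z : ℝ × ℝ => C z.1 z.2 := by simp only [hC]; fun_prop
  obtain ⟨g, hg⟩ : ∃ g : ℝ → ℝ → ℝ, ∀ σ τ, g σ τ =
    exp (2 * l σ τ) * (S σ τ * (κ σ * E (l σ τ) * cos (Θ σ τ) ^ 3)) := ⟨_, fun _ _ => rfl⟩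
  have hgc : Continuous fun z : ℝ × ℝ => g z.1 z.2 := by simp only [hg]; fun_prop
  simp only [← hg] at hΩ
  have hΩc : Continuous fun z : ℝ × ℝ => Ω z.1 z.2 := by
    have := continuous_integral_of_continuous (f := fun (z : ℝ × ℝ) τ => g z.1 τ) (a := fun _ => 0)
      (continuous_uncurry_comp hgc (by fun_prop : Continuous fun z : (ℝ × ℝ) × ℝ => z.1.1)
        continuous_snd) continuous_const continuous_snd
    simp only [hΩ]
    fun_prop
  have hΘt : ∀ σ t, HasDerivAt (fun t => Θ σ t) (-(1 / 2) * S σ t ^ 2) t := by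
    intro σ t
    have h₁ : Continuous fun τ => -(1 / 2) * S σ τ ^ 2 := by fun_prop
    have h₂ := ((h₁.integral_hasStrictDerivAt 0 t).hasDerivAt).const_add σ
    exact h₂.congr_of_eventuallyEq (.of_forall fun t => hΘ σ t)
  have hlt : ∀ σ t, HasDerivAt (fun t => l σ t) (1 / 2 * (S σ t * C σ t)) t := by
    intro σ t
    have h₁ : Continuous fun τ => 1 / 2 * (S σ τ * C σ τ) := by fun_prop
    have h₂ := ((h₁.integral_hasStrictDerivAt 0 t).hasDerivAt).const_add (l₀ σ)
    exact h₂.congr_of_eventuallyEq (.of_forall fun t => hl σ t)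
  have hFσ : ∀ σ t, HasDerivAt (fun σ => F σ t) (κ σ * (E (l σ t) * cos (Θ σ t) ^ 2)) σ := by
    intro σ t
    have h₁ : Continuous fun s => κ s * (E (l s t) * cos (Θ s t) ^ 2) := by fun_prop
    have h₂ := ((h₁.integral_hasStrictDerivAt 0 σ).hasDerivAt).const_add (f t)
    exact h₂.congr_of_eventuallyEq (.of_forall fun σ => hF σ t)
  obtain ⟨G, hG⟩ : ∃ G : ℝ → ℝ → ℝ, ∀ σ t, G σ t =
    -(S σ t * C σ t * Ω σ t + κ σ * E (l σ t) * cos (Θ σ t) ^ 2 * (S σ t * cos (Θ σ t))) :=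
    ⟨_, fun _ _ => rfl⟩
  have hGc : Continuous fun z : ℝ × ℝ => G z.1 z.2 := by simp only [hG]; fun_prop
  have hΩt : ∀ σ t, HasDerivAt (fun t => Ω σ t) (G σ t) t := by
    intro σ t
    have h₁ : Continuous (g σ) := continuous_uncurry_comp hgc continuous_const continuous_id
    have h₂ := ((h₁.integral_hasStrictDerivAt 0 t).hasDerivAt).const_sub (exp (2 * l₀ σ))
    have h₃ := ((hlt σ t).const_mul 2).neg.exp.mul h₂
    refine (h₃.congr_of_eventuallyEq (.of_forall fun t => hΩ σ t)).congr_deriv ?_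
    have e : exp (-(2 * l σ t)) * exp (2 * l σ t) = 1 := by rw [← exp_add]; simp
    simp only [Pi.neg_apply]
    rw [hG, hΩ, hg]
    linear_combination (-(S σ t * (κ σ * E (l σ t) * cos (Θ σ t) ^ 3))) * e
  have hΩ0 : ∀ σ, Ω σ 0 = 1 := by
    intro σ
    rw [hΩ, hl]
    simp only [intervalIntegral.integral_same, add_zero, sub_zero]
    rw [← exp_add]; simp
  obtain ⟨Ψ, hΨ⟩ : ∃ Ψ : ℝ → ℝ → ℝ, ∀ σ t, Ψ σ t = Θ 0 t + ∫ s in 0..σ, Ω s t :=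
    ⟨_, fun _ _ => rfl⟩
  have hΨc : Continuous fun z : ℝ × ℝ => Ψ z.1 z.2 := by
    have := continuous_integral_of_continuous (f := fun (z : ℝ × ℝ) s => Ω s z.2) (a := fun _ => 0)
      (continuous_uncurry_comp hΩc continuous_snd
        (by fun_prop : Continuous fun z : (ℝ × ℝ) × ℝ => z.1.2)) continuous_const continuous_fst
    simp only [hΨ]
    fun_prop
  have hΨσ : ∀ σ t, HasDerivAt (fun σ => Ψ σ t) (Ω σ t) σ := by
    intro σ t
    have h₁ : Continuous fun s => Ω s t := by fun_prop
    have h₂ := ((h₁.integral_hasStrictDerivAt 0 σ).hasDerivAt).const_add (Θ 0 t)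
    exact h₂.congr_of_eventuallyEq (.of_forall fun σ => hΨ σ t)
  have hΨt : ∀ σ t, HasDerivAt (fun t => Ψ σ t) (-(1 / 2) * S 0 t ^ 2 + ∫ s in 0..σ, G s t) t := by
    intro σ t
    have h₁ := hasDerivAt_integral_of_continuous (f := fun t s => Ω s t) (f' := fun t s => G s t)
      (by fun_prop) (by fun_prop) (fun t s => hΩt s t) 0 σ t
    exact ((hΘt 0 t).add h₁).congr_of_eventuallyEq (.of_forall fun t => hΨ σ t)
  obtain ⟨S', hS'⟩ : ∃ S' : ℝ → ℝ → ℝ, ∀ σ t, S' σ t = sin (Ψ σ t) + F σ t * cos (Ψ σ t) :=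
    ⟨_, fun _ _ => rfl⟩
  obtain ⟨C', hC'⟩ : ∃ C' : ℝ → ℝ → ℝ, ∀ σ t, C' σ t = cos (Ψ σ t) - F σ t * sin (Ψ σ t) :=
    ⟨_, fun _ _ => rfl⟩
  have hSc' : Continuous fun z : ℝ × ℝ => S' z.1 z.2 := by simp only [hS']; fun_prop
  have hCc' : Continuous fun z : ℝ × ℝ => C' z.1 z.2 := by simp only [hC']; fun_prop
  obtain ⟨G', hG'⟩ : ∃ G' : ℝ → ℝ → ℝ, ∀ σ t, G' σ t =
    -(S' σ t * C' σ t * Ω σ t + κ σ * E (l σ t) * cos (Θ σ t) ^ 2 * (S' σ t * cos (Ψ σ t))) :=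
    ⟨_, fun _ _ => rfl⟩
  have hGc' : Continuous fun z : ℝ × ℝ => G' z.1 z.2 := by simp only [hG']; fun_prop
  have hS'σ : ∀ σ t, HasDerivAt (fun σ => -(1 / 2) * S' σ t ^ 2) (G' σ t) σ := by
    intro σ t
    have h₁ := (hΨσ σ t).sin.add ((hFσ σ t).mul (hΨσ σ t).cos)
    have h₂ := ((h₁.congr_of_eventuallyEq (f₁ := fun σ => S' σ t)
      (.of_forall fun σ => hS' σ t)).pow 2).const_mul (-(1 / 2))
    refine h₂.congr_deriv ?_
    rw [hG', hC']
    push_cast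
    ring
  have hΨ0 : ∀ t, Ψ 0 t = Θ 0 t := fun t => by rw [hΨ]; simp
  have hint : ∀ σ t, ∫ s in 0..σ, G' s t = -(1 / 2) * S' σ t ^ 2 + 1 / 2 * S 0 t ^ 2 := by
    intro σ t
    rw [intervalIntegral.integral_eq_sub_of_hasDerivAt (fun s _ => hS'σ s t)
      (Continuous.intervalIntegrable (by fun_prop) _ _), hS' 0, hΨ0, ← hS]
    ring
  obtain ⟨δ, hδ⟩ : ∃ δ : ℝ → ℝ → ℝ, ∀ σ t, δ σ t = Ψ σ t - Θ σ t := ⟨_, fun _ _ => rfl⟩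
  obtain ⟨h, hh⟩ : ∃ h : ℝ → ℝ → ℝ, ∀ σ t, h σ t = -(1 / 2) * (S' σ t ^ 2 - S σ t ^ 2)
      + ∫ s in 0..σ, (G s t - G' s t) := ⟨_, fun _ _ => rfl⟩
  have hhc : Continuous fun z : ℝ × ℝ => h z.1 z.2 := by
    have := continuous_integral_of_continuous (f := fun (z : ℝ × ℝ) s => G s z.2 - G' s z.2)
      (a := fun _ => 0) (by fun_prop) continuous_const continuous_fst
    simp only [hh]
    fun_prop
  have hδt : ∀ σ t, HasDerivAt (fun t => δ σ t) (h σ t) t := by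
    intro σ t
    refine (((hΨt σ t).sub (hΘt σ t)).congr_of_eventuallyEq
      (.of_forall fun t => hδ σ t)).congr_deriv ?_
    rw [hh, intervalIntegral.integral_sub (Continuous.intervalIntegrable (by fun_prop) _ _)
      (Continuous.intervalIntegrable (by fun_prop) _ _), hint]
    ring
  have hδ0 : ∀ σ, δ σ 0 = 0 := by
    intro σ
    rw [hδ, hΨ, hΘ, hΘ]
    simp only [hΩ0]
    simp
  have key := eq_zero_of_abs_deriv_le (δ := δ) (h := h) (by simp only [hδ]; fun_prop) hhc hδ0 hδt ?_
  · have e : ∀ σ, Θ σ t = Ψ σ t := fun σ => by linarith [hδ σ t, key σ t]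
    exact (hΨσ σ t).congr_of_eventuallyEq (.of_forall e)
  intro R hR
  have hbd : ∀ {f : ℝ → ℝ → ℝ}, (Continuous fun z : ℝ × ℝ => f z.1 z.2) →
      ∃ m, 0 ≤ m ∧ ∀ σ t, |σ| ≤ R → |t| ≤ R → |f σ t| ≤ m := by
    intro f hf
    obtain ⟨m, hm⟩ := ((isCompact_Icc (a := -R) (b := R)).prod (isCompact_Icc (a := -R) (b := R)))
      |>.exists_bound_of_continuousOn hf.continuousOn
    exact ⟨|m|, abs_nonneg _, fun σ t hσ ht =>
      (hm (σ, t) ⟨abs_le.1 hσ, abs_le.1 ht⟩).trans (le_abs_self _)⟩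
  obtain ⟨b, hb0, hb⟩ := hbd hFc
  obtain ⟨m, hm0, hm⟩ := hbd hΩc
  obtain ⟨e, he0, he⟩ := hbd (f := fun σ t => κ σ * E (l σ t) * cos (Θ σ t) ^ 2) (by fun_prop)
  refine ⟨(1 + b) ^ 2 * (1 + 2 * (m + e) * R), by positivity, fun σ t hσ ht c hc hδc => ?_⟩
  have hd : ∀ s, |s| ≤ R → |Ψ s t - Θ s t| ≤ c := fun s hs => by rw [← hδ]; exact hδc s hs
  have hF' : ∀ s, |s| ≤ R → |F s t| ≤ b := fun s hs => hb s t hs ht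
  have hSd : ∀ s, |s| ≤ R → |S' s t - S s t| ≤ (1 + b) * c := fun s hs => by
    rw [hS', hS]
    exact (abs_sin_add_mul_cos_sub_le (e := 0) (hF' s hs) (hd s hs) (by simp)).trans_eq (by ring)
  have hCd : ∀ s, |s| ≤ R → |C' s t - C s t| ≤ (1 + b) * c := fun s hs => by
    rw [hC', hC]
    exact (abs_cos_sub_mul_sin_sub_le (e := 0) (hF' s hs) (hd s hs) (by simp)).trans_eq (by ring)
  have hS1 : ∀ s, |s| ≤ R → |S s t| ≤ 1 + b := fun s hs => by
    rw [hS]; exact (abs_sin_add_mul_cos_le _ _).trans (by linarith [hF' s hs])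
  have hS1' : ∀ s, |s| ≤ R → |S' s t| ≤ 1 + b := fun s hs => by
    rw [hS']; exact (abs_sin_add_mul_cos_le _ _).trans (by linarith [hF' s hs])
  have hC1 : ∀ s, |s| ≤ R → |C s t| ≤ 1 + b := fun s hs => by
    rw [hC]; exact (abs_cos_sub_mul_sin_le _ _).trans (by linarith [hF' s hs])
  have hSS : |S' σ t * S' σ t - S σ t * S σ t| ≤ 2 * (1 + b) * ((1 + b) * c) :=
    abs_mul_sub_mul_le (hS1' σ hσ) (hS1 σ hσ) (hSd σ hσ) (hSd σ hσ)
  have hGG : ∀ s, |s| ≤ R → |G s t - G' s t| ≤ 2 * (1 + b) * ((1 + b) * c) * (m + e) := by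
    intro s hs
    have e₁ := abs_mul_sub_mul_le (hS1' s hs) (hC1 s hs) (hSd s hs) (hCd s hs)
    have hcc : |cos (Ψ s t) - cos (Θ s t)| ≤ (1 + b) * c :=
      (abs_cos_sub_cos_le _ _).trans ((hd s hs).trans (le_mul_of_one_le_left hc (by linarith)))
    have e₂ := abs_mul_sub_mul_le (hS1' s hs)
      ((abs_cos_le_one (Θ s t)).trans (by linarith : 1 ≤ 1 + b)) (hSd s hs) hcc
    rw [hG, hG', show ∀ x y x' y' w k : ℝ, -(x * w + k * y) - -(x' * w + k * y')
      = (x' - x) * w + (y' - y) * k from fun _ _ _ _ _ _ => by ring, mul_add]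
    refine (abs_add_le _ _).trans (add_le_add ?_ ?_)
    · rw [abs_mul]
      exact mul_le_mul e₁ (hm s t hs ht) (abs_nonneg _) (by positivity)
    · rw [abs_mul]
      exact mul_le_mul e₂ (he s t hs ht) (abs_nonneg _) (by positivity)
  have hI : |∫ s in 0..σ, (G s t - G' s t)| ≤ 2 * (1 + b) * ((1 + b) * c) * (m + e) * R := by
    have := intervalIntegral.norm_integral_le_of_norm_le_const (a := 0) (b := σ)
      (f := fun s => G s t - G' s t) (C := 2 * (1 + b) * ((1 + b) * c) * (m + e)) fun s hs => by
        refine hGG s ?_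
        rw [abs_le]
        exact Set.uIcc_subset_Icc ⟨by linarith, hR⟩ (abs_le.1 hσ) (Set.uIoc_subset_uIcc hs)
    rw [sub_zero] at this
    exact this.trans (mul_le_mul_of_nonneg_left hσ (by positivity))
  rw [hh, pow_two, pow_two]
  refine (abs_add_le _ _).trans ?_
  rw [abs_mul, show |(-(1 / 2) : ℝ)| = 1 / 2 by norm_num]
  nlinarith

end LabelDerivative

section LabelSmooth

open Real

theorem exists_label_system {κ f l₀ E : ℝ → ℝ} (hκ : ContDiff ℝ (⊤ : ℕ∞) κ)
    (hf : ContDiff ℝ (⊤ : ℕ∞) f) (hl₀ : ContDiff ℝ (⊤ : ℕ∞) l₀) (hE : ContDiff ℝ (⊤ : ℕ∞) E)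
    {B k M L : ℝ} (hB : ∀ t, |f t| ≤ B)
    (hk : ∀ σ, |∫ s in 0..σ, (|κ s|)| ≤ k) (hM : ∀ x, |E x| ≤ M)
    (hL : ∀ x y, |E x - E y| ≤ L * |x - y|) :
    ∃ Θ l F S C : ℝ → ℝ → ℝ, Smooth2 Θ ∧ Smooth2 l ∧ Smooth2 F ∧
      (∀ σ t, S σ t = sin (Θ σ t) + F σ t * cos (Θ σ t)) ∧
      (∀ σ t, C σ t = cos (Θ σ t) - F σ t * sin (Θ σ t)) ∧
      (∀ σ t, HasDerivAt (fun t => Θ σ t) (-(1 / 2) * S σ t ^ 2) t) ∧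
      (∀ σ t, HasDerivAt (fun t => l σ t) (1 / 2 * (S σ t * C σ t)) t) ∧
      (∀ σ t, HasDerivAt (fun σ => F σ t) (κ σ * (E (l σ t) * cos (Θ σ t) ^ 2)) σ) ∧
      (∀ σ, Θ σ 0 = σ) ∧ (∀ σ, l σ 0 = l₀ σ) ∧ (∀ t, F 0 t = f t) ∧
      ∀ σ t, |F σ t - f t| ≤ k * M := by
  obtain ⟨Θ, l, F, hΘc, hlc, hFc, hF, hΘ, hl, hFf⟩ := exists_label_system_continuous hκ.continuous
    hf.continuous hl₀.continuous hE.continuous hB hk hM hL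
  obtain ⟨S, hS⟩ : ∃ S : ℝ → ℝ → ℝ, ∀ σ t, S σ t = sin (Θ σ t) + F σ t * cos (Θ σ t) :=
    ⟨_, fun _ _ => rfl⟩
  obtain ⟨C, hC⟩ : ∃ C : ℝ → ℝ → ℝ, ∀ σ t, C σ t = cos (Θ σ t) - F σ t * sin (Θ σ t) :=
    ⟨_, fun _ _ => rfl⟩
  simp only [← hS, ← hC] at hΘ hl
  have hκc := hκ.continuous
  have hEc := hE.continuous
  have hSc : Continuous fun z : ℝ × ℝ => S z.1 z.2 := by simp only [hS]; fun_prop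
  have hCc : Continuous fun z : ℝ × ℝ => C z.1 z.2 := by simp only [hC]; fun_prop
  have hΘσ := hasDerivAt_label hκ.continuous hl₀.continuous hE.continuous hΘc hlc hFc hS hC hF hΘ hl
  have hΘt : ∀ σ t, HasDerivAt (fun t => Θ σ t) (-(1 / 2) * S σ t ^ 2) t := by
    intro σ t
    have h₁ : Continuous fun τ => -(1 / 2) * S σ τ ^ 2 := by fun_prop
    have h₂ := ((h₁.integral_hasStrictDerivAt 0 t).hasDerivAt).const_add σ
    exact h₂.congr_of_eventuallyEq (.of_forall fun t => hΘ σ t)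
  have hlt : ∀ σ t, HasDerivAt (fun t => l σ t) (1 / 2 * (S σ t * C σ t)) t := by
    intro σ t
    have h₁ : Continuous fun τ => 1 / 2 * (S σ τ * C σ τ) := by fun_prop
    have h₂ := ((h₁.integral_hasStrictDerivAt 0 t).hasDerivAt).const_add (l₀ σ)
    exact h₂.congr_of_eventuallyEq (.of_forall fun t => hl σ t)
  have hFσ : ∀ σ t, HasDerivAt (fun σ => F σ t) (κ σ * (E (l σ t) * cos (Θ σ t) ^ 2)) σ := by
    intro σ t
    have h₁ : Continuous fun s => κ s * (E (l s t) * cos (Θ s t) ^ 2) := by fun_prop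
    have h₂ := ((h₁.integral_hasStrictDerivAt 0 σ).hasDerivAt).const_add (f t)
    exact h₂.congr_of_eventuallyEq (.of_forall fun σ => hF σ t)
  have hE' : ContDiff ℝ (⊤ : ℕ∞) (deriv E) := (contDiff_infty_iff_deriv.1 hE).2
  have hf' : ContDiff ℝ (⊤ : ℕ∞) (deriv f) := (contDiff_infty_iff_deriv.1 hf).2
  have hEc' := hE'.continuous
  obtain ⟨j, hj⟩ : ∃ j : ℝ → ℝ → ℝ, ∀ σ t, j σ t = κ σ * (deriv E (l σ t) * (1 / 2 * (S σ t * C σ t))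
      * cos (Θ σ t) ^ 2 + E (l σ t) * (2 * cos (Θ σ t) * (-sin (Θ σ t) * (-(1 / 2) * S σ t ^ 2)))) :=
    ⟨_, fun _ _ => rfl⟩
  have hFt : ∀ σ t, HasDerivAt (fun t => F σ t) (deriv f t + ∫ s in 0..σ, j s t) t := by
    intro σ t
    have h₁ : ∀ t s, HasDerivAt (fun t => κ s * (E (l s t) * cos (Θ s t) ^ 2)) (j s t) t := by
      intro t s
      have e₁ := HasDerivAt.comp t (h₂ := E) (h := fun t => l s t)
        (hE.differentiable (by simp) (l s t)).hasDerivAt (hlt s t)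
      have e₂ := (e₁.mul ((hΘt s t).cos.pow 2)).const_mul (κ s)
      refine e₂.congr_deriv ?_
      rw [hj]
      simp only [Function.comp_apply, Pi.pow_apply]
      push_cast
      ring
    have h₂ := hasDerivAt_integral_of_continuous
      (f := fun t s => κ s * (E (l s t) * cos (Θ s t) ^ 2)) (f' := fun t s => j s t)
      (by fun_prop) (by simp only [hj]; fun_prop) h₁ 0 σ t
    have h₃ := (hf.differentiable (by simp) t).hasDerivAt
    exact (h₃.add h₂).congr_of_eventuallyEq (.of_forall fun t => hF σ t)
  have hle : ∀ {V : Type} [NormedAddCommGroup V] [NormedSpace ℝ V] {g : V → ℝ} (n : ℕ),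
      ContDiff ℝ (⊤ : ℕ∞) g → ContDiff ℝ n g := fun n hg => hg.of_le (by exact_mod_cast le_top)
  have hlevel : ∀ n : ℕ, ContDiff ℝ n (fun z : ℝ × ℝ => Θ z.1 z.2) →
      ContDiff ℝ n (fun z : ℝ × ℝ => F z.1 z.2) → ContDiff ℝ n (fun z : ℝ × ℝ => S z.1 z.2) ∧
      ContDiff ℝ n (fun z : ℝ × ℝ => C z.1 z.2) ∧ ContDiff ℝ n (fun z : ℝ × ℝ => l z.1 z.2) := by
    intro n h₁ h₂
    have hSn : ContDiff ℝ n (fun z : ℝ × ℝ => S z.1 z.2) := by simp only [hS]; fun_prop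
    have hCn : ContDiff ℝ n (fun z : ℝ × ℝ => C z.1 z.2) := by simp only [hC]; fun_prop
    refine ⟨hSn, hCn, ?_⟩
    have := contDiff_integral (f := fun σ τ => 1 / 2 * (S σ τ * C σ τ))
      (contDiff_const.mul (hSn.mul hCn))
    have hl₀n := hle n hl₀
    simp only [hl]
    exact (hl₀n.comp contDiff_fst).add this
  have hmain : ∀ n : ℕ, ContDiff ℝ n (fun z : ℝ × ℝ => Θ z.1 z.2) ∧
      ContDiff ℝ n (fun z : ℝ × ℝ => F z.1 z.2) := by
    intro n
    induction n with
    | zero => exact ⟨contDiff_zero.2 hΘc, contDiff_zero.2 hFc⟩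
    | succ n ih =>
      obtain ⟨hΘn, hFn⟩ := ih
      obtain ⟨hSn, hCn, hln⟩ := hlevel n hΘn hFn
      have hκn := hle n hκ
      have hEn := hle n hE
      have hEn' := hle n hE'
      have hfn' := hle n hf'
      have hl₀n := hle n hl₀
      have hEl : ContDiff ℝ n fun z : ℝ × ℝ => E (l z.1 z.2) := hEn.comp hln
      have hEl' : ContDiff ℝ n fun z : ℝ × ℝ => deriv E (l z.1 z.2) := hEn'.comp hln
      have hκ1 : ContDiff ℝ n fun z : ℝ × ℝ => κ z.1 := hκn.comp contDiff_fst
      have hl1 : ContDiff ℝ n fun z : ℝ × ℝ => l₀ z.1 := hl₀n.comp contDiff_fst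
      have hcn : ContDiff ℝ n fun z : ℝ × ℝ => cos (Θ z.1 z.2) := contDiff_cos.comp hΘn
      have hsn : ContDiff ℝ n fun z : ℝ × ℝ => sin (Θ z.1 z.2) := contDiff_sin.comp hΘn
      have hxn : ContDiff ℝ n fun z : ℝ × ℝ => exp (2 * l z.1 z.2) :=
        contDiff_exp.comp (contDiff_const.mul hln)
      have hxn' : ContDiff ℝ n fun z : ℝ × ℝ => exp (-(2 * l z.1 z.2)) :=
        contDiff_exp.comp (contDiff_const.mul hln).neg
      refine ⟨contDiff_succ_of_partials hΘσ hΘt ?_ (contDiff_const.mul (hSn.pow 2)),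
        contDiff_succ_of_partials hFσ hFt (hκ1.mul (hEl.mul (hcn.pow 2))) ?_⟩
      · have := contDiff_integral (f := fun σ τ =>
          exp (2 * l σ τ) * (S σ τ * (κ σ * E (l σ τ) * cos (Θ σ τ) ^ 3)))
          (hxn.mul (hSn.mul ((hκ1.mul hEl).mul (hcn.pow 3))))
        exact hxn'.mul ((contDiff_exp.comp (contDiff_const.mul hl1)).sub this)
      · have hjn : ContDiff ℝ n fun z : ℝ × ℝ => j z.1 z.2 := by
          simp only [hj]
          exact hκ1.mul (((hEl'.mul (contDiff_const.mul (hSn.mul hCn))).mul (hcn.pow 2)).add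
            (hEl.mul ((contDiff_const.mul hcn).mul (hsn.neg.mul (contDiff_const.mul (hSn.pow 2))))))
        exact (hfn'.comp contDiff_snd).add (contDiff_integral_fst hjn)
  refine ⟨Θ, l, F, S, C, contDiff_infty.2 fun n => (hmain n).1,
    contDiff_infty.2 fun n => (hlevel n (hmain n).1 (hmain n).2).2.2,
    contDiff_infty.2 fun n => (hmain n).2, hS, hC, hΘt, hlt, hFσ, fun σ => ?_, fun σ => ?_,
    fun t => ?_, hFf⟩
  · rw [hΘ]; simp
  · rw [hl]; simp
  · rw [hF]; simp

end LabelSmooth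

section Window

open Real

theorem hasDerivAt_comp_neg {f : ℝ → ℝ} {f' x : ℝ} (hf : HasDerivAt f f' (-x)) :
    HasDerivAt (fun x => f (-x)) (-f') x := by
  have := HasDerivAt.comp x (h₂ := f) (h := fun x => -x) hf (hasDerivAt_neg x)
  exact this.congr_deriv (by ring)

theorem antitoneOn_Icc_of_hasDerivAt {f f' : ℝ → ℝ} {a b : ℝ} (hf : ∀ x, HasDerivAt f (f' x) x)
    (hf' : ∀ x ∈ Set.Icc a b, f' x ≤ 0) : AntitoneOn f (Set.Icc a b) :=
  antitoneOn_of_deriv_nonpos (convex_Icc a b) (fun x _ => (hf x).continuousAt.continuousWithinAt)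
    (fun x _ => (hf x).differentiableAt.differentiableWithinAt) fun x hx => by
      rw [(hf x).deriv]
      exact hf' x (interior_subset hx)

theorem sin_sub_cos_le {x : ℝ} (h₁ : -(π / 2) ≤ x) (h₂ : x ≤ 1 / 4) : sin x - cos x ≤ -(1 / 2) := by
  have hc : 0 ≤ cos x := cos_nonneg_of_neg_pi_div_two_le_of_le h₁ (by linarith [pi_gt_three])
  rcases le_or_gt x 0 with hx | hx
  · have hs : sin x ≤ 0 := sin_nonpos_of_nonpos_of_neg_pi_le hx (by linarith [pi_pos])
    nlinarith [sin_sq_add_cos_sq x]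
  · have := sin_le hx.le
    have := one_sub_sq_div_two_le_cos (x := x)
    nlinarith

variable {θ l F S C : ℝ → ℝ}

/-- Along a label, once `F ≤ -1` the angle leaves the window `θ > -π/2` in finite time, and until
then `e^(2l) cos² θ` decreases. -/
theorem label_window (hS : ∀ t, S t = sin (θ t) + F t * cos (θ t))
    (hC : ∀ t, C t = cos (θ t) - F t * sin (θ t))
    (hθ : ∀ t, HasDerivAt θ (-(1 / 2) * S t ^ 2) t)
    (hl : ∀ t, HasDerivAt l (1 / 2 * (S t * C t)) t) {d : ℝ} (hd : 0 ≤ d)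
    (hF : ∀ t, d ≤ t → F t ≤ -1) (h0 : θ 0 ≤ 1 / 4) {t : ℝ} (ht : d ≤ t) (hw : -(π / 2) < θ t) :
    t ≤ d + 16 ∧ exp (2 * l t) * cos (θ t) ^ 2 ≤ exp (2 * l d) * cos (θ d) ^ 2 := by
  have hanti : Antitone θ := antitone_of_hasDerivAt_nonpos hθ fun t => by
    simp only [Pi.zero_apply]
    nlinarith [sq_nonneg (S t)]
  have hlow : ∀ τ ∈ Set.Icc d t, -(π / 2) ≤ θ τ := fun τ hτ => hw.le.trans (hanti hτ.2)
  have hup : ∀ τ ∈ Set.Icc d t, θ τ ≤ 1 / 4 := fun τ hτ => (hanti (hd.trans hτ.1)).trans h0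
  have hcos : ∀ τ ∈ Set.Icc d t, 0 ≤ cos (θ τ) := fun τ hτ =>
    cos_nonneg_of_neg_pi_div_two_le_of_le (hlow τ hτ) (by linarith [hup τ hτ, pi_gt_three])
  have hS2 : ∀ τ ∈ Set.Icc d t, S τ ≤ -(1 / 2) := fun τ hτ => by
    rw [hS]
    nlinarith [sin_sub_cos_le (hlow τ hτ) (hup τ hτ),
      mul_le_mul_of_nonneg_right (hF τ hτ.1) (hcos τ hτ)]
  have hdm : d ∈ Set.Icc d t := ⟨le_rfl, ht⟩
  have htm : t ∈ Set.Icc d t := ⟨ht, le_rfl⟩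
  constructor
  · have h₁ := antitoneOn_Icc_of_hasDerivAt (a := d) (b := t)
      (fun τ => (hθ τ).add ((hasDerivAt_id τ).div_const 8)) fun τ hτ => by nlinarith [hS2 τ hτ]
    have h₂ := h₁ hdm htm ht
    simp only [Pi.add_apply, id] at h₂
    linarith [hup d hdm, pi_lt_d2]
  · refine antitoneOn_Icc_of_hasDerivAt (a := d) (b := t)
      (f := fun τ => exp (2 * l τ) * cos (θ τ) ^ 2) (f' := fun τ => exp (2 * l τ) * cos (θ τ) * S τ)
      (fun τ => ?_) (fun τ hτ => ?_) hdm htm ht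
    · refine (((hl τ).const_mul 2).exp.mul ((hθ τ).cos.pow 2)).congr_deriv ?_
      simp only [Pi.pow_apply]
      push_cast
      have e : C τ * cos (θ τ) + S τ * sin (θ τ) = 1 := by
        rw [hC, hS]
        linear_combination sin_sq_add_cos_sq (θ τ)
      linear_combination exp (2 * l τ) * S τ * cos (θ τ) * e
    · exact mul_nonpos_of_nonneg_of_nonpos (mul_nonneg (exp_pos _).le (hcos τ hτ))
        ((hS2 τ hτ).trans (by norm_num))

theorem label_window_neg (hS : ∀ t, S t = sin (θ t) + F t * cos (θ t))
    (hC : ∀ t, C t = cos (θ t) - F t * sin (θ t))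
    (hθ : ∀ t, HasDerivAt θ (-(1 / 2) * S t ^ 2) t)
    (hl : ∀ t, HasDerivAt l (1 / 2 * (S t * C t)) t) {d : ℝ} (hd : 0 ≤ d)
    (hF : ∀ t, t ≤ -d → 1 ≤ F t) (h0 : -(1 / 4) ≤ θ 0) {t : ℝ} (ht : t ≤ -d) (hw : θ t < π / 2) :
    -(d + 16) ≤ t ∧ exp (2 * l t) * cos (θ t) ^ 2 ≤ exp (2 * l (-d)) * cos (θ (-d)) ^ 2 := by
  have h := label_window (θ := fun t => -θ (-t)) (l := fun t => l (-t)) (F := fun t => -F (-t))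
    (S := fun t => -S (-t)) (C := fun t => C (-t)) (fun t => by simp only [hS, sin_neg, cos_neg]; ring)
    (fun t => by simp only [hC, sin_neg, cos_neg]; ring)
    (fun t => by
      have := (hasDerivAt_comp_neg (hθ (-t))).neg
      exact this.congr_deriv (by ring))
    (fun t => by
      have := hasDerivAt_comp_neg (hl (-t))
      exact this.congr_deriv (by ring)) hd (fun t ht => by linarith [hF (-t) (by linarith)])
    (by simpa using by linarith) (t := -t) (by linarith) (by rw [neg_neg]; linarith)
  simp only [neg_neg, cos_neg] at h
  exact ⟨by linarith [h.1], h.2⟩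

theorem le_of_deriv_pos_at_level {h h' : ℝ → ℝ} (hd : ∀ x, HasDerivAt h (h' x) x) {c : ℝ}
    (hpos : ∀ x, h x = c → 0 < h' x) {a b : ℝ} (hab : a ≤ b) (ha : c ≤ h a) : c ≤ h b :=
  image_le_of_deriv_right_lt_deriv_boundary (f := fun _ => c) (f' := fun _ => 0) (a := a) (b := b)
    continuousOn_const (fun x _ => (hasDerivAt_const x c).hasDerivWithinAt) ha hd
    (fun x _ hx => hpos x hx.symm) ⟨hab, le_rfl⟩

/-- A function with positive derivative at every point of a level set attains the level once. -/
theorem eq_of_deriv_pos_at_level {h h' : ℝ → ℝ} (hd : ∀ x, HasDerivAt h (h' x) x) {c : ℝ}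
    (hpos : ∀ x, h x = c → 0 < h' x) {a b : ℝ} (ha : h a = c) (hb : h b = c) : a = b := by
  have key : ∀ a b, h a = c → h b = c → a < b → False := by
    intro a b ha hb hab
    have hge : ∀ x, a ≤ x → c ≤ h x := fun x hx => le_of_deriv_pos_at_level hd hpos hx ha.ge
    have hle : ∀ x, x ≤ b → h x ≤ c := fun x hx => by
      have := le_of_deriv_pos_at_level (h := fun x => -h (-x)) (h' := fun x => h' (-x)) (c := -c)
        (fun x => by
          have := (hasDerivAt_comp_neg (hd (-x))).neg
          exact this.congr_deriv (by ring)) (fun x hx => hpos _ (by linarith)) (neg_le_neg hx)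
        (by simp [hb])
      simp only [neg_neg] at this
      linarith
    have hm : (a + b) / 2 ∈ Set.Ioo a b := ⟨by linarith, by linarith⟩
    have he : h =ᶠ[nhds ((a + b) / 2)] fun _ => c := by
      filter_upwards [Ioo_mem_nhds hm.1 hm.2] with x hx
      exact le_antisymm (hle x hx.2.le) (hge x hx.1.le)
    have := (hd _).unique ((hasDerivAt_const _ c).congr_of_eventuallyEq he)
    linarith [hpos _ he.eq_of_nhds]
  rcases lt_trichotomy a b with h | h | h
  · exact (key a b ha hb h).elim
  · exact h
  · exact (key b a hb ha h).elim

end Window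

section LabelSystem

open Real

/-- Smooth solutions of the Lagrangian system with labels `σ`. -/
structure IsLabelSystem (κ l₀ E : ℝ → ℝ) (Θ l F S C : ℝ → ℝ → ℝ) : Prop where
  smooth_angle : Smooth2 Θ
  smooth_log : Smooth2 l
  smooth_field : Smooth2 F
  sin_eq : ∀ σ t, S σ t = sin (Θ σ t) + F σ t * cos (Θ σ t)
  cos_eq : ∀ σ t, C σ t = cos (Θ σ t) - F σ t * sin (Θ σ t)
  angle_deriv : ∀ σ t, HasDerivAt (fun t => Θ σ t) (-(1 / 2) * S σ t ^ 2) t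
  log_deriv : ∀ σ t, HasDerivAt (fun t => l σ t) (1 / 2 * (S σ t * C σ t)) t
  field_deriv : ∀ σ t, HasDerivAt (fun σ => F σ t) (κ σ * (E (l σ t) * cos (Θ σ t) ^ 2)) σ
  angle_zero : ∀ σ, Θ σ 0 = σ
  log_zero : ∀ σ, l σ 0 = l₀ σ

namespace IsLabelSystem

variable {κ l₀ E : ℝ → ℝ} {Θ l F S C : ℝ → ℝ → ℝ}

theorem mul_cos_add_mul_sin (h : IsLabelSystem κ l₀ E Θ l F S C) (σ t : ℝ) :
    C σ t * cos (Θ σ t) + S σ t * sin (Θ σ t) = 1 := by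
  rw [h.cos_eq, h.sin_eq]
  linear_combination sin_sq_add_cos_sq (Θ σ t)

theorem hasDerivAt_pdx_angle (h : IsLabelSystem κ l₀ E Θ l F S C) (σ t : ℝ) :
    HasDerivAt (fun t => pdx Θ σ t)
      (-S σ t * (C σ t * pdx Θ σ t + κ σ * (E (l σ t) * cos (Θ σ t) ^ 3))) t := by
  have h₁ := h.smooth_angle.pdx.hasDerivAt_snd σ t
  rw [h.smooth_angle.pdt_pdx] at h₁
  have h₂ : HasDerivAt (fun σ => S σ t)
      (C σ t * pdx Θ σ t + κ σ * (E (l σ t) * cos (Θ σ t) ^ 3)) σ := by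
    have e : (fun σ => S σ t) = fun σ => sin (Θ σ t) + F σ t * cos (Θ σ t) :=
      funext fun σ => h.sin_eq σ t
    have hΘ := h.smooth_angle.hasDerivAt_fst σ t
    rw [e]
    refine (hΘ.sin.add ((h.field_deriv σ t).mul hΘ.cos)).congr_deriv ?_
    rw [h.cos_eq]
    ring
  have h₃ : pdt Θ = fun σ t => -(1 / 2) * S σ t ^ 2 :=
    funext fun σ => funext fun t => (h.angle_deriv σ t).deriv
  have h₄ : HasDerivAt (fun σ => -(1 / 2) * S σ t ^ 2)
      (-S σ t * (C σ t * pdx Θ σ t + κ σ * (E (l σ t) * cos (Θ σ t) ^ 3))) σ := by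
    refine ((h₂.pow 2).const_mul (-(1 / 2))).congr_deriv ?_
    push_cast
    ring
  rw [h₃] at h₁
  exact h₁.congr_deriv h₄.deriv

theorem exp_mul_pdx_angle (h : IsLabelSystem κ l₀ E Θ l F S C) {σ t : ℝ}
    (hE : ∀ τ ∈ Set.uIcc 0 t, κ σ * (E (l σ τ) - exp (2 * l σ τ)) = 0)
    (hbal : exp (2 * l₀ σ) + 1 / 2 * κ σ * (exp (2 * l₀ σ) * cos σ ^ 2) ^ 2 = 1 / 2) :
    exp (2 * l σ t) * pdx Θ σ t =
      1 / 2 * (1 - κ σ * (exp (2 * l σ t) * cos (Θ σ t) ^ 2) ^ 2) := by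
  obtain ⟨G, hG⟩ : ∃ G : ℝ → ℝ, ∀ t, G t = exp (2 * l σ t) * pdx Θ σ t +
    1 / 2 * κ σ * (exp (2 * l σ t) * cos (Θ σ t) ^ 2) ^ 2 := ⟨_, fun _ => rfl⟩
  have hd : ∀ τ, HasDerivAt G (κ σ * (E (l σ τ) - exp (2 * l σ τ)) *
      (-(exp (2 * l σ τ) * S σ τ * cos (Θ σ τ) ^ 3))) τ := by
    intro τ
    rw [funext hG]
    have he := ((h.log_deriv σ τ).const_mul 2).exp
    have hc := (h.angle_deriv σ τ).cos
    refine ((he.mul (h.hasDerivAt_pdx_angle σ τ)).add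
      (((he.mul (hc.pow 2)).pow 2).const_mul (1 / 2 * κ σ))).congr_deriv ?_
    simp only [Pi.pow_apply, Pi.mul_apply]
    push_cast
    linear_combination κ σ * exp (2 * l σ τ) ^ 2 * cos (Θ σ τ) ^ 3 * S σ τ
      * h.mul_cos_add_mul_sin σ τ
  have hconst : G t = G 0 := by
    have hi := intervalIntegral.integral_eq_sub_of_hasDerivAt (a := 0) (b := t) (f := G)
      (f' := fun _ => 0) (fun τ hτ => by
        have := hd τ
        rwa [hE τ hτ, zero_mul] at this) (by simp)
    rw [intervalIntegral.integral_zero] at hi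
    linarith
  have h0 : pdx Θ σ 0 = 1 := by
    have e : (fun σ => Θ σ 0) = fun σ => σ := funext h.angle_zero
    rw [pdx, e]
    exact deriv_id σ
  rw [hG, hG, h.log_zero, h.angle_zero, h0, mul_one, hbal] at hconst
  linarith

theorem abs_log_sub_le (h : IsLabelSystem κ l₀ E Θ l F S C) {b : ℝ} {σ : ℝ}
    (hF : ∀ t, |F σ t| ≤ b) (t : ℝ) : |l σ t - l₀ σ| ≤ 1 / 2 * (1 + b) ^ 2 * |t| := by
  have hb : ∀ τ, ‖1 / 2 * (S σ τ * C σ τ)‖ ≤ 1 / 2 * (1 + b) ^ 2 := fun τ => by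
    rw [norm_eq_abs, abs_mul, abs_mul, h.sin_eq, h.cos_eq, sq, abs_of_pos (by norm_num : (0:ℝ) < 1 / 2)]
    have h₁ := (abs_sin_add_mul_cos_le (Θ σ τ) (F σ τ)).trans (add_le_add_right (hF τ) 1)
    have h₂ := (abs_cos_sub_mul_sin_le (Θ σ τ) (F σ τ)).trans (add_le_add_right (hF τ) 1)
    exact mul_le_mul_of_nonneg_left
      (mul_le_mul h₁ h₂ (abs_nonneg _) ((abs_nonneg _).trans h₁)) (by norm_num)
  have := convex_univ.norm_image_sub_le_of_norm_hasDerivWithin_le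
    (fun τ _ => (h.log_deriv σ τ).hasDerivWithinAt) (fun τ _ => hb τ) (Set.mem_univ 0)
    (Set.mem_univ t)
  simpa [h.log_zero] using this

theorem abs_angle_sub_le (h : IsLabelSystem κ l₀ E Θ l F S C) {b : ℝ} {σ : ℝ}
    (hF : ∀ t, |F σ t| ≤ b) (t : ℝ) : |Θ σ t - σ| ≤ 1 / 2 * (1 + b) ^ 2 * |t| := by
  have hb : ∀ τ, ‖-(1 / 2) * S σ τ ^ 2‖ ≤ 1 / 2 * (1 + b) ^ 2 := fun τ => by
    rw [norm_eq_abs, abs_mul, abs_pow, h.sin_eq, abs_neg, abs_of_pos (by norm_num : (0:ℝ) < 1 / 2)]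
    have h₁ := (abs_sin_add_mul_cos_le (Θ σ τ) (F σ τ)).trans (add_le_add_right (hF τ) 1)
    exact mul_le_mul_of_nonneg_left (pow_le_pow_left₀ (abs_nonneg _) h₁ 2) (by norm_num)
  have := convex_univ.norm_image_sub_le_of_norm_hasDerivWithin_le
    (fun τ _ => (h.angle_deriv σ τ).hasDerivWithinAt) (fun τ _ => hb τ) (Set.mem_univ 0)
    (Set.mem_univ t)
  simpa [h.angle_zero] using this

/-- As long as a charged label stays in the window `|Θ| < π / 2`, the time is bounded and the
density `κ (e^(2l) cos² Θ)²` stays below one. -/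
theorem window (h : IsLabelSystem κ l₀ E Θ l F S C) {b δ σ : ℝ}
    (hF : ∀ t, |F σ t| ≤ b) (hδ : 0 ≤ δ) (hneg : ∀ t, δ ≤ t → F σ t ≤ -1)
    (hpos : ∀ t, t ≤ -δ → 1 ≤ F σ t) (hσ : |σ| ≤ 1 / 4)
    (hsmall : κ σ * exp (4 * l₀ σ + 4 * (1 / 2 * (1 + b) ^ 2 * δ)) < 1) {t : ℝ}
    (h₁ : -(π / 2) < Θ σ t) (h₂ : Θ σ t < π / 2) :
    |t| ≤ δ + 16 ∧ κ σ * (exp (2 * l σ t) * cos (Θ σ t) ^ 2) ^ 2 < 1 := by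
  have hmid : ∀ t, |t| ≤ δ → κ σ * (exp (2 * l σ t) * cos (Θ σ t) ^ 2) ^ 2 < 1 := by
    intro t ht
    rcases le_or_gt (κ σ) 0 with hκ | hκ
    · exact (mul_nonpos_of_nonpos_of_nonneg hκ (sq_nonneg _)).trans_lt one_pos
    · refine lt_of_le_of_lt (mul_le_mul_of_nonneg_left ?_ hκ.le) hsmall
      have hl := (abs_le.1 ((h.abs_log_sub_le hF t).trans
        (mul_le_mul_of_nonneg_left ht (by positivity)))).2
      have he : exp (2 * l σ t) * cos (Θ σ t) ^ 2 ≤ exp (2 * l σ t) :=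
        mul_le_of_le_one_right (exp_pos _).le (cos_sq_le_one _)
      refine (pow_le_pow_left₀ (by positivity) he 2).trans ?_
      rw [← exp_nat_mul]
      refine exp_le_exp.2 ?_
      push_cast
      linarith
  have hcomp : ∀ {x y : ℝ}, exp (2 * l σ x) * cos (Θ σ x) ^ 2 ≤ exp (2 * l σ y) * cos (Θ σ y) ^ 2 →
      κ σ * (exp (2 * l σ y) * cos (Θ σ y) ^ 2) ^ 2 < 1 →
      κ σ * (exp (2 * l σ x) * cos (Θ σ x) ^ 2) ^ 2 < 1 := by
    intro x y hxy hy
    rcases le_or_gt (κ σ) 0 with hκ | hκ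
    · exact (mul_nonpos_of_nonpos_of_nonneg hκ (sq_nonneg _)).trans_lt one_pos
    · exact (mul_le_mul_of_nonneg_left (pow_le_pow_left₀ (by positivity) hxy 2) hκ.le).trans_lt hy
  have h0 := abs_le.1 hσ
  rw [← h.angle_zero σ] at h0
  rcases le_or_gt |t| δ with ht | ht
  · exact ⟨by linarith, hmid t ht⟩
  · rcases lt_abs.1 ht with ht | ht
    · obtain ⟨h₃, h₄⟩ := label_window (h.sin_eq σ) (h.cos_eq σ) (h.angle_deriv σ) (h.log_deriv σ) hδ
        hneg h0.2 ht.le h₁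
      exact ⟨abs_le.2 ⟨by linarith, h₃⟩, hcomp h₄ (hmid δ (abs_of_nonneg hδ).le)⟩
    · obtain ⟨h₃, h₄⟩ := label_window_neg (h.sin_eq σ) (h.cos_eq σ) (h.angle_deriv σ)
        (h.log_deriv σ) hδ hpos h0.1 (by linarith : t ≤ -δ) h₂
      exact ⟨abs_le.2 ⟨h₃, by linarith⟩, hcomp h₄ (hmid (-δ) (by rw [abs_neg, abs_of_nonneg hδ]))⟩

end IsLabelSystem

end LabelSystem

section LabelSolution

open Real

namespace IsLabelSystem

variable {κ l₀ E : ℝ → ℝ} {Θ l F S C : ℝ → ℝ → ℝ}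

theorem exists_label (h : IsLabelSystem κ l₀ E Θ l F S C) {b : ℝ} (hF : ∀ σ t, |F σ t| ≤ b)
    (hpos : ∀ σ t, -(π / 2) < Θ σ t → Θ σ t < π / 2 → 0 < pdx Θ σ t) :
    ∃ Sg : ℝ → ℝ → ℝ, Smooth2 Sg ∧ ∀ x t, Θ (Sg x t) t = arctan x := by
  have hex : ∀ x t, ∃ σ, Θ σ t = arctan x := by
    intro x t
    have hK : 0 ≤ 1 / 2 * (1 + b) ^ 2 * |t| := by positivity
    have hb := fun σ => abs_le.1 (h.abs_angle_sub_le (hF σ) t)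
    have hc : Continuous fun σ => Θ σ t :=
      continuous_uncurry_comp h.smooth_angle.continuous continuous_id continuous_const
    obtain ⟨σ, -, hσ⟩ := intermediate_value_Icc
      (by linarith : arctan x - 1 / 2 * (1 + b) ^ 2 * |t| ≤ arctan x + 1 / 2 * (1 + b) ^ 2 * |t|)
      hc.continuousOn (show arctan x ∈ _ from
        ⟨by linarith [(hb (arctan x - 1 / 2 * (1 + b) ^ 2 * |t|)).2],
          by linarith [(hb (arctan x + 1 / 2 * (1 + b) ^ 2 * |t|)).1]⟩)
    exact ⟨σ, hσ⟩
  choose Sg hSg using hex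
  have hp : ∀ σ x t, Θ σ t = arctan x → 0 < pdx Θ σ t := fun σ x t e =>
    hpos σ t (e ▸ neg_pi_div_two_lt_arctan x) (e ▸ arctan_lt_pi_div_two x)
  refine ⟨Sg, smooth2_of_unique_level h.smooth_angle contDiff_arctan hSg (fun σ x t e => ?_)
    fun x t => (hp _ x t (hSg x t)).ne', hSg⟩
  exact eq_of_deriv_pos_at_level (fun σ => h.smooth_angle.hasDerivAt_fst σ t)
    (fun σ => hp σ x t) e (hSg x t)

theorem pdx_pdt_field (h : IsLabelSystem κ l₀ E Θ l F S C) (hE : Differentiable ℝ E) {σ t : ℝ}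
    (hEl : κ σ * (deriv E (l σ t) - 2 * E (l σ t)) = 0) :
    pdx (pdt F) σ t = κ σ * (E (l σ t) * (S σ t * cos (Θ σ t))) := by
  have e : pdx F = fun σ t => κ σ * (E (l σ t) * cos (Θ σ t) ^ 2) :=
    funext fun σ => funext fun t => (h.field_deriv σ t).deriv
  have h₁ : HasDerivAt (fun t => E (l σ t)) (deriv E (l σ t) * (1 / 2 * (S σ t * C σ t))) t :=
    HasDerivAt.comp t (h₂ := E) (h := fun t => l σ t) (hE _).hasDerivAt (h.log_deriv σ t)
  have h₂ := (h₁.mul ((h.angle_deriv σ t).cos.pow 2)).const_mul (κ σ)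
  rw [← h.smooth_field.pdt_pdx, e]
  refine h₂.deriv.trans ?_
  simp only [Pi.pow_apply]
  push_cast
  linear_combination κ σ * E (l σ t) * S σ t * cos (Θ σ t) * h.mul_cos_add_mul_sin σ t
    + 1 / 2 * S σ t * C σ t * cos (Θ σ t) ^ 2 * hEl

theorem exists_isSPESol (h : IsLabelSystem κ l₀ E Θ l F S C) {b : ℝ} (hF : ∀ σ t, |F σ t| ≤ b)
    (hpos : ∀ σ t, -(π / 2) < Θ σ t → Θ σ t < π / 2 → 0 < pdx Θ σ t) (hE : Differentiable ℝ E)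
    (hEl : ∀ σ t, -(π / 2) < Θ σ t → Θ σ t < π / 2 →
      κ σ * (deriv E (l σ t) - 2 * E (l σ t)) = 0) {f n : ℝ → ℝ} {n' : ℝ} (hf : ∀ t, F 0 t = f t)
    (hn : ∀ σ, κ σ * (E (l₀ σ) * cos σ ^ 4) = n σ) (hn' : HasDerivAt n n' 0) :
    ∃ u, IsSPESol (-1) (1 / 2) u ∧ u 0 0 = f 0 ∧ pdx u 0 0 = 1 + n 0 ∧ pdx (pdx u) 0 0 = n' ∧
      pdt u 0 0 = 1 / 2 * f 0 ^ 2 * n 0 + deriv f 0 ∧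
      pdt (pdt u) 0 0 = u 0 0 * pdt u 0 0 * pdx u 0 0 + 1 / 2 * u 0 0 ^ 2 *
        (-1 * u 0 0 + u 0 0 * pdx u 0 0 ^ 2 + 1 / 2 * u 0 0 ^ 2 * pdx (pdx u) 0 0) +
        (1 / 2 * f 0 ^ 3 * n 0 + deriv (deriv f) 0 - f 0 * pdt u 0 0) := by
  obtain ⟨Sg, hSs, hSg⟩ := h.exists_label hF hpos
  have hlo : ∀ x t, -(π / 2) < Θ (Sg x t) t := fun x t => hSg x t ▸ neg_pi_div_two_lt_arctan x
  have hhi : ∀ x t, Θ (Sg x t) t < π / 2 := fun x t => hSg x t ▸ arctan_lt_pi_div_two x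
  have hΩ : ∀ x t, 0 < pdx Θ (Sg x t) t := fun x t => hpos _ _ (hlo x t) (hhi x t)
  obtain ⟨u, hu⟩ : ∃ u : ℝ → ℝ → ℝ, u = fun x t => x + F (Sg x t) t := ⟨_, rfl⟩
  have hu' : ∀ x t, u x t = x + F (Sg x t) t := fun x t => by rw [hu]
  have hfst : Smooth2 fun x _ => x := contDiff_fst
  have hsnd : Smooth2 fun _ t => t := contDiff_snd
  have hus : Smooth2 u := by
    rw [hu]
    exact ContDiff.add hfst (h.smooth_field.comp hSs hsnd)
  have hSu : ∀ x t, S (Sg x t) t = cos (arctan x) * u x t := by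
    intro x t
    have hc := (cos_arctan_pos x).ne'
    have ht := tan_arctan x
    rw [tan_eq_sin_div_cos, div_eq_iff hc] at ht
    rw [h.sin_eq, hSg, hu', ht]
    ring
  have hcos : ∀ x : ℝ, cos (arctan x) ^ 2 = 1 / (1 + x ^ 2) := fun x => by rw [cos_sq_arctan]
  have hSx : ∀ x t, pdx Θ (Sg x t) t * pdx Sg x t = cos (arctan x) ^ 2 := by
    intro x t
    have h₁ := h.smooth_angle.hasDerivAt_comp (hSs.hasDerivAt_fst x t) (hasDerivAt_const x t)
    simp only [hSg] at h₁
    rw [hcos]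
    linarith [h₁.unique (hasDerivAt_arctan x)]
  have hpΘ : ∀ σ t, pdt Θ σ t = -(1 / 2) * S σ t ^ 2 := fun σ t => (h.angle_deriv σ t).deriv
  have hpF : ∀ σ t, pdx F σ t = κ σ * (E (l σ t) * cos (Θ σ t) ^ 2) :=
    fun σ t => (h.field_deriv σ t).deriv
  have hSt : ∀ x t, pdt Sg x t = 1 / 2 * u x t ^ 2 * pdx Sg x t := by
    intro x t
    have h₁ := h.smooth_angle.hasDerivAt_comp (hSs.hasDerivAt_snd x t) (hasDerivAt_id t)
    simp only [id, hSg] at h₁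
    have h₂ := h₁.unique (hasDerivAt_const t (arctan x))
    rw [hpΘ, hSu] at h₂
    refine mul_left_cancel₀ (hΩ x t).ne' ?_
    linear_combination h₂ - 1 / 2 * u x t ^ 2 * hSx x t
  have hux : ∀ x t, pdx u x t = 1 + pdx F (Sg x t) t * pdx Sg x t := by
    intro x t
    have h₁ := (hasDerivAt_id x).add
      (h.smooth_field.hasDerivAt_comp (hSs.hasDerivAt_fst x t) (hasDerivAt_const x t))
    rw [mul_zero, add_zero] at h₁
    rw [hu]
    exact h₁.deriv
  have hut : ∀ x t, pdt u x t = pdx F (Sg x t) t * pdt Sg x t + pdt F (Sg x t) t := by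
    intro x t
    have h₁ := (h.smooth_field.hasDerivAt_comp (hSs.hasDerivAt_snd x t)
      (hasDerivAt_id t)).const_add x
    rw [mul_one] at h₁
    rw [hu]
    exact h₁.deriv
  have hFσt : ∀ x t, pdx (pdt F) (Sg x t) t = u x t * pdx F (Sg x t) t := by
    intro x t
    rw [h.pdx_pdt_field hE (hEl _ _ (hlo x t) (hhi x t)), hpF, hSu, hSg]
    ring
  obtain ⟨Z, hZ⟩ : ∃ Z : ℝ → ℝ → ℝ, Z = fun x t => pdt F (Sg x t) t - 1 / 2 * u x t ^ 2 :=
    ⟨_, rfl⟩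
  have hZs : Smooth2 Z := by
    rw [hZ]
    exact ContDiff.sub (h.smooth_field.pdt.comp hSs hsnd) (contDiff_const.mul (ContDiff.pow hus 2))
  have hZx : ∀ x t, pdx Z x t = -1 * u x t := by
    intro x t
    have h₁ := (h.smooth_field.pdt.hasDerivAt_comp (hSs.hasDerivAt_fst x t)
      (hasDerivAt_const x t)).sub (((hus.hasDerivAt_fst x t).pow 2).const_mul (1 / 2))
    rw [hZ]
    refine h₁.deriv.trans ?_
    rw [hFσt, hux]
    push_cast
    ring
  have hZt : ∀ x t, pdt Z x t = 1 / 2 * u x t ^ 3 * (pdx u x t - 1) + pdt (pdt F) (Sg x t) t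
      - u x t * pdt u x t := by
    intro x t
    have h₁ := (h.smooth_field.pdt.hasDerivAt_comp (hSs.hasDerivAt_snd x t)
      (hasDerivAt_id t)).sub (((hus.hasDerivAt_snd x t).pow 2).const_mul (1 / 2))
    rw [hZ]
    refine h₁.deriv.trans ?_
    simp only [id]
    rw [hFσt, hSt, hux]
    push_cast
    ring
  obtain ⟨hsol, hutt⟩ := isSPESol_of_transport (ε := -1) hus hZs (fun x t => by
    rw [hut, hux, hSt, hZ]
    ring) hZx
  have hS0 : ∀ x, Sg x 0 = arctan x := fun x => by rw [← hSg x 0, h.angle_zero]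
  have hS00 : Sg 0 0 = 0 := by rw [hS0, arctan_zero]
  have hΘ0 : ∀ σ, pdx Θ σ 0 = 1 := by
    intro σ
    have e : (fun σ => Θ σ 0) = fun σ => σ := funext h.angle_zero
    rw [pdx, e]
    exact deriv_id σ
  have hux0 : ∀ x, pdx u x 0 = 1 + n (arctan x) := by
    intro x
    have h₁ := hSx x 0
    rw [hΘ0, one_mul] at h₁
    rw [hux, h₁, hpF, hS0, h.log_zero, h.angle_zero, ← hn]
    ring
  have hu0 : u 0 0 = f 0 := by rw [hu', hS00, hf, zero_add]
  have hft : ∀ t, pdt F 0 t = deriv f t := fun t => by rw [pdt, funext hf]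
  have hn0 : pdx u 0 0 = 1 + n 0 := by rw [hux0, arctan_zero]
  have hut0 : pdt u 0 0 = 1 / 2 * f 0 ^ 2 * n 0 + deriv f 0 := by
    have := hux 0 0
    rw [hut, hSt, hS00, hft, hu0]
    rw [hn0, hS00] at this
    linear_combination -(1 / 2 * f 0 ^ 2) * this
  refine ⟨u, hsol, hu0, hn0, ?_, hut0, ?_⟩
  · have h₁ : HasDerivAt (fun x => n (arctan x)) (n' * (1 / (1 + (0 : ℝ) ^ 2))) 0 :=
      HasDerivAt.comp (0 : ℝ) (h₂ := n) (h := arctan) (by rwa [arctan_zero]) (hasDerivAt_arctan 0)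
    have h₂ := h₁.const_add 1
    have e : pdx (pdx u) 0 0 = deriv (fun x => pdx u x 0) 0 := rfl
    rw [e, funext hux0, h₂.deriv]
    norm_num
  · have e : pdt (pdt F) 0 0 = deriv (fun t => pdt F 0 t) 0 := rfl
    rw [hutt, hZt, hS00, e, funext hft, hn0, hu0]
    ring

end IsLabelSystem

end LabelSolution

section LabelData

open Real Filter Topology

theorem exists_cutoff {s : ℝ} (hs : 0 < s) : ∃ χ : ℝ → ℝ, ContDiff ℝ (⊤ : ℕ∞) χ ∧
    (∀ x, 0 ≤ χ x) ∧ (∀ x, χ x ≤ 1) ∧ χ =ᶠ[𝓝 0] 1 ∧ ∀ x, s ≤ |x| → χ x = 0 := by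
  refine ⟨fun x => smoothTransition (2 - 2 * (x / s) ^ 2),
    smoothTransition.contDiff.comp (by fun_prop), fun _ => smoothTransition.nonneg _,
    fun _ => smoothTransition.le_one _, ?_, fun x hx => smoothTransition.zero_of_nonpos ?_⟩
  · have hc : ContinuousAt (fun x : ℝ => 2 - 2 * (x / s) ^ 2) 0 := by fun_prop
    filter_upwards [hc.tendsto.eventually_const_le (u := 1) (by norm_num)] with y hy
    exact smoothTransition.one_of_one_le hy
  · have : 1 ≤ |x / s| := by rwa [abs_div, abs_of_pos hs, one_le_div hs]
    rw [← sq_abs]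
    nlinarith

theorem exists_switching_field {δ : ℝ} (hδ : 0 < δ) (v a c : ℝ) :
    ∃ f : ℝ → ℝ, ContDiff ℝ (⊤ : ℕ∞) f ∧ f 0 = v ∧ deriv f 0 = a ∧ deriv (deriv f) 0 = c ∧
      (∀ t, |f t| ≤ |v| + 3) ∧ (∀ t, δ ≤ t → f t ≤ -2) ∧ ∀ t, t ≤ -δ → 2 ≤ f t := by
  obtain ⟨s, hs, hsδ, hs1, hsa⟩ : ∃ s : ℝ, 0 < s ∧ s ≤ δ ∧ s ≤ 1 ∧ (|a| + |c|) * s ≤ 1 := by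
    have h : 0 < 1 / (|a| + |c| + 1) := by positivity
    refine ⟨min δ (1 / (|a| + |c| + 1)), lt_min hδ h, min_le_left _ _, (min_le_right _ _).trans ?_,
      (mul_le_mul_of_nonneg_left (min_le_right _ _) (by positivity)).trans ?_⟩
    · rw [div_le_one (by positivity)]
      linarith [abs_nonneg a, abs_nonneg c]
    · rw [mul_one_div, div_le_one (by positivity)]
      linarith
  obtain ⟨χ, hχ, hχ0, hχ1, hχe, hχs⟩ := exists_cutoff hs
  obtain ⟨A, hA⟩ : ∃ A : ℝ → ℝ, ∀ t, A t = v + a * t + c / 2 * t ^ 2 := ⟨_, fun _ => rfl⟩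
  obtain ⟨g, hg⟩ : ∃ g : ℝ → ℝ, ∀ t, g t = 2 * smoothTransition (-(2 * t / δ) - 1)
    - 2 * smoothTransition (2 * t / δ - 1) := ⟨_, fun _ => rfl⟩
  have hAs : ContDiff ℝ (⊤ : ℕ∞) A := by rw [funext hA]; fun_prop
  have hgs : ContDiff ℝ (⊤ : ℕ∞) g := by
    rw [funext hg]
    exact (contDiff_const.mul (smoothTransition.contDiff.comp (by fun_prop))).sub
      (contDiff_const.mul (smoothTransition.contDiff.comp (by fun_prop)))
  obtain ⟨f, hf⟩ : ∃ f : ℝ → ℝ, ∀ t, f t = A t * χ t + g t := ⟨_, fun _ => rfl⟩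
  have hfA : f =ᶠ[𝓝 0] A := by
    have h₁ : ContinuousAt (fun t : ℝ => -(2 * t / δ) - 1) 0 := by fun_prop
    have h₂ : ContinuousAt (fun t : ℝ => 2 * t / δ - 1) 0 := by fun_prop
    filter_upwards [hχe, h₁.tendsto.eventually_le_const (u := 0) (by norm_num),
      h₂.tendsto.eventually_le_const (u := 0) (by norm_num)] with t h h₁ h₂
    rw [hf, hg, h, smoothTransition.zero_of_nonpos h₁, smoothTransition.zero_of_nonpos h₂,
      Pi.one_apply]
    ring
  have hAd : ∀ t, deriv A t = a + c * t := by
    intro t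
    rw [funext hA]
    refine ((((hasDerivAt_id t).const_mul a).const_add v).add
      (((hasDerivAt_id t).pow 2).const_mul (c / 2))).deriv.trans ?_
    simp only [id]
    push_cast
    ring
  have hg2 : ∀ t, |g t| ≤ 2 := fun t => by
    rw [hg, abs_le]
    constructor <;> linarith [smoothTransition.nonneg (-(2 * t / δ) - 1),
      smoothTransition.nonneg (2 * t / δ - 1), smoothTransition.le_one (-(2 * t / δ) - 1),
      smoothTransition.le_one (2 * t / δ - 1)]
  have hAb : ∀ t, |t| ≤ s → |A t| ≤ |v| + 1 := fun t ht => by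
    rw [hA]
    refine (abs_add_three _ _ _).trans ?_
    rw [abs_mul, abs_mul, abs_pow, abs_div, abs_two]
    have h₁ := mul_le_mul_of_nonneg_left ht (abs_nonneg a)
    have h₂ := mul_le_mul_of_nonneg_left ht (abs_nonneg c)
    have h₃ : |c| * |t| ^ 2 ≤ |c| * |t| := mul_le_mul_of_nonneg_left
      (by nlinarith [abs_nonneg t]) (abs_nonneg c)
    have h₄ : 0 ≤ |c| * |t| ^ 2 := by positivity
    linarith
  refine ⟨f, ?_, ?_, ?_, ?_, fun t => ?_, fun t ht => ?_, fun t ht => ?_⟩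
  · rw [funext hf]
    exact (hAs.mul hχ).add hgs
  · rw [hfA.eq_of_nhds, hA]
    ring
  · rw [hfA.deriv_eq, hAd]
    ring
  · rw [hfA.deriv.deriv_eq, funext hAd]
    refine (((hasDerivAt_id (0 : ℝ)).const_mul c).const_add a).deriv.trans ?_
    ring
  · rw [hf]
    refine (abs_add_le _ _).trans ?_
    have h : |A t * χ t| ≤ |v| + 1 := by
      rw [abs_mul, abs_of_nonneg (hχ0 t)]
      rcases le_or_gt |t| s with h | h
      · exact (mul_le_of_le_one_right (abs_nonneg _) (hχ1 t)).trans (hAb t h)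
      · rw [hχs t h.le, mul_zero]
        positivity
    linarith [hg2 t]
  · have h : 1 ≤ t / δ := by rwa [one_le_div hδ]
    rw [hf, hg, hχs t (hsδ.trans (ht.trans (le_abs_self t))), mul_div_assoc,
      smoothTransition.zero_of_nonpos (by linarith), smoothTransition.one_of_one_le (by linarith)]
    linarith
  · have h : 1 ≤ -t / δ := by
      rw [one_le_div hδ]
      linarith
    rw [neg_div] at h
    rw [hf, hg, hχs t (hsδ.trans (by linarith [neg_le_abs t])), mul_div_assoc,
      smoothTransition.one_of_one_le (by linarith), smoothTransition.zero_of_nonpos (by linarith)]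
    linarith

theorem exists_truncated_exp {Λ : ℝ} (hΛ : 0 < Λ) :
    ∃ E : ℝ → ℝ, ContDiff ℝ (⊤ : ℕ∞) E ∧ (∀ x, |x| < Λ → E x = exp (2 * x)) ∧
      (∀ x, |x| < Λ → deriv E x = 2 * E x) ∧ (∀ x, |E x| ≤ exp (4 * Λ)) ∧
      ∃ L : ℝ, ∀ x y, |E x - E y| ≤ L * |x - y| := by
  obtain ⟨χ, hχ⟩ : ∃ χ : ℝ → ℝ, ∀ x, χ x = smoothTransition (2 - (x / Λ) ^ 2) :=
    ⟨_, fun _ => rfl⟩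
  have hχs : ContDiff ℝ (⊤ : ℕ∞) χ := by
    rw [funext hχ]
    exact smoothTransition.contDiff.comp (by fun_prop)
  have hχ1 : ∀ x, |x| < Λ → χ x = 1 := fun x hx => by
    rw [hχ]
    have : |x / Λ| < 1 := by rwa [abs_div, abs_of_pos hΛ, div_lt_one hΛ]
    exact smoothTransition.one_of_one_le (by nlinarith [sq_lt_one_iff_abs_lt_one (x / Λ)|>.2 this])
  have hχ0 : ∀ x, 2 * Λ ≤ |x| → χ x = 0 := fun x hx => by
    rw [hχ]
    have : 2 ≤ |x / Λ| := by rwa [abs_div, abs_of_pos hΛ, le_div_iff₀ hΛ]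
    refine smoothTransition.zero_of_nonpos ?_
    rw [← sq_abs]
    nlinarith
  obtain ⟨E, hE⟩ : ∃ E : ℝ → ℝ, ∀ x, E x = exp (2 * x) * χ x := ⟨_, fun _ => rfl⟩
  have hEs : ContDiff ℝ (⊤ : ℕ∞) E := by
    rw [funext hE]
    exact ContDiff.mul (by fun_prop) hχs
  have hEe : ∀ x, |x| < Λ → E x = exp (2 * x) := fun x hx => by rw [hE, hχ1 x hx, mul_one]
  have hsupp : HasCompactSupport E := by
    refine HasCompactSupport.intro (isCompact_Icc (a := -(2 * Λ)) (b := 2 * Λ)) fun x hx => ?_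
    rw [hE, hχ0 x (le_of_not_gt fun h => hx (abs_le.1 h.le)), mul_zero]
  refine ⟨E, hEs, hEe, fun x hx => ?_, fun x => ?_, ?_⟩
  · have he : E =ᶠ[𝓝 x] fun x => exp (2 * x) := by
      filter_upwards [continuous_abs.continuousAt.eventually_lt_const hx] with y hy
      exact hEe y hy
    rw [he.deriv_eq, hEe x hx]
    refine ((hasDerivAt_id x).const_mul 2).exp.deriv.trans ?_
    simp only [id]
    ring
  · rw [hE, abs_mul, abs_of_pos (exp_pos _)]
    rcases le_or_gt (2 * Λ) |x| with h | h
    · rw [hχ0 x h, abs_zero, mul_zero]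
      exact (exp_pos _).le
    · rw [hχ, abs_of_nonneg (smoothTransition.nonneg _)]
      refine (mul_le_of_le_one_right (exp_pos _).le (smoothTransition.le_one _)).trans
        (exp_le_exp.2 ?_)
      linarith [le_abs_self x]
  · obtain ⟨L, hL⟩ := ContDiff.lipschitzWith_of_hasCompactSupport hsupp hEs (by simp)
    exact ⟨L, fun x y => by simpa [Real.dist_eq] using hL.dist_le_mul x y⟩

theorem abs_integral_le_of_support {g : ℝ → ℝ} (hg : Continuous g) {K s : ℝ} (hs : 0 ≤ s)
    (hK : ∀ x, |g x| ≤ K) (h0 : ∀ x, s ≤ |x| → g x = 0) (σ : ℝ) :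
    |∫ x in 0..σ, g x| ≤ K * s := by
  have hK' : ∀ m, |m| ≤ s → |∫ x in 0..m, g x| ≤ K * s := fun m hm => by
    have h := intervalIntegral.norm_integral_le_of_norm_le_const (a := 0) (b := m)
      (f := g) fun x _ => hK x
    rw [sub_zero] at h
    exact h.trans (mul_le_mul_of_nonneg_left hm ((abs_nonneg _).trans (hK 0)))
  have hsplit : ∀ m, |m| ≤ s → (∀ x ∈ Set.uIcc m σ, s ≤ |x|) → |∫ x in 0..σ, g x| ≤ K * s := by
    intro m hm hx
    rw [← intervalIntegral.integral_add_adjacent_intervals (hg.intervalIntegrable 0 m)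
      (hg.intervalIntegrable m σ), intervalIntegral.integral_congr (g := fun _ => 0)
      fun x hxm => h0 x (hx x hxm), intervalIntegral.integral_zero, add_zero]
    exact hK' m hm
  rcases le_or_gt |σ| s with h | h
  · exact hK' σ h
  · rcases lt_abs.1 h with h | h
    · refine hsplit s (abs_of_nonneg hs).le fun x hx => ?_
      rw [Set.uIcc_of_le h.le] at hx
      exact hx.1.trans (le_abs_self x)
    · refine hsplit (-s) (by rw [abs_neg, abs_of_nonneg hs]) fun x hx => ?_
      rw [Set.uIcc_of_ge (by linarith)] at hx
      linarith [hx.2, neg_le_abs x]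

end LabelData

section NegativeCase

open Real Filter Topology

/-- A charge density concentrated near the origin with prescribed slope there. -/
theorem exists_thin_charge {p r s : ℝ} (hs : 0 < s) (hr1 : |r| * s ≤ 1) (hr2 : |r| * s ≤ (p + 1) / 2) :
    ∃ n : ℝ → ℝ, ContDiff ℝ (⊤ : ℕ∞) n ∧ n 0 = p - 1 ∧ HasDerivAt n r 0 ∧
      (∀ σ, |n σ| ≤ |p - 1| + 1) ∧ (∀ σ, min 2 ((p + 1) / 2) ≤ 2 + n σ) ∧
      ∀ σ, s ≤ |σ| → n σ = 0 := by
  obtain ⟨χ, hχ, hχ0, hχ1, hχe, hχs⟩ := exists_cutoff hs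
  obtain ⟨n, hn⟩ : ∃ n : ℝ → ℝ, ∀ σ, n σ = (p - 1 + r * σ) * χ σ := ⟨_, fun _ => rfl⟩
  have hne : n =ᶠ[𝓝 0] fun σ => p - 1 + r * σ := by
    filter_upwards [hχe] with σ h
    rw [hn, h, Pi.one_apply, mul_one]
  have hrσ : ∀ σ, |σ| < s → |r * σ| ≤ |r| * s := fun σ h => by
    rw [abs_mul]
    exact mul_le_mul_of_nonneg_left h.le (abs_nonneg r)
  refine ⟨n, ?_, ?_, ?_, fun σ => ?_, fun σ => ?_, fun σ h => by rw [hn, hχs σ h, mul_zero]⟩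
  · rw [funext hn]
    exact ContDiff.mul (by fun_prop) hχ
  · rw [hne.eq_of_nhds]
    ring
  · refine HasDerivAt.congr_of_eventuallyEq ?_ hne
    exact (((hasDerivAt_id (0 : ℝ)).const_mul r).const_add (p - 1)).congr_deriv (mul_one r)
  · rcases le_or_gt s |σ| with h | h
    · rw [hn, hχs σ h, mul_zero, abs_zero]
      positivity
    · rw [hn, abs_mul, abs_of_nonneg (hχ0 σ)]
      refine (mul_le_of_le_one_right (abs_nonneg _) (hχ1 σ)).trans ((abs_add_le _ _).trans ?_)
      linarith [hrσ σ h]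
  · rcases le_or_gt s |σ| with h | h
    · rw [hn, hχs σ h, mul_zero, add_zero]
      exact min_le_left _ _
    · have h₁ := (abs_le.1 (hrσ σ h)).1
      have h₂ := min_le_left 2 ((p + 1) / 2)
      have h₃ := min_le_right 2 ((p + 1) / 2)
      rw [hn]
      nlinarith [hχ0 σ, hχ1 σ, mul_nonneg (hχ0 σ)
        (by linarith : 0 ≤ 2 + (p - 1 + r * σ) - min 2 ((p + 1) / 2)),
        mul_nonneg (sub_nonneg.2 (hχ1 σ)) (sub_nonneg.2 h₂)]

/-- A smooth function agreeing with `1 / cos⁴` near the origin. -/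
theorem exists_inv_cos_pow : ∃ g : ℝ → ℝ, ContDiff ℝ (⊤ : ℕ∞) g ∧
    ∀ σ, |σ| ≤ 1 / 4 → g σ * cos σ ^ 4 = 1 := by
  refine ⟨fun σ => (cos σ ^ 4 + smoothTransition (σ ^ 2 - 1))⁻¹, ContDiff.inv ?_ fun σ => ?_,
    fun σ h => ?_⟩
  · exact ContDiff.add (by fun_prop) (smoothTransition.contDiff.comp (by fun_prop))
  · rcases le_or_gt |σ| 1 with h | h
    · have hc : 0 < cos σ := cos_pos_of_mem_Ioo
        ⟨by linarith [(abs_le.1 h).1, pi_gt_three], by linarith [(abs_le.1 h).2, pi_gt_three]⟩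
      exact (add_pos_of_pos_of_nonneg (by positivity) (smoothTransition.nonneg _)).ne'
    · have : 0 < σ ^ 2 - 1 := by
        rw [← sq_abs]
        nlinarith
      exact (add_pos_of_nonneg_of_pos (by positivity) (smoothTransition.pos_of_pos this)).ne'
  · have hc : 0 < cos σ := cos_pos_of_mem_Ioo
        ⟨by linarith [(abs_le.1 h).1, pi_gt_three], by linarith [(abs_le.1 h).2, pi_gt_three]⟩
    have : σ ^ 2 - 1 ≤ 0 := by
      rw [← sq_abs]
      nlinarith [abs_nonneg σ]
    simp only
    rw [smoothTransition.zero_of_nonpos this, add_zero]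
    exact inv_mul_cancel₀ (by positivity)

end NegativeCase

section NegativeCase

open Real Filter Topology

theorem exists_time_scale {c N : ℝ} (hc : 0 < c) (hN : 1 ≤ N) :
    ∃ δ : ℝ, 0 < δ ∧ exp (4 * (c * δ)) ≤ 1 + 1 / (N + 1) := by
  have hlog : 0 < log (1 + 1 / (N + 1)) :=
    log_pos (by linarith [show 0 < 1 / (N + 1) by positivity])
  refine ⟨log (1 + 1 / (N + 1)) / (4 * c), by positivity, ?_⟩
  rw [← le_log_iff_exp_le (by positivity), ← mul_assoc, mul_div_cancel₀ _ (by positivity)]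

theorem exists_label_width {R y N K : ℝ} (hR : 0 ≤ R) (hy : 0 < y) (hN : 0 < N) (hK : 0 < K) :
    ∃ s : ℝ, 0 < s ∧ s ≤ 1 / 4 ∧ R * s ≤ 1 ∧ R * s ≤ y ∧ s ≤ N ∧ s ≤ K := by
  have hr : ∀ {s z : ℝ}, 0 ≤ s → s ≤ z / (R + 1) → R * s ≤ z := fun h₀ h => by
    rw [le_div_iff₀ (by positivity)] at h
    linarith
  have hpos : 0 < min (1 / 4) (min (1 / (R + 1)) (min (y / (R + 1)) (min N K))) := by positivity
  refine ⟨_, hpos, min_le_left _ _, hr hpos.le ?_, hr hpos.le ?_, ?_, ?_⟩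
  · exact (min_le_right _ _).trans (min_le_left _ _)
  · exact (min_le_right _ _).trans ((min_le_right _ _).trans (min_le_left _ _))
  · exact (min_le_right _ _).trans ((min_le_right _ _).trans
      ((min_le_right _ _).trans (min_le_left _ _)))
  · exact (min_le_right _ _).trans ((min_le_right _ _).trans
      ((min_le_right _ _).trans (min_le_right _ _)))

theorem lt_cos_pow_four {N s σ : ℝ} (hN : 1 ≤ N) (hs4 : s ≤ 1 / 4) (hsN : s ≤ 1 / (N + 1))
    (hσ : |σ| < s) : 1 - 1 / (2 * (N + 1)) < cos σ ^ 4 := by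
  have hσ0 := abs_nonneg σ
  have h₁ := one_sub_sq_div_two_le_cos (x := σ)
  have h₂ : σ ^ 2 < s ^ 2 := by
    rw [← sq_abs]
    nlinarith
  have h₃ : 2 * s ^ 2 ≤ 1 / (2 * (N + 1)) := by
    rw [one_div, mul_inv, ← one_div (N + 1)]
    nlinarith
  have h₅ : s ^ 2 ≤ 1 / 16 := by nlinarith
  have h₄ : 1 - σ ^ 2 ≤ cos σ ^ 2 := by nlinarith [sq_nonneg (σ ^ 2)]
  have h₆ : (1 - σ ^ 2) ^ 2 ≤ (cos σ ^ 2) ^ 2 := pow_le_pow_left₀ (by linarith) h₄ 2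
  nlinarith [sq_nonneg (σ ^ 2)]

theorem charge_density_lt_one {κ n l N c₄ ε : ℝ} (hN : 1 ≤ N) (hn : n ≤ N) (hn2 : 0 < 2 + n)
    (hc : 1 - 1 / (2 * (N + 1)) < c₄) (hc0 : 0 < c₄) (hκ : κ * c₄ = n * (2 + n))
    (hl : exp (2 * l) * (2 + n) = 1) (hε : exp ε ≤ 1 + 1 / (N + 1)) :
    κ * exp (4 * l + ε) < 1 := by
  rw [exp_add, show 4 * l = 2 * l + 2 * l by ring, exp_add]
  refine lt_of_mul_lt_mul_right (a := c₄ * (2 + n)) ?_ (mul_pos hc0 hn2).le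
  have e : κ * (exp (2 * l) * exp (2 * l) * exp ε) * (c₄ * (2 + n)) = n * exp ε := by
    linear_combination exp ε * (κ * c₄ * exp (2 * l) * hl + exp (2 * l) * hκ + n * hl)
  rw [e, one_mul]
  rcases le_or_gt n 0 with h₀ | h₀
  · exact (mul_nonpos_of_nonpos_of_nonneg h₀ (exp_pos _).le).trans_lt (mul_pos hc0 hn2)
  · refine (mul_le_mul_of_nonneg_left hε h₀.le).trans_lt ?_
    refine lt_of_lt_of_le ?_ (mul_le_mul_of_nonneg_right hc.le hn2.le)
    rw [one_div (2 * _), mul_inv, ← one_div (N + 1)]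
    have h₂ : 1 / (N + 1) * (N + 1) = 1 := one_div_mul_cancel (by positivity)
    have h₃ : 0 < 1 / (N + 1) := by positivity
    nlinarith

/-- Initial data for the label system. -/
theorem exists_label_data {p : ℝ} (hp : -1 < p) (r : ℝ) {c : ℝ} (hc0 : 0 < c) :
    ∃ (δ k M L : ℝ) (κ l₀ E n : ℝ → ℝ), 0 < δ ∧ k * M ≤ 1 ∧ ContDiff ℝ (⊤ : ℕ∞) κ ∧
      ContDiff ℝ (⊤ : ℕ∞) l₀ ∧ ContDiff ℝ (⊤ : ℕ∞) E ∧ n 0 = p - 1 ∧ HasDerivAt n r 0 ∧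
      (∀ σ, |∫ s in 0..σ, (|κ s|)| ≤ k) ∧ (∀ x, |E x| ≤ M) ∧
      (∀ x y, |E x - E y| ≤ L * |x - y|) ∧
      (∀ σ, κ σ ≠ 0 → |σ| ≤ 1 / 4 ∧ κ σ * exp (4 * l₀ σ + 4 * (c * δ)) < 1) ∧
      (∀ σ, exp (2 * l₀ σ) + 1 / 2 * κ σ * (exp (2 * l₀ σ) * cos σ ^ 2) ^ 2 = 1 / 2) ∧
      (∀ σ, κ σ * (E (l₀ σ) * cos σ ^ 4) = n σ) ∧
      ∀ σ x, |x - l₀ σ| ≤ c * (δ + 16) → E x = exp (2 * x) ∧ deriv E x = 2 * E x := by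
  set N := |p - 1| + 1 with hN
  have hN1 : 1 ≤ N := by linarith [abs_nonneg (p - 1)]
  set m := min 2 ((p + 1) / 2) with hm
  have hm0 : 0 < m := lt_min two_pos (by linarith)
  obtain ⟨δ, hδ, hδc⟩ := exists_time_scale hc0 hN1
  set Λ := |log m| + |log (2 + N)| + c * (δ + 16) with hΛ
  have hΛc : 0 < c * (δ + 16) := by positivity
  obtain ⟨E, hE, hEe, hE', hEM, L, hEL⟩ := exists_truncated_exp
    (show 0 < Λ + 1 by positivity)
  have hM0 : 0 < exp (4 * (Λ + 1)) := exp_pos _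
  set M := exp (4 * (Λ + 1)) with hM
  set K := 2 * N * (2 + N) with hK
  have hK0 : 0 < K := by positivity
  obtain ⟨s, hs, hs4, hsr1, hsr2, hsN, hsK⟩ := exists_label_width (abs_nonneg r)
    (show 0 < (p + 1) / 2 by linarith) (show 0 < 1 / (N + 1) by positivity)
    (show 0 < 1 / (K * M) by positivity)
  obtain ⟨n, hns, hn0, hn', hnN, hnm, hnz⟩ := exists_thin_charge hs hsr1 hsr2
  obtain ⟨g, hgs, hg⟩ := exists_inv_cos_pow
  have hn2 : ∀ σ, 0 < 2 + n σ := fun σ => hm0.trans_le (hnm σ)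
  obtain ⟨κ, hκ⟩ : ∃ κ : ℝ → ℝ, ∀ σ, κ σ = n σ * (2 + n σ) * g σ := ⟨_, fun _ => rfl⟩
  obtain ⟨l₀, hl₀⟩ : ∃ l₀ : ℝ → ℝ, ∀ σ, l₀ σ = -(1 / 2) * log (2 + n σ) := ⟨_, fun _ => rfl⟩
  have hκs : ContDiff ℝ (⊤ : ℕ∞) κ := by
    rw [funext hκ]
    exact (hns.mul (contDiff_const.add hns)).mul hgs
  have hl₀s : ContDiff ℝ (⊤ : ℕ∞) l₀ := by
    rw [funext hl₀]
    exact contDiff_const.mul ((contDiff_const.add hns).log fun σ => (hn2 σ).ne')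
  have hexp : ∀ σ, exp (2 * l₀ σ) * (2 + n σ) = 1 := fun σ => by
    rw [hl₀, show 2 * (-(1 / 2) * log (2 + n σ)) = -log (2 + n σ) by ring, exp_neg,
      exp_log (hn2 σ), inv_mul_cancel₀ (hn2 σ).ne']
  have hκc : ∀ σ, κ σ * cos σ ^ 4 = n σ * (2 + n σ) := fun σ => by
    rcases le_or_gt s |σ| with h | h
    · rw [hκ, hnz σ h]
      ring
    · rw [hκ, mul_assoc, hg σ (h.le.trans hs4), mul_one]
  have hκz : ∀ σ, s ≤ |σ| → κ σ = 0 := fun σ h => by rw [hκ, hnz σ h]; ring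
  have hcos4 : ∀ σ, |σ| < s → 1 - 1 / (2 * (N + 1)) < cos σ ^ 4 := fun σ h =>
    lt_cos_pow_four hN1 hs4 hsN h
  have hN12 : 1 / (2 * (N + 1)) ≤ 1 / 4 :=
    one_div_le_one_div_of_le (by norm_num) (by linarith)
  have hκK : ∀ σ, |κ σ| ≤ K := by
    intro σ
    rcases le_or_gt s |σ| with h | h
    · rw [hκz σ h, abs_zero]
      exact hK0.le
    · have h₁ := hcos4 σ h
      have h₂ : |κ σ| * cos σ ^ 4 = |n σ| * (2 + n σ) := by
        have h₄ : 0 ≤ cos σ ^ 4 := by positivity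
        rw [← abs_of_nonneg h₄, ← abs_mul, hκc, abs_mul, abs_of_pos (hn2 σ)]
      have h₃ : |n σ| * (2 + n σ) ≤ N * (2 + N) :=
        mul_le_mul (hnN σ) (by linarith [le_abs_self (n σ), hnN σ]) (hn2 σ).le (by positivity)
      nlinarith [abs_nonneg (κ σ)]
  have hl₀b : ∀ σ, |l₀ σ| ≤ |log m| + |log (2 + N)| := by
    intro σ
    have h₁ := log_le_log hm0 (hnm σ)
    have h₂ := log_le_log (hn2 σ) (by linarith [le_abs_self (n σ), hnN σ] : 2 + n σ ≤ 2 + N)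
    rw [hl₀, abs_mul, abs_neg, abs_of_pos (by norm_num : (0 : ℝ) < 1 / 2)]
    have h₃ : |log (2 + n σ)| ≤ |log m| + |log (2 + N)| := abs_le.2
      ⟨by linarith [neg_abs_le (log m), abs_nonneg (log (2 + N))],
        by linarith [le_abs_self (log (2 + N)), abs_nonneg (log m)]⟩
    linarith [abs_nonneg (log (2 + n σ))]
  have hEx : ∀ σ x, |x - l₀ σ| ≤ c * (δ + 16) → E x = exp (2 * x) ∧ deriv E x = 2 * E x := by
    intro σ x hx
    have h₂ := abs_add_le (x - l₀ σ) (l₀ σ)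
    rw [sub_add_cancel] at h₂
    have h₃ : |x| < Λ + 1 := by linarith [hl₀b σ]
    exact ⟨hEe x h₃, hE' x h₃⟩
  refine ⟨δ, K * s, M, L, κ, l₀, E, n, hδ, ?_, hκs, hl₀s, hE, hn0, hn', fun σ => ?_, hEM, hEL,
    fun σ hσ => ?_, fun σ => ?_, fun σ => ?_, hEx⟩
  · rw [le_div_iff₀ (by positivity)] at hsK
    linarith
  · exact abs_integral_le_of_support hκs.continuous.abs hs.le
      (fun σ => by rw [abs_abs]; exact hκK σ) (fun σ h => by rw [hκz σ h, abs_zero]) σ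
  · have h : |σ| < s := lt_of_not_ge fun h => hσ (hκz σ h)
    have h₁ := hcos4 σ h
    exact ⟨h.le.trans hs4, charge_density_lt_one hN1 ((le_abs_self _).trans (hnN σ)) (hn2 σ) h₁
      (by linarith) (hκc σ) (hexp σ) hδc⟩
  · linear_combination 1 / 2 * exp (2 * l₀ σ) ^ 2 * hκc σ
      + (1 / 2 + 1 / 2 * exp (2 * l₀ σ) * n σ) * hexp σ
  · rw [(hEx σ (l₀ σ) (by rw [sub_self, abs_zero]; exact hΛc.le)).1]
    linear_combination exp (2 * l₀ σ) * hκc σ + n σ * hexp σ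

theorem exists_isSPESol_neg_one_of_lt {p : ℝ} (hp : -1 < p) (v q r τ : ℝ) :
    ∃ u, IsSPESol (-1) (1 / 2) u ∧ u 0 0 = v ∧ pdx u 0 0 = p ∧ pdt u 0 0 = q ∧
      pdx (pdx u) 0 0 = r ∧ pdt (pdt u) 0 0 = τ := by
  set b := |v| + 4 with hb
  set c := 1 / 2 * (1 + b) ^ 2 with hc
  have hb0 : 0 ≤ b := by positivity
  have hc0 : 0 < c := by positivity
  obtain ⟨δ, k, M, L, κ, l₀, E, n, hδ, hkM, hκs, hl₀s, hE, hn0, hn', hk, hEM, hEL, hκσ, hbal, hn,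
    hEx⟩ := exists_label_data hp r hc0
  obtain ⟨f, hfs, hf0, hf1, hf2, hfB, hfneg, hfpos⟩ := exists_switching_field hδ v
    (q - 1 / 2 * v ^ 2 * (p - 1)) (τ - (v * q * p + 1 / 2 * v ^ 2 *
      (-1 * v + v * p ^ 2 + 1 / 2 * v ^ 2 * r)) - 1 / 2 * v ^ 3 * (p - 1) + v * q)
  obtain ⟨Θ, l, F, S, C, hΘs, hls, hFs, hS, hC, hΘ, hl, hFσ, hΘ0, hl0, hF0, hFf⟩ :=
    exists_label_system hκs hfs hl₀s hE hfB hk hEM hEL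
  have h : IsLabelSystem κ l₀ E Θ l F S C := ⟨hΘs, hls, hFs, hS, hC, hΘ, hl, hFσ, hΘ0, hl0⟩
  have hFf' : ∀ σ t, |F σ t - f t| ≤ 1 := fun σ t => (hFf σ t).trans hkM
  have hFb : ∀ σ t, |F σ t| ≤ b := fun σ t => by
    have := abs_add_le (F σ t - f t) (f t)
    rw [sub_add_cancel] at this
    linarith [hFf' σ t, hfB t]
  have hFneg : ∀ σ t, δ ≤ t → F σ t ≤ -1 := fun σ t ht => by
    linarith [hfneg t ht, (abs_le.1 (hFf' σ t)).2]
  have hFpos : ∀ σ t, t ≤ -δ → 1 ≤ F σ t := fun σ t ht => by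
    linarith [hfpos t ht, (abs_le.1 (hFf' σ t)).1]
  have hwin : ∀ σ t, κ σ ≠ 0 → -(π / 2) < Θ σ t → Θ σ t < π / 2 →
      |t| ≤ δ + 16 ∧ κ σ * (exp (2 * l σ t) * cos (Θ σ t) ^ 2) ^ 2 < 1 := fun σ t h₀ h₁ h₂ =>
    h.window (hFb σ) hδ.le (hFneg σ) (hFpos σ) (hκσ σ h₀).1 (hκσ σ h₀).2 h₁ h₂
  have hlx : ∀ σ t, |t| ≤ δ + 16 →
      E (l σ t) = exp (2 * l σ t) ∧ deriv E (l σ t) = 2 * E (l σ t) := fun σ t ht =>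
    hEx σ (l σ t) ((h.abs_log_sub_le (hFb σ) t).trans (mul_le_mul_of_nonneg_left ht hc0.le))
  have hpos : ∀ σ t, -(π / 2) < Θ σ t → Θ σ t < π / 2 → 0 < pdx Θ σ t := by
    intro σ t h₁ h₂
    have key : κ σ * (exp (2 * l σ t) * cos (Θ σ t) ^ 2) ^ 2 < 1 ∧
        ∀ τ ∈ Set.uIcc 0 t, κ σ * (E (l σ τ) - exp (2 * l σ τ)) = 0 := by
      by_cases h₀ : κ σ = 0
      · simp [h₀]
      · obtain ⟨ht, hlt⟩ := hwin σ t h₀ h₁ h₂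
        refine ⟨hlt, fun τ hτ => ?_⟩
        have h₃ := Set.abs_sub_left_of_mem_uIcc hτ
        rw [sub_zero, sub_zero] at h₃
        rw [(hlx σ τ (h₃.trans ht)).1, sub_self, mul_zero]
    have h₃ := h.exp_mul_pdx_angle key.2 (hbal σ)
    refine pos_of_mul_pos_right (a := exp (2 * l σ t)) ?_ (exp_pos _).le
    rw [h₃]
    linarith [key.1]
  obtain ⟨u, hu, hu0, hux, huxx, hut, hutt⟩ := h.exists_isSPESol hFb hpos
    (hE.differentiable (by simp)) (fun σ t h₁ h₂ => by
      by_cases h₀ : κ σ = 0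
      · rw [h₀, zero_mul]
      · rw [(hlx σ t (hwin σ t h₀ h₁ h₂).1).2, sub_self, mul_zero]) hF0
    hn hn'
  rw [hf0] at hu0
  rw [hn0, add_sub_cancel] at hux
  rw [hf0, hn0, hf1, add_sub_cancel] at hut
  refine ⟨u, hu, hu0, hux, hut, huxx, ?_⟩
  rw [hutt, hu0, hux, hut, huxx, hf0, hn0, hf2]
  ring

end NegativeCase

section Rescaling

theorem Smooth2.rescale {U : ℝ → ℝ → ℝ} (hU : Smooth2 U) (c ν x₀ t₀ : ℝ) :
    Smooth2 fun x t => c * U (x - x₀) (ν * (t - t₀)) :=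
  contDiff_const.mul (hU.comp (a := fun x _ => x - x₀) (b := fun _ t => ν * (t - t₀))
    (contDiff_fst.sub contDiff_const)
    (contDiff_const.mul (contDiff_snd.sub contDiff_const)))

theorem Smooth2.pdx_rescale {U : ℝ → ℝ → ℝ} (hU : Smooth2 U) (c ν x₀ t₀ : ℝ) :
    _root_.pdx (fun x t => c * U (x - x₀) (ν * (t - t₀))) =
      fun x t => c * _root_.pdx U (x - x₀) (ν * (t - t₀)) := by
  funext x t
  refine ((hU.hasDerivAt_comp ((hasDerivAt_id x).sub_const x₀)
    (hasDerivAt_const x (ν * (t - t₀)))).const_mul c).deriv.trans ?_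
  simp only [id]
  ring

theorem Smooth2.pdt_rescale {U : ℝ → ℝ → ℝ} (hU : Smooth2 U) (c ν x₀ t₀ : ℝ) :
    _root_.pdt (fun x t => c * U (x - x₀) (ν * (t - t₀))) =
      fun x t => c * ν * _root_.pdt U (x - x₀) (ν * (t - t₀)) := by
  funext x t
  refine ((hU.hasDerivAt_comp (hasDerivAt_const t (x - x₀))
    (((hasDerivAt_id t).sub_const t₀).const_mul ν)).const_mul c).deriv.trans ?_
  simp only [id]
  ring

theorem IsSPESol.rescale {a b α β c ν : ℝ} {U : ℝ → ℝ → ℝ} (hU : IsSPESol a b U)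
    (hα : a * ν = α) (hβ : b * ν = β * c ^ 2) (x₀ t₀ : ℝ) :
    IsSPESol α β fun x t => c * U (x - x₀) (ν * (t - t₀)) := by
  obtain ⟨hs, h⟩ := hU
  refine ⟨hs.rescale c ν x₀ t₀, fun x t => ?_⟩
  have h3 : Smooth2 fun x t => U x t ^ 3 := ContDiff.pow hs 3
  have e : (fun x t => (c * U (x - x₀) (ν * (t - t₀))) ^ 3) =
      fun x t => c ^ 3 * (fun x t => U x t ^ 3) (x - x₀) (ν * (t - t₀)) :=
    funext fun x => funext fun t => mul_pow _ _ _
  rw [hs.pdt_rescale, hs.pdt.pdx_rescale, e, h3.pdx_rescale, h3.pdx.pdx_rescale]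
  simp only [h]
  linear_combination c * U (x - x₀) (ν * (t - t₀)) * hα +
    c / 3 * pdx (pdx fun x t => U x t ^ 3) (x - x₀) (ν * (t - t₀)) * hβ

theorem exists_isSPESol_rescale {a b α β c ν v p q r τ : ℝ} (hα : a * ν = α)
    (hβ : b * ν = β * c ^ 2) (x₀ t₀ : ℝ)
    (hU : ∃ u, IsSPESol a b u ∧ u 0 0 = v ∧ pdx u 0 0 = p ∧ pdt u 0 0 = q ∧
      pdx (pdx u) 0 0 = r ∧ pdt (pdt u) 0 0 = τ) :
    ∃ u, IsSPESol α β u ∧ u x₀ t₀ = c * v ∧ pdx u x₀ t₀ = c * p ∧ pdt u x₀ t₀ = c * ν * q ∧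
      pdx (pdx u) x₀ t₀ = c * r ∧ pdt (pdt u) x₀ t₀ = c * ν * ν * τ := by
  obtain ⟨U, hU, rfl, rfl, rfl, rfl, rfl⟩ := hU
  refine ⟨_, hU.rescale hα hβ x₀ t₀, ?_, ?_, ?_, ?_, ?_⟩
  · simp only [sub_self, mul_zero]
  · rw [hU.1.pdx_rescale]
    simp only [sub_self, mul_zero]
  · rw [hU.1.pdt_rescale]
    simp only [sub_self, mul_zero]
  · rw [hU.1.pdx_rescale, hU.1.pdx.pdx_rescale]
    simp only [sub_self, mul_zero]
  · rw [hU.1.pdt_rescale, hU.1.pdt.pdt_rescale]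
    simp only [sub_self, mul_zero]

theorem exists_isSPESol_neg_one (v p q r τ : ℝ) :
    ∃ u, IsSPESol (-1) (1 / 2) u ∧ u 0 0 = v ∧ pdx u 0 0 = p ∧ pdt u 0 0 = q ∧
      pdx (pdx u) 0 0 = r ∧ pdt (pdt u) 0 0 = τ := by
  rcases lt_or_ge (-1) p with hp | hp
  · exact exists_isSPESol_neg_one_of_lt hp v q r τ
  · simpa using exists_isSPESol_rescale (c := -1) (ν := 1) (α := -1) (β := 1 / 2) (by norm_num)
      (by norm_num) 0 0
      (exists_isSPESol_neg_one_of_lt (p := -p) (by linarith) (-v) (-q) (-r) (-τ))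

theorem exists_isSPESol_of_normalized {ε α β : ℝ} (hε : ε ^ 2 = 1) (h : 0 < ε * α / β)
    (hU : ∀ v p q r τ : ℝ, ∃ u, IsSPESol ε (1 / 2) u ∧ u 0 0 = v ∧ pdx u 0 0 = p ∧ pdt u 0 0 = q ∧
      pdx (pdx u) 0 0 = r ∧ pdt (pdt u) 0 0 = τ) (x t v p q r τ : ℝ) :
    ∃ u, IsSPESol α β u ∧ u x t = v ∧ pdx u x t = p ∧ pdt u x t = q ∧
      pdx (pdx u) x t = r ∧ pdt (pdt u) x t = τ := by
  have hβ : β ≠ 0 := fun h₀ => by simp [h₀] at h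
  have hν : ε * α ≠ 0 := fun h₀ => by simp [h₀] at h
  have hc : 0 < √(ε * α / β / 2) := Real.sqrt_pos.2 (by positivity)
  have hc2 : √(ε * α / β / 2) ^ 2 = ε * α / β / 2 := Real.sq_sqrt (by positivity)
  set c := √(ε * α / β / 2)
  set ν := ε * α
  have := exists_isSPESol_rescale (a := ε) (b := 1 / 2) (c := c) (ν := ν) (α := α) (β := β)
    (by linear_combination α * hε) (by rw [hc2]; field_simp) x t
    (hU (v / c) (p / c) (q / (c * ν)) (r / c) (τ / (c * ν * ν)))
  have hcν : c * ν ≠ 0 := mul_ne_zero hc.ne' hν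
  rwa [mul_div_cancel₀ v hc.ne', mul_div_cancel₀ p hc.ne', mul_div_cancel₀ r hc.ne',
    mul_div_cancel₀ q hcν, mul_div_cancel₀ τ (mul_ne_zero hcν hν)] at this

theorem exists_isSPESol {α β : ℝ} (hα : α ≠ 0) (hβ : β ≠ 0) (x t v p q r τ : ℝ) :
    ∃ u, IsSPESol α β u ∧ u x t = v ∧ pdx u x t = p ∧ pdt u x t = q ∧
      pdx (pdx u) x t = r ∧ pdt (pdt u) x t = τ := by
  rcases lt_or_gt_of_ne (div_ne_zero hα hβ) with h | h
  · exact exists_isSPESol_of_normalized (ε := -1) (by norm_num)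
      (by rw [neg_one_mul, neg_div]; linarith) exists_isSPESol_neg_one x t v p q r τ
  · exact exists_isSPESol_of_normalized (ε := 1) (by norm_num) (by rwa [one_mul])
      exists_isSPESol_one x t v p q r τ

end Rescaling

/-- Classification of contact symmetries of the SPE: if a smooth characteristic
`Q(x,t,u,p,q)` on the first jet space, evaluated along every smooth solution `u`
as `Q̃(x,t) = Q(x,t,u,∂x u,∂t u)`, satisfies the linearized symmetry equation,
then `Q = C₁ p + C₂ q + C₃ (x p − t q − u)` for some constants `C₁, C₂, C₃`.
In particular every contact symmetry of the SPE is a point symmetry, and the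
point symmetry algebra is three-dimensional, spanned by the x-translation, the
t-translation, and the dilation. -/
theorem contact_symmetry_classification (α β : ℝ) (hα : α ≠ 0) (hβ : β ≠ 0)
    (Q : ℝ × ℝ × ℝ × ℝ × ℝ → ℝ) (hQ : ContDiff ℝ (⊤ : ℕ∞) Q)
    (hsym : ∀ u : ℝ → ℝ → ℝ, IsSPESol α β u →
      SatisfiesLinearized α β u
        (fun x t => Q (x, t, u x t, pdx u x t, pdt u x t))) :
    ∃ C₁ C₂ C₃ : ℝ, ∀ x t v p q : ℝ,
      Q (x, t, v, p, q) = C₁ * p + C₂ * q + C₃ * (x * p - t * q - v) := by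
  exact contact_symmetry_of_jets hα hβ (exists_isSPESol hα hβ) hQ hsym
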